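/- arXiv:2306.11328 — 4 statements merged into one kernel-verified Lean document; each statement's English description precedes it below -/
import Mathlib

section
/- Let n and k be integers with 0 ≤ k ≤ n/2 − 1, and let T be a tree of order n with exactly k branch vertices that has the minimum Mostar index among all such trees. Then T is isomorphic to C_{n,⌈k/2⌉,⌊k/2⌋}. -/
open Finset SimpleGraph

open scoped Classical

/-- ψ(uv) = |n_u - n_v| for an edge, as a symmetric function on `Sym2 V`. -/
noncomputable def mostarPsi {V : Type*} [Fintype V] (G : SimpleGraph V) : Sym2 V → ℕ :=
  Sym2.lift ⟨fun u v =>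
    (((Finset.univ.filter fun w => G.dist w u < G.dist w v).card : ℤ) -
      ((Finset.univ.filter fun w => G.dist w v < G.dist w u).card : ℤ)).natAbs,
    fun u v => by dsimp only; omega⟩

/-- The Mostar index of a graph. -/
noncomputable def mostar {V : Type*} [Fintype V] (G : SimpleGraph V) : ℕ :=
  ∑ e ∈ G.edgeFinset, mostarPsi G e

/-- The graph on `Fin n` determined by a parent function. -/
def parentGraph (n : ℕ) (p : ℕ → ℕ) : SimpleGraph (Fin n) :=
  SimpleGraph.fromRel (fun u v => p u.val = v.val)

/-- S_{n,r}: r pendent paths of almost equal lengths at a common vertex. -/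
def spiderS (n r : ℕ) : SimpleGraph (Fin n) :=
  parentGraph n (fun v => if v ≤ r then 0 else v - r)

/-- The star on n vertices. -/
def starG (n : ℕ) : SimpleGraph (Fin n) :=
  parentGraph n (fun _ => 0)

/-- C_{n,a,b}. -/
def catC (n a b : ℕ) : SimpleGraph (Fin n) :=
  parentGraph n (fun v =>
    if v < n - a - b then v - 1
    else if v < n - b then v - (n - a - b) + 1
    else v - a - b - 1)

/-- F_{n,a,b}. -/
def catF (n a b : ℕ) : SimpleGraph (Fin n) :=
  parentGraph n (fun v =>
    if v < n - a - b - 2 then v - 1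
    else if v = n - a - b - 2 then 1
    else if v < n - b then v - (n - a - b - 2)
    else v - a - b - 3)

/-- A^r_{n,a,b}. -/
def treeA (n r a b : ℕ) : SimpleGraph (Fin n) :=
  parentGraph n (fun v =>
    if v < n - (a + b) * r then v - 1
    else if v < n - b * r then (if (v - (n - (a + b) * r)) % r = 0 then 0 else v - 1)
    else (if (v - (n - b * r)) % r = 0 then n - (a + b) * r - 1 else v - 1))

/-- S^r_{n,k}: k pendent paths of length r and n - k*r - 1 pendent edges at a common vertex. -/
def treeSrk (n r k : ℕ) : SimpleGraph (Fin n) :=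
  parentGraph n (fun v =>
    if v < n - k * r then 0
    else if (v - (n - k * r)) % r = 0 then 0 else v - 1)

/-- Number of vertices of odd degree. -/
noncomputable def oddDegreeCount {V : Type*} [Fintype V] (G : SimpleGraph V) : ℕ :=
  (Finset.univ.filter fun v => Odd (G.degree v)).card

/-- Number of vertices of degree two. -/
noncomputable def degreeTwoCount {V : Type*} [Fintype V] (G : SimpleGraph V) : ℕ :=
  (Finset.univ.filter fun v => G.degree v = 2).card

/-- Number of branch vertices (degree at least three). -/
noncomputable def branchCount {V : Type*} [Fintype V] (G : SimpleGraph V) : ℕ :=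
  (Finset.univ.filter fun v => 3 ≤ G.degree v).card

/-- Number of pendent paths of length r in G. -/
noncomputable def pendentPathCount {V : Type*} [Fintype V] (G : SimpleGraph V) (r : ℕ) : ℕ :=
  Nat.card { u : Fin (r + 1) → V //
    Function.Injective u ∧
    (∀ i : Fin r, G.Adj (u i.castSucc) (u i.succ)) ∧
    G.degree (u 0) = 1 ∧ 2 ≤ G.degree (u (Fin.last r)) ∧
    ∀ i : Fin (r + 1), i ≠ 0 → i ≠ Fin.last r → G.degree (u i) = 2 }

namespace MB

/-- The vertices closer to `b` than to `a`. -/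
noncomputable def side {V : Type*} [Fintype V] (G : SimpleGraph V) (a b : V) : Finset V :=
  Finset.univ.filter fun w => G.dist w b < G.dist w a

/-- Size of the smaller side of an edge. -/
noncomputable def msz {V : Type*} [Fintype V] (G : SimpleGraph V) : Sym2 V → ℕ :=
  Sym2.lift ⟨fun u v => min (side G u v).card (side G v u).card, fun _ _ => min_comm _ _⟩

/-- Number of edges whose smaller side has size at most `j`. -/
noncomputable def cnt {V : Type*} [Fintype V] (G : SimpleGraph V) (j : ℕ) : ℕ :=
  (G.edgeFinset.filter fun e => msz G e ≤ j).card

/-- `U` is a vertex set separated from its complement by the single edge `ab`. -/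
structure IsCut {V : Type*} (G : SimpleGraph V) (U : Set V) (a b : V) : Prop where
  adj : G.Adj a b
  bmem : b ∈ U
  amem : a ∉ U
  cross : ∀ x ∈ U, ∀ y, y ∉ U → G.Adj x y → x = b ∧ y = a

section
variable {V : Type*} {G : SimpleGraph V}

lemma IsCut.compl {U : Set V} {a b : V} (h : IsCut G U a b) : IsCut G Uᶜ b a where
  adj := h.adj.symm
  bmem := h.amem
  amem := fun h' => h' h.bmem
  cross := fun x hx y hy hxy => by
    have hy' : y ∈ U := by simpa using hy
    exact (h.cross y hy' x hx hxy.symm).symm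

lemma IsCut.walk_len {U : Set V} {a b : V} (h : IsCut G U a b) (hc : G.Connected) {x z : V}
    (p : G.Walk x z) (hz : z = a) (hx : x ∈ U) : G.dist x b + 1 ≤ p.length := by
  induction p with
  | nil => subst hz; exact absurd hx h.amem
  | @cons x y z hxy p ih =>
    by_cases hy : y ∈ U
    · have h1 := ih hz hy
      have h2 := hc.dist_triangle (u := x) (v := y) (w := b)
      have h3 : G.dist x y = 1 := dist_eq_one_iff_adj.2 hxy
      simp only [Walk.length_cons]; omega
    · obtain ⟨rfl, rfl⟩ := h.cross x hx y hy hxy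
      simp

lemma IsCut.lt {U : Set V} {a b : V} (h : IsCut G U a b) (hc : G.Connected) {x : V}
    (hx : x ∈ U) : G.dist x b < G.dist x a := by
  obtain ⟨p, hp⟩ := hc.exists_walk_length_eq_dist x a
  have := h.walk_len hc p rfl hx
  omega

lemma IsCut.mem_iff {U : Set V} {a b : V} (h : IsCut G U a b) (hc : G.Connected) {x : V} :
    x ∈ U ↔ G.dist x b < G.dist x a := by
  refine ⟨h.lt hc, fun h1 => ?_⟩
  by_contra h2
  have := h.compl.lt hc (x := x) h2
  omega

lemma exists_cut (hG : G.IsTree) {a b : V} (hab : G.Adj a b) : ∃ U, IsCut G U a b := by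
  have hb : G.IsBridge s(a, b) := isAcyclic_iff_forall_adj_isBridge.1 hG.isAcyclic hab
  refine ⟨{x | (G.deleteEdges {s(a, b)}).Reachable b x}, hab, Reachable.refl _, ?_, ?_⟩
  · intro h
    exact isBridge_iff.1 hb h.symm
  · intro x hx y hy hxy
    by_contra hne
    apply hy
    refine Reachable.trans hx (Adj.reachable ?_)
    rw [deleteEdges_adj]
    refine ⟨hxy, ?_⟩
    intro h
    have h' : s(x, y) = s(a, b) := h
    rw [Sym2.eq_iff] at h'
    rcases h' with ⟨rfl, rfl⟩ | ⟨rfl, rfl⟩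
    · exact hy (Reachable.refl _)
    · exact hne ⟨rfl, rfl⟩

variable [Fintype V]

lemma mem_side {a b x : V} : x ∈ side G a b ↔ G.dist x b < G.dist x a := by
  simp [side]

lemma IsCut.eq_side {U : Finset V} {a b : V} (h : IsCut G (U : Set V) a b) (hc : G.Connected) :
    U = side G a b := by
  ext x
  rw [mem_side, ← h.mem_iff hc]; rfl

lemma isCut_side (hG : G.IsTree) {a b : V} (hab : G.Adj a b) :
    IsCut G (side G a b : Set V) a b := by
  obtain ⟨U, hU⟩ := exists_cut hG hab
  have : U = (side G a b : Set V) := by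
    ext x
    rw [hU.mem_iff hG.1]; simp [mem_side]
  rwa [← this]

lemma IsCut.side_compl {U : Finset V} {a b : V} (h : IsCut G (U : Set V) a b) (hc : G.Connected) :
    Uᶜ = side G b a := by
  apply IsCut.eq_side _ hc
  have := h.compl
  simpa using this

lemma side_compl (hG : G.IsTree) {a b : V} (hab : G.Adj a b) :
    (side G a b)ᶜ = side G b a := (isCut_side hG hab).side_compl hG.1

lemma card_side_add (hG : G.IsTree) {a b : V} (hab : G.Adj a b) :
    (side G a b).card + (side G b a).card = Fintype.card V := by
  rw [← side_compl hG hab, Finset.card_add_card_compl]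

lemma mem_side_swap (hG : G.IsTree) {a b : V} (hab : G.Adj a b) {x : V} :
    x ∈ side G b a ↔ x ∉ side G a b := by
  rw [← side_compl hG hab, Finset.mem_compl]

lemma self_mem_side {a b : V} (hc : G.Connected) (hab : G.Adj a b) : b ∈ side G a b := by
  rw [mem_side, dist_self]
  exact hc.pos_dist_of_ne hab.ne'

lemma not_mem_side {a b : V} : a ∉ side G a b := by
  rw [mem_side, dist_self]; omega

lemma side_cross (hG : G.IsTree) {a b x y : V} (hab : G.Adj a b) (hx : x ∈ side G a b)
    (hy : y ∉ side G a b) (hxy : G.Adj x y) : x = b ∧ y = a :=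
  (isCut_side hG hab).cross x hx y hy hxy

/-- neighbours of `b` other than `a` -/
noncomputable def ch (G : SimpleGraph V) (a b : V) : Finset V := (G.neighborFinset b).erase a

lemma mem_ch {a b c : V} : c ∈ ch G a b ↔ c ≠ a ∧ G.Adj b c := by
  simp [ch]

lemma card_ch {a b : V} (hab : G.Adj a b) : (ch G a b).card + 1 = G.degree b := by
  unfold ch
  rw [Finset.card_erase_add_one, card_neighborFinset_eq_degree]
  simpa using hab.symm

lemma side_disj (hG : G.IsTree) {b c c' : V} (hc : G.Adj b c) (hc' : G.Adj b c') (hne : c ≠ c') :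
    Disjoint (side G b c) (side G b c') := by
  have h1 : IsCut G ((side G b c \ side G b c' : Finset V) : Set V) b c := by
    refine ⟨hc, ?_, ?_, ?_⟩
    · have h2 : c ∉ side G b c' := fun h =>
        hne (side_cross hG hc' h not_mem_side hc.symm).1
      simp [self_mem_side hG.1 hc, h2]
    · simp [not_mem_side]
    · intro x hx y hy hxy
      simp only [Finset.coe_sdiff, Set.mem_sdiff, Finset.mem_coe] at hx hy
      by_cases hyc : y ∈ side G b c
      · have hy2 : y ∈ side G b c' := by
          by_contra h; exact hy ⟨hyc, h⟩
        have := (side_cross hG hc' hy2 hx.2 hxy.symm).2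
        subst this
        exact absurd hx.1 not_mem_side
      · exact side_cross hG hc hx.1 hyc hxy
  have h2 := h1.eq_side hG.1
  rw [← h2]
  exact Finset.sdiff_disjoint

lemma side_eq (hG : G.IsTree) {a b : V} (hab : G.Adj a b) :
    side G a b = insert b ((ch G a b).biUnion fun c => side G b c) := by
  symm
  apply IsCut.eq_side _ hG.1
  refine ⟨hab, by simp, ?_, ?_⟩
  · simp only [Finset.coe_insert, Finset.coe_biUnion, Set.mem_insert_iff, Set.mem_iUnion, not_or,
      Finset.mem_coe]
    refine ⟨hab.ne, ?_⟩
    rintro ⟨c, hc, ha⟩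
    rw [mem_ch] at hc
    exact hc.1 (side_cross hG hc.2 ha not_mem_side hab).1.symm
  · intro x hx y hy hxy
    simp only [Finset.coe_insert, Finset.coe_biUnion, Set.mem_insert_iff, Set.mem_iUnion, not_or,
      Finset.mem_coe, not_exists, exists_prop] at hx hy
    rcases hx with rfl | ⟨c, hc, hx⟩
    · refine ⟨rfl, ?_⟩
      by_contra hya
      have hyc : y ∈ ch G a x := mem_ch.2 ⟨hya, hxy⟩
      exact hy.2 y ⟨hyc, self_mem_side hG.1 hxy⟩
    · have hyc : y ∉ side G b c := fun h => hy.2 c ⟨hc, h⟩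
      exact absurd (side_cross hG (mem_ch.1 hc).2 hx hyc hxy).2 hy.1

lemma side_sub (hG : G.IsTree) {a b c : V} (hab : G.Adj a b) (hc : c ∈ ch G a b) :
    side G b c ⊆ side G a b := by
  rw [side_eq hG hab]
  intro x hx
  simp only [Finset.mem_insert, Finset.mem_biUnion]
  exact Or.inr ⟨c, hc, hx⟩

lemma sum_side (hG : G.IsTree) {a b : V} (hab : G.Adj a b) (f : V → ℕ) :
    ∑ x ∈ side G a b, f x = f b + ∑ c ∈ ch G a b, ∑ x ∈ side G b c, f x := by
  rw [side_eq hG hab, Finset.sum_insert, Finset.sum_biUnion]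
  · intro c hc c' hc' hne
    exact side_disj hG (mem_ch.1 hc).2 (mem_ch.1 hc').2 hne
  · simp only [Finset.mem_biUnion, not_exists, not_and]
    intro c hc
    exact not_mem_side

lemma card_side (hG : G.IsTree) {a b : V} (hab : G.Adj a b) :
    (side G a b).card = 1 + ∑ c ∈ ch G a b, (side G b c).card := by
  have := sum_side hG hab (fun _ => 1)
  simpa using this

/-- edges touching `side a b` -/
noncomputable def tch (G : SimpleGraph V) (a b : V) : Finset (Sym2 V) :=
  G.edgeFinset.filter fun e => ∃ x ∈ side G a b, x ∈ e

lemma tch_eq (hG : G.IsTree) {a b : V} (hab : G.Adj a b) :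
    tch G a b = insert s(a, b) ((ch G a b).biUnion fun c => tch G b c) := by
  ext e
  induction e using Sym2.ind with
  | _ u v =>
  simp only [tch, Finset.mem_filter, Finset.mem_insert, Finset.mem_biUnion, mem_edgeFinset,
    mem_edgeSet]
  constructor
  · rintro ⟨huv, x, hx, hxe⟩
    wlog hxu : x = u generalizing u v
    · have hxv : x = v := by
        rcases Sym2.mem_iff.1 hxe with h | h
        · exact absurd h hxu
        · exact h
      have := this v u huv.symm (by rw [Sym2.eq_swap]; exact hxe) hxv
      rw [Sym2.eq_swap, adj_comm]; exact this
    subst hxu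
    rw [side_eq hG hab] at hx
    simp only [Finset.mem_insert, Finset.mem_biUnion] at hx
    rcases hx with rfl | ⟨c, hc, hx⟩
    · by_cases hva : v = a
      · left; rw [hva, Sym2.eq_swap]
      · right
        exact ⟨v, mem_ch.2 ⟨hva, huv⟩, huv, v, self_mem_side hG.1 huv, by simp⟩
    · right; exact ⟨c, hc, huv, x, hx, hxe⟩
  · rintro (h | ⟨c, hc, huv, x, hx, hxe⟩)
    · have hm : s(u, v) ∈ G.edgeSet := by rw [h]; exact hab
      refine ⟨hm, b, self_mem_side hG.1 hab, ?_⟩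
      rw [h]; simp
    · exact ⟨huv, x, side_sub hG hab hc hx, hxe⟩

lemma cross_edge (hG : G.IsTree) {a b x y : V} (hab : G.Adj a b) (hx : x ∈ side G a b)
    {e : Sym2 V} (he : e ∈ G.edgeSet) (hxe : x ∈ e) (hye : y ∈ e) (hy : y ∉ side G a b) :
    e = s(a, b) := by
  have hne : x ≠ y := by rintro rfl; exact hy hx
  have h := (Sym2.mem_and_mem_iff hne).1 ⟨hxe, hye⟩
  subst h
  obtain ⟨rfl, rfl⟩ := side_cross hG hab hx hy he
  exact Sym2.eq_swap

lemma sum_tch (hG : G.IsTree) {a b : V} (hab : G.Adj a b) (f : Sym2 V → ℕ) :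
    ∑ e ∈ tch G a b, f e = f s(a, b) + ∑ c ∈ ch G a b, ∑ e ∈ tch G b c, f e := by
  rw [tch_eq hG hab, Finset.sum_insert, Finset.sum_biUnion]
  · intro c hc c' hc' hne
    change Disjoint (tch G b c) (tch G b c')
    rw [Finset.disjoint_left]
    intro e he he'
    simp only [tch, Finset.mem_filter, mem_edgeFinset] at he he'
    obtain ⟨he, x, hx, hxe⟩ := he
    obtain ⟨-, y, hy, hye⟩ := he'
    have hd := side_disj hG (mem_ch.1 hc).2 (mem_ch.1 hc').2 hne
    have h1 := cross_edge hG (mem_ch.1 hc).2 hx he hxe hye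
      (Finset.disjoint_right.1 hd hy)
    have h2 := cross_edge hG (mem_ch.1 hc').2 hy he hye hxe
      (Finset.disjoint_left.1 hd hx)
    rw [h1] at h2
    exact hne (Sym2.congr_right.1 h2)
  · simp only [Finset.mem_biUnion, not_exists, not_and]
    intro c hc he
    simp only [tch, Finset.mem_filter] at he
    obtain ⟨-, x, hx, hxe⟩ := he
    rcases Sym2.mem_iff.1 hxe with rfl | rfl
    · have := side_cross hG (mem_ch.1 hc).2 hx not_mem_side hab
      exact (mem_ch.1 hc).1 this.1.symm
    · exact not_mem_side hx

lemma msz_mk (a b : V) : msz G s(a, b) = min (side G a b).card (side G b a).card := rfl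

lemma psi_eq (hG : G.IsTree) {e : Sym2 V} (he : e ∈ G.edgeSet) :
    mostarPsi G e + 2 * msz G e = Fintype.card V := by
  induction e using Sym2.ind with
  | _ a b =>
  have hab : G.Adj a b := he
  have h1 := card_side_add hG hab
  have h2 : mostarPsi G s(a, b) =
    (((side G b a).card : ℤ) - ((side G a b).card : ℤ)).natAbs := rfl
  rw [h2, msz_mk]
  omega

lemma msz_pos (hG : G.IsTree) {e : Sym2 V} (he : e ∈ G.edgeSet) : 1 ≤ msz G e := by
  induction e using Sym2.ind with
  | _ a b =>
  have hab : G.Adj a b := he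
  rw [msz_mk]
  have h1 := Finset.card_pos.2 ⟨_, self_mem_side hG.1 hab⟩
  have h2 := Finset.card_pos.2 ⟨_, self_mem_side hG.1 hab.symm⟩
  omega

lemma mostar_eq (hG : G.IsTree) :
    mostar G + 2 * ∑ e ∈ G.edgeFinset, msz G e = G.edgeFinset.card * Fintype.card V := by
  unfold mostar
  rw [Finset.mul_sum, ← Finset.sum_add_distrib,
    Finset.sum_congr rfl (fun e he => psi_eq hG (mem_edgeFinset.1 he))]
  simp

lemma sum_msz (hG : G.IsTree) :
    ∑ e ∈ G.edgeFinset, msz G e + ∑ j ∈ Finset.range (Fintype.card V), cnt G j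
      = G.edgeFinset.card * Fintype.card V := by
  have h1 : ∀ j, cnt G j = ∑ e ∈ G.edgeFinset, if msz G e ≤ j then 1 else 0 := by
    intro j; unfold cnt; rw [Finset.card_filter]
  simp only [h1]
  rw [Finset.sum_comm, ← Finset.sum_add_distrib, Finset.sum_const_nat (m := Fintype.card V)]
  intro e he
  have h2 : msz G e ≤ Fintype.card V := by
    have := psi_eq hG (mem_edgeFinset.1 he)
    omega
  rw [← Finset.card_filter]
  have h3 : (Finset.range (Fintype.card V)).filter (fun j => msz G e ≤ j)
      = Finset.Ico (msz G e) (Fintype.card V) := by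
    ext j; simp [and_comm]
  rw [h3, Nat.card_Ico]; omega

lemma cnt_compare {G' : SimpleGraph V} (hG : G.IsTree) (hG' : G'.IsTree)
    (hle : mostar G ≤ mostar G') (hc : ∀ j, cnt G' j ≤ cnt G j) (j : ℕ)
    (hj : j < Fintype.card V) : cnt G j ≤ cnt G' j := by
  have h1 := mostar_eq hG
  have h2 := mostar_eq hG'
  have h3 := sum_msz hG
  have h4 := sum_msz hG'
  have h5 := hG.card_edgeFinset
  have h6 := hG'.card_edgeFinset
  have h7 : G.edgeFinset.card = G'.edgeFinset.card := by omega
  rw [← h7] at h2 h4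
  by_contra hlt
  have h8 : ∑ j ∈ Finset.range (Fintype.card V), cnt G' j <
      ∑ j ∈ Finset.range (Fintype.card V), cnt G j :=
    Finset.sum_lt_sum (fun i _ => hc i) ⟨j, Finset.mem_range.2 hj, by omega⟩
  omega

end

section
variable {V : Type*} {G : SimpleGraph V} [Fintype V]

/-- number of light edges touching the side -/
noncomputable def HH (G : SimpleGraph V) (j : ℕ) (a b : V) : ℕ :=
  ∑ e ∈ tch G a b, if msz G e ≤ j then 1 else 0

/-- number of branch vertices in the side -/
noncomputable def KK (G : SimpleGraph V) (a b : V) : ℕ :=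
  ∑ x ∈ side G a b, if 3 ≤ G.degree x then 1 else 0

lemma HH_rec (hG : G.IsTree) (j : ℕ) {a b : V} (hab : G.Adj a b) :
    HH G j a b = (if msz G s(a, b) ≤ j then 1 else 0) + ∑ c ∈ ch G a b, HH G j b c :=
  sum_tch hG hab _

lemma KK_rec (hG : G.IsTree) {a b : V} (hab : G.Adj a b) :
    KK G a b = (if 3 ≤ G.degree b then 1 else 0) + ∑ c ∈ ch G a b, KK G b c :=
  sum_side hG hab _

lemma card_side_lt (hG : G.IsTree) {a b c : V} (hab : G.Adj a b) (hc : c ∈ ch G a b) :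
    (side G b c).card < (side G a b).card := by
  rw [card_side hG hab]
  have := Finset.single_le_sum (f := fun c => (side G b c).card) (fun _ _ => Nat.zero_le _) hc
  omega

lemma card_side_back (hG : G.IsTree) {a b c : V} (hab : G.Adj a b) (hc : c ∈ ch G a b) :
    (side G b a).card ≤ (side G c b).card := by
  have h1 := card_side_add hG hab
  have h2 := card_side_add hG (mem_ch.1 hc).2
  have h3 := card_side_lt hG hab hc
  omega

lemma KK_bound (hG : G.IsTree) (N : ℕ) : ∀ a b : V, G.Adj a b → (side G a b).card ≤ N →
    2 * KK G a b + 1 ≤ (side G a b).card := by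
  induction N with
  | zero =>
    intro a b hab h
    have h1 := Finset.card_pos.2 ⟨_, self_mem_side hG.1 hab⟩
    omega
  | succ N ih =>
    intro a b hab h
    have hs : ∑ c ∈ ch G a b, (2 * KK G b c + 1) ≤ ∑ c ∈ ch G a b, (side G b c).card :=
      Finset.sum_le_sum fun c hc => ih b c (mem_ch.1 hc).2 (by
        have := card_side_lt hG hab hc; omega)
    rw [Finset.sum_add_distrib, ← Finset.mul_sum] at hs
    simp only [Finset.sum_const, smul_eq_mul, mul_one] at hs
    have h2 := card_side hG hab
    have h3 := card_ch hab
    rw [KK_rec hG hab]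
    split_ifs <;> omega

lemma HH_bound (hG : G.IsTree) (j : ℕ) (hj : 1 ≤ j) (N : ℕ) : ∀ a b : V, G.Adj a b →
    (side G a b).card ≤ N → j < (side G b a).card →
    ((side G a b).card ≤ j → HH G j a b = (side G a b).card) ∧
    (j < (side G a b).card → j ≤ HH G j a b ∧ KK G a b + (j + 1) / 2 ≤ HH G j a b) := by
  induction N with
  | zero =>
    intro a b hab h
    have h1 := Finset.card_pos.2 ⟨_, self_mem_side hG.1 hab⟩
    omega
  | succ N ih =>
    intro a b hab h hback
    have ih' : ∀ c ∈ ch G a b, ((side G b c).card ≤ j → HH G j b c = (side G b c).card) ∧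
      (j < (side G b c).card → j ≤ HH G j b c ∧ KK G b c + (j + 1) / 2 ≤ HH G j b c) := by
      intro c hc
      refine ih b c (mem_ch.1 hc).2 ?_ ?_
      · have := card_side_lt hG hab hc; omega
      · have := card_side_back hG hab hc; omega
    have hs := card_side hG hab
    have hH := HH_rec hG j hab
    have hK := KK_rec hG hab
    have hd := card_ch hab
    have hKb := KK_bound hG _ a b hab le_rfl
    rw [msz_mk] at hH
    constructor
    · intro hle
      have : ∑ c ∈ ch G a b, HH G j b c = ∑ c ∈ ch G a b, (side G b c).card :=
        Finset.sum_congr rfl fun c hc => (ih' c hc).1 (by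
          have := card_side_lt hG hab hc; omega)
      rw [if_pos (by omega)] at hH
      omega
    · intro hlt
      rw [if_neg (by omega)] at hH
      by_cases hex : ∃ c ∈ ch G a b, j < (side G b c).card
      · obtain ⟨c, hc, hcj⟩ := hex
        obtain ⟨i1, i2⟩ := (ih' c hc).2 hcj
        rw [← Finset.add_sum_erase _ _ hc] at hH hK
        have hrest : ∑ c ∈ (ch G a b).erase c, (KK G b c + 1) ≤
            ∑ c ∈ (ch G a b).erase c, HH G j b c := by
          apply Finset.sum_le_sum
          intro c' hc'
          have hc'' := Finset.mem_of_mem_erase hc'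
          have hk' := KK_bound hG _ b c' (mem_ch.1 hc'').2 le_rfl
          by_cases h' : (side G b c').card ≤ j
          · rw [(ih' c' hc'').1 h']; omega
          · have := ((ih' c' hc'').2 (by omega)).2
            omega
        rw [Finset.sum_add_distrib] at hrest
        simp only [Finset.sum_const, smul_eq_mul, mul_one] at hrest
        have hce := Finset.card_erase_add_one hc
        split_ifs at hK <;> omega
      · push Not at hex
        have : ∑ c ∈ ch G a b, HH G j b c = ∑ c ∈ ch G a b, (side G b c).card :=
          Finset.sum_congr rfl fun c hc => (ih' c hc).1 (hex c hc)
        omega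

lemma KK_total (hG : G.IsTree) {a b : V} (hab : G.Adj a b) :
    KK G a b + KK G b a = branchCount G := by
  unfold KK branchCount
  rw [← side_compl hG hab, Finset.sum_add_sum_compl, Finset.card_filter]

lemma HH_total (hG : G.IsTree) {a b : V} (hab : G.Adj a b) (j : ℕ) (h : j < msz G s(a, b)) :
    HH G j a b + HH G j b a ≤ cnt G j := by
  unfold HH cnt
  rw [← Finset.card_filter, ← Finset.card_filter, ← Finset.card_union_of_disjoint]
  · apply Finset.card_le_card
    intro e he
    simp only [tch, Finset.mem_union, Finset.mem_filter] at he ⊢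
    tauto
  · rw [Finset.disjoint_left]
    intro e he he'
    simp only [tch, Finset.mem_filter, mem_edgeFinset] at he he'
    obtain ⟨⟨he, x, hx, hxe⟩, hm⟩ := he
    obtain ⟨⟨-, y, hy, hye⟩, -⟩ := he'
    rw [mem_side_swap hG hab] at hy
    have := cross_edge hG hab hx he hxe hye hy
    rw [this] at hm
    omega

lemma cnt_lower (hG : G.IsTree) (j : ℕ) (hj : 1 ≤ j) :
    min (Fintype.card V - 1) (max (2 * j) (branchCount G + 2 * ((j + 1) / 2))) ≤ cnt G j := by
  have h5 := hG.card_edgeFinset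
  by_cases hall : ∀ e ∈ G.edgeFinset, msz G e ≤ j
  · have : cnt G j = G.edgeFinset.card := by
      unfold cnt; rw [Finset.filter_true_of_mem hall]
    omega
  · push Not at hall
    obtain ⟨e, he, hej⟩ := hall
    induction e using Sym2.ind with
    | _ a b =>
    have hab : G.Adj a b := mem_edgeFinset.1 he
    have h1 := HH_total hG hab j hej
    have h2 := KK_total hG hab
    rw [msz_mk] at hej
    have h3 := (HH_bound hG j hj _ a b hab le_rfl (by omega)).2 (by omega)
    have h4 := (HH_bound hG j hj _ b a hab.symm le_rfl (by omega)).2 (by omega)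
    omega

end

/-- adjacency of labels -/
def LA (p q : ℕ × Bool) : Prop :=
  (p.2 = false ∧ q.2 = false ∧ (p.1 + 1 = q.1 ∨ q.1 + 1 = p.1)) ∨ (p.2 ≠ q.2 ∧ p.1 = q.1)

/-- `l` exhibits `G` as a caterpillar with spine of `m` vertices and pendent vertices at `B`. -/
structure Lab {V : Type*} (G : SimpleGraph V) (m : ℕ) (B : Finset ℕ) (l : V → ℕ × Bool) :
    Prop where
  inj : Function.Injective l
  lt : ∀ x, (l x).1 < m
  memB : ∀ x, (l x).2 = true → (l x).1 ∈ B
  surj0 : ∀ i, i < m → ∃ x, l x = (i, false)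
  surj1 : ∀ i ∈ B, ∃ x, l x = (i, true)
  hB : ∀ i ∈ B, 1 ≤ i ∧ i + 2 ≤ m
  adj : ∀ x y, G.Adj x y ↔ LA (l x) (l y)

/-- size of the left part of the spine edge `i, i+1`. -/
def ell (B : Finset ℕ) (i : ℕ) : ℕ := i + 1 + (B.filter fun q => q ≤ i).card

lemma Lab.ex {V W : Type*} {G : SimpleGraph V} {G' : SimpleGraph W} {m : ℕ} {B : Finset ℕ}
    {l : V → ℕ × Bool} {l' : W → ℕ × Bool} (h : Lab G m B l) (h' : Lab G' m B l') (x : V) :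
    ∃ y, l' y = l x := by
  rcases hx : l x with ⟨i, b⟩
  cases b
  · exact h'.surj0 i (by have := h.lt x; rw [hx] at this; exact this)
  · exact h'.surj1 i (by have := h.memB x; rw [hx] at this; exact this rfl)

lemma Lab.iso {V W : Type*} {G : SimpleGraph V} {G' : SimpleGraph W} {m : ℕ} {B : Finset ℕ}
    {l : V → ℕ × Bool} {l' : W → ℕ × Bool} (h : Lab G m B l) (h' : Lab G' m B l') :
    Nonempty (G ≃g G') := by
  choose f hf using h.ex h'
  choose g hg using h'.ex h
  refine ⟨⟨⟨f, g, ?_, ?_⟩, ?_⟩⟩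
  · intro x; apply h.inj; rw [hg, hf]
  · intro x; apply h'.inj; rw [hf, hg]
  · intro x y
    change G'.Adj (f x) (f y) ↔ _
    rw [h'.adj, h.adj, hf, hf]

lemma Lab.reflect {V : Type*} {G : SimpleGraph V} {m : ℕ} {B : Finset ℕ}
    {l : V → ℕ × Bool} (h : Lab G m B l) :
    Lab G m (B.image fun i => m - 1 - i) (fun x => (m - 1 - (l x).1, (l x).2)) where
  inj := by
    intro x y hxy
    simp only [Prod.mk.injEq] at hxy
    have h1 := h.lt x
    have h2 := h.lt y
    exact h.inj (Prod.ext (by omega) hxy.2)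
  lt := fun x => by have := h.lt x; simp only; omega
  memB := fun x hx => Finset.mem_image.2 ⟨_, h.memB x hx, rfl⟩
  surj0 := fun i hi => by
    obtain ⟨x, hx⟩ := h.surj0 (m - 1 - i) (by omega)
    refine ⟨x, ?_⟩
    rw [hx]; ext <;> simp; omega
  surj1 := fun i hi => by
    obtain ⟨q, hq, rfl⟩ := Finset.mem_image.1 hi
    obtain ⟨x, hx⟩ := h.surj1 q hq
    exact ⟨x, by rw [hx]⟩
  hB := fun i hi => by
    obtain ⟨q, hq, rfl⟩ := Finset.mem_image.1 hi
    have := h.hB q hq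
    omega
  adj := fun x y => by
    rw [h.adj]
    have h1 := h.lt x
    have h2 := h.lt y
    unfold LA
    simp only
    constructor
    · rintro (⟨h3, h4, h5⟩ | ⟨h3, h4⟩)
      · left; exact ⟨h3, h4, by omega⟩
      · right; exact ⟨h3, by omega⟩
    · rintro (⟨h3, h4, h5⟩ | ⟨h3, h4⟩)
      · left; exact ⟨h3, h4, by omega⟩
      · right; exact ⟨h3, by omega⟩

section
variable {V : Type*} {G : SimpleGraph V} [Fintype V] {m : ℕ} {B : Finset ℕ} {l : V → ℕ × Bool}

lemma Lab.card_le (h : Lab G m B l) (i : ℕ) (hi : i < m) :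
    (Finset.univ.filter fun x => (l x).1 ≤ i).card = ell B i := by
  rw [← Finset.card_image_of_injective _ h.inj]
  have : (Finset.univ.filter fun x => (l x).1 ≤ i).image l =
      (Finset.range (i + 1)) ×ˢ {false} ∪ (B.filter fun q => q ≤ i) ×ˢ {true} := by
    ext ⟨q, b⟩
    simp only [Finset.mem_image, Finset.mem_filter, Finset.mem_univ, true_and, Finset.mem_union,
      Finset.mem_product, Finset.mem_range, Finset.mem_singleton]
    constructor
    · rintro ⟨x, hx, hxe⟩
      rw [hxe] at hx
      have h1 := h.memB x
      rw [hxe] at h1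
      cases b
      · left; exact ⟨by simp only at hx; omega, rfl⟩
      · right; exact ⟨⟨h1 rfl, hx⟩, rfl⟩
    · rintro (⟨hq, rfl⟩ | ⟨⟨hq, hq'⟩, rfl⟩)
      · obtain ⟨x, hx⟩ := h.surj0 q (by omega)
        exact ⟨x, by rw [hx]; simp only; omega, hx⟩
      · obtain ⟨x, hx⟩ := h.surj1 q hq
        exact ⟨x, by rw [hx]; exact hq', hx⟩
  rw [this, Finset.card_union_of_disjoint]
  · simp [ell]
  · rw [Finset.disjoint_left]
    rintro ⟨q, b⟩
    simp
    intro _ h1 _ _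
    simp [h1]

lemma Lab.card (h : Lab G m B l) (hm : 0 < m) : Fintype.card V = m + B.card := by
  have h1 := h.card_le (m - 1) (by omega)
  rw [Finset.filter_true_of_mem (fun x _ => by have := h.lt x; omega)] at h1
  rw [Finset.card_univ] at h1
  rw [h1, ell, Finset.filter_true_of_mem (fun q hq => by have := h.hB q hq; omega)]
  omega

lemma Lab.cnt (h : Lab G m B l) (hG : G.IsTree) (hm : 2 ≤ m) (j : ℕ) (hj : 1 ≤ j) :
    cnt G j = B.card + ((Finset.range (m - 1)).filter
      fun i => ell B i ≤ j ∨ m + B.card ≤ j + ell B i).card := by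
  have hN := h.card (by omega)
  have hs0 : ∀ i, ∃ x, i < m → l x = (i, false) := fun i => by
    by_cases hi : i < m
    · obtain ⟨x, hx⟩ := h.surj0 i hi; exact ⟨x, fun _ => hx⟩
    · obtain ⟨x, hx⟩ := h.surj0 0 (by omega); exact ⟨x, fun h => absurd h hi⟩
  have hs1 : ∀ i, ∃ x, i ∈ B → l x = (i, true) := fun i => by
    by_cases hi : i ∈ B
    · obtain ⟨x, hx⟩ := h.surj1 i hi; exact ⟨x, fun _ => hx⟩
    · obtain ⟨x, hx⟩ := h.surj0 0 (by omega); exact ⟨x, fun h => absurd h hi⟩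
  choose u hu using hs0
  choose t ht using hs1
  -- sizes
  have hmp : ∀ i ∈ B, msz G s(u i, t i) ≤ 1 := by
    intro i hi
    have hi' := h.hB i hi
    have hui := hu i (by omega)
    have hti := ht i hi
    have hcut : IsCut G (({t i} : Finset V) : Set V) (u i) (t i) := by
      refine ⟨?_, by simp, ?_, ?_⟩
      · rw [h.adj, hui, hti]; right; simp
      · simp only [Finset.coe_singleton, Set.mem_singleton_iff]
        intro he; rw [he, hti] at hui; simp at hui
      · intro x hx y hy hxy
        simp only [Finset.coe_singleton, Set.mem_singleton_iff] at hx
        subst hx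
        refine ⟨rfl, h.inj ?_⟩
        rw [h.adj, hti] at hxy
        rw [hui]
        rcases hxy with h1 | ⟨h1, h2⟩
        · simp at h1
        · simp only [ne_eq] at h1 h2
          refine Prod.ext h2.symm ?_
          cases hh : (l y).2
          · rfl
          · exact absurd hh.symm h1
    rw [msz_mk, ← hcut.eq_side hG.1]
    simp
  have hms : ∀ i, i < m - 1 → msz G s(u i, u (i + 1)) = min (ell B i) (m + B.card - ell B i) := by
    intro i hi
    have hui := hu i (by omega)
    have hui' := hu (i + 1) (by omega)
    have hcut : IsCut G ((Finset.univ.filter fun x => (l x).1 ≤ i : Finset V) : Set V)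
        (u (i + 1)) (u i) := by
      refine ⟨?_, ?_, ?_, ?_⟩
      · rw [h.adj, hui, hui']; left; simp
      · simp [hui]
      · simp [hui']
      · intro x hx y hy hxy
        simp only [Finset.coe_filter, Finset.mem_univ, true_and, Set.mem_ofPred_eq] at hx hy
        rw [h.adj] at hxy
        rcases hxy with ⟨h1, h2, h3⟩ | ⟨h1, h2⟩
        · exact ⟨h.inj (by rw [hui]; exact Prod.ext (by simp only; omega) h1),
            h.inj (by rw [hui']; exact Prod.ext (by simp only; omega) h2)⟩
        · omega
    have h1 := h.card_le i (by omega)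
    have hadj := hcut.adj
    have h2 := card_side_add hG hadj
    rw [msz_mk, ← h1, hcut.eq_side hG.1]
    rw [min_comm]
    omega
  have key : G.edgeFinset.filter (fun e => msz G e ≤ j) =
      B.image (fun i => s(u i, t i)) ∪ ((Finset.range (m - 1)).filter
      fun i => ell B i ≤ j ∨ m + B.card ≤ j + ell B i).image (fun i => s(u i, u (i + 1))) := by
    ext e
    simp only [Finset.mem_filter, Finset.mem_union, Finset.mem_image, mem_edgeFinset,
      Finset.mem_range]
    constructor
    · rintro ⟨he, hej⟩
      induction e using Sym2.ind with
      | _ x y =>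
      have hxy : G.Adj x y := he
      have hxy' := hxy
      rw [h.adj] at hxy'
      rcases hxy' with ⟨h1, h2, h3⟩ | ⟨h1, h2⟩
      · right
        wlog h4 : (l x).1 + 1 = (l y).1 generalizing x y
        · rw [Sym2.eq_swap]
          rw [Sym2.eq_swap] at hej
          exact this y x hxy.symm hej hxy.symm h2 h1 h3.symm (by omega)
        have hy := h.lt y
        have e1 : x = u (l x).1 := h.inj (by rw [hu _ (h.lt x)]; exact Prod.ext rfl h1)
        have e2 : y = u ((l x).1 + 1) := h.inj (by rw [h4, hu _ (h.lt y)]; exact Prod.ext rfl h2)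
        refine ⟨(l x).1, ⟨by omega, ?_⟩, by rw [← e1, ← e2]⟩
        rw [e2] at hej
        nth_rw 1 [e1] at hej
        rw [hms _ (by omega)] at hej
        omega
      · left
        wlog h4 : (l y).2 = true generalizing x y
        · rw [Sym2.eq_swap]
          rw [Sym2.eq_swap] at hej
          refine this y x hxy.symm hej hxy.symm h1.symm h2.symm ?_
          cases hh : (l x).2
          · simp only [Bool.not_eq_true] at h4
            rw [hh, h4] at h1; exact absurd rfl h1
          · rfl
        have hy := h.memB y h4
        have h5 : (l x).2 = false := by
          cases hh : (l x).2
          · rfl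
          · rw [hh, h4] at h1; exact absurd rfl h1
        have e1 : x = u (l y).1 := h.inj (by rw [hu _ (h.lt y)]; exact Prod.ext h2 h5)
        have e2 : y = t (l y).1 := h.inj (by rw [ht _ hy]; exact Prod.ext rfl h4)
        exact ⟨(l y).1, hy, by rw [← e1, ← e2]⟩
    · rintro (⟨i, hi, rfl⟩ | ⟨i, ⟨hi, hij⟩, rfl⟩)
      · have hi' := h.hB i hi
        refine ⟨?_, (hmp i hi).trans hj⟩
        rw [mem_edgeSet, h.adj, hu i (by omega), ht i hi]; right; simp
      · refine ⟨?_, ?_⟩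
        · rw [mem_edgeSet, h.adj, hu i (by omega), hu (i + 1) (by omega)]; left; simp
        · rw [hms i hi]; omega
  unfold MB.cnt
  rw [key, Finset.card_union_of_disjoint, Finset.card_image_of_injOn, Finset.card_image_of_injOn]
  · intro i hi i' hi' he
    simp only [Finset.coe_filter, Finset.mem_range, Set.mem_ofPred_eq] at hi hi' he
    have a1 := hu i (by omega)
    have a2 := hu (i + 1) (by omega)
    have a3 := hu i' (by omega)
    have a4 := hu (i' + 1) (by omega)
    rw [Sym2.eq_iff] at he
    rcases he with ⟨e1, e2⟩ | ⟨e1, e2⟩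
    · rw [e1, a3] at a1; simp at a1; omega
    · rw [e1, a4] at a1; rw [e2, a3] at a2; simp at a1 a2; omega
  · intro i hi i' hi' he
    simp only [Finset.mem_coe] at hi hi' he
    have b1 := h.hB i hi
    have b2 := h.hB i' hi'
    have a1 := hu i (by omega)
    have a3 := hu i' (by omega)
    have a4 := ht i' hi'
    rw [Sym2.eq_iff] at he
    rcases he with ⟨e1, e2⟩ | ⟨e1, e2⟩
    · rw [e1, a3] at a1; simp at a1; omega
    · rw [e1, a4] at a1; simp at a1
  · rw [Finset.disjoint_left]
    intro e he he'
    obtain ⟨i, hi, rfl⟩ := Finset.mem_image.1 he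
    obtain ⟨i', hi', he⟩ := Finset.mem_image.1 he'
    simp only [Finset.mem_filter, Finset.mem_range] at hi'
    have a1 := ht i hi
    have a3 := hu i' (by omega)
    have a4 := hu (i' + 1) (by omega)
    rw [Sym2.eq_iff] at he
    rcases he with ⟨e1, e2⟩ | ⟨e1, e2⟩
    · rw [← e2, a4] at a1; simp at a1
    · rw [← e1, a3] at a1; simp at a1

end

/-- pendent positions of the extremal caterpillar -/
def BO (m a b : ℕ) : Finset ℕ := Finset.Icc 1 a ∪ Finset.Icc (m - 1 - b) (m - 2)

lemma card_BO (m a b : ℕ) (hm : a + b + 2 ≤ m) : (BO m a b).card = a + b := by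
  unfold BO
  rw [Finset.card_union_of_disjoint]
  · simp; omega
  · rw [Finset.disjoint_left]
    intro x
    simp only [Finset.mem_Icc]; omega

lemma split_card (B : Finset ℕ) (i : ℕ) :
    (B.filter fun q => q ≤ i).card + (B.filter fun q => i < q).card = B.card := by
  have := Finset.card_filter_add_card_filter_not (s := B) (fun q => q ≤ i)
  simpa using this

lemma BO_upper (m k j : ℕ) (hm : k + 2 ≤ m) :
    k + ((Finset.range (m - 1)).filter
      fun i => ell (BO m ((k + 1) / 2) (k / 2)) i ≤ j ∨
        m + k ≤ j + ell (BO m ((k + 1) / 2) (k / 2)) i).card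
    ≤ max (2 * j) (k + 2 * ((j + 1) / 2)) := by
  set a := (k + 1) / 2 with ha
  set b := k / 2 with hb
  have hk : a + b = k := by omega
  have hcard := card_BO m a b (by omega)
  have hsub : ((Finset.range (m - 1)).filter
      fun i => ell (BO m a b) i ≤ j ∨ m + k ≤ j + ell (BO m a b) i) ⊆
      Finset.range (max ((j + 1) / 2) (j - a)) ∪
        Finset.Ico (m - 1 - max ((j + 1) / 2) (j - b)) (m - 1) := by
    intro i hi
    simp only [Finset.mem_filter, Finset.mem_range] at hi
    obtain ⟨him, hi⟩ := hi
    simp only [Finset.mem_union, Finset.mem_range, Finset.mem_Ico]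
    have hl : min i a ≤ ((BO m a b).filter fun q => q ≤ i).card := by
      have : Finset.Icc 1 (min i a) ⊆ (BO m a b).filter fun q => q ≤ i := by
        intro q
        simp only [BO, Finset.mem_filter, Finset.mem_union, Finset.mem_Icc]
        omega
      have := Finset.card_le_card this
      simpa using this
    have hr : min (m - 2 - i) b ≤ ((BO m a b).filter fun q => i < q).card := by
      have : Finset.Icc (max (i + 1) (m - 1 - b)) (m - 2) ⊆ (BO m a b).filter fun q => i < q := by
        intro q
        simp only [BO, Finset.mem_filter, Finset.mem_union, Finset.mem_Icc]
        omega
      have := Finset.card_le_card this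
      rw [Nat.card_Icc] at this
      omega
    have hs := split_card (BO m a b) i
    unfold ell at hi
    rcases hi with hi | hi
    · left; omega
    · right; omega
  have h1 := Finset.card_le_card hsub
  have h2 := Finset.card_union_le (Finset.range (max ((j + 1) / 2) (j - a)))
    (Finset.Ico (m - 1 - max ((j + 1) / 2) (j - b)) (m - 1))
  rw [Finset.card_range, Nat.card_Ico] at h2
  omega

section
variable {m k : ℕ} {B : Finset ℕ}

lemma left_le (hB : ∀ i ∈ B, 1 ≤ i ∧ i + 2 ≤ m) (i : ℕ) :
    (B.filter fun q => q ≤ i).card ≤ i := by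
  have : (B.filter fun q => q ≤ i) ⊆ Finset.Icc 1 i := by
    intro q hq
    simp only [Finset.mem_filter, Finset.mem_Icc] at hq ⊢
    exact ⟨(hB q hq.1).1, hq.2⟩
  simpa using Finset.card_le_card this

lemma left_lt (hB : ∀ i ∈ B, 1 ≤ i ∧ i + 2 ≤ m) (i i0 : ℕ) (h1 : 1 ≤ i0) (h2 : i0 ≤ i)
    (h3 : i0 ∉ B) : (B.filter fun q => q ≤ i).card + 1 ≤ i := by
  have : insert i0 (B.filter fun q => q ≤ i) ⊆ Finset.Icc 1 i := by
    intro q hq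
    simp only [Finset.mem_filter, Finset.mem_Icc, Finset.mem_insert] at hq ⊢
    rcases hq with rfl | hq
    · exact ⟨h1, h2⟩
    · exact ⟨(hB q hq.1).1, hq.2⟩
  have := Finset.card_le_card this
  rw [Finset.card_insert_of_notMem (by simp [h3])] at this
  simpa using this

lemma right_le (hB : ∀ i ∈ B, 1 ≤ i ∧ i + 2 ≤ m) (i : ℕ) :
    (B.filter fun q => i < q).card ≤ m - 2 - i := by
  have : (B.filter fun q => i < q) ⊆ Finset.Icc (i + 1) (m - 2) := by
    intro q hq
    simp only [Finset.mem_filter, Finset.mem_Icc] at hq ⊢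
    have := (hB q hq.1).2
    omega
  have := Finset.card_le_card this
  rw [Nat.card_Icc] at this
  omega

lemma right_lt (hB : ∀ i ∈ B, 1 ≤ i ∧ i + 2 ≤ m) (i i0 : ℕ) (h1 : i < i0) (h2 : i0 ≤ m - 2)
    (h3 : i0 ∉ B) : (B.filter fun q => i < q).card + 1 ≤ m - 2 - i := by
  have : insert i0 (B.filter fun q => i < q) ⊆ Finset.Icc (i + 1) (m - 2) := by
    intro q hq
    simp only [Finset.mem_filter, Finset.mem_Icc, Finset.mem_insert] at hq ⊢
    rcases hq with rfl | hq
    · omega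
    · have := (hB q hq.1).2
      omega
  have := Finset.card_le_card this
  rw [Finset.card_insert_of_notMem (by simp [h3]), Nat.card_Icc] at this
  omega

lemma count_ge (j p q : ℕ) (hpq : p + q ≤ m - 1)
    (hp : ∀ i < p, ell B i ≤ j)
    (hq : ∀ i, m - 1 - q ≤ i → i < m - 1 → m + B.card ≤ j + ell B i) :
    p + q ≤ ((Finset.range (m - 1)).filter
      fun i => ell B i ≤ j ∨ m + B.card ≤ j + ell B i).card := by
  have hsub : Finset.range p ∪ Finset.Ico (m - 1 - q) (m - 1) ⊆ ((Finset.range (m - 1)).filter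
      fun i => ell B i ≤ j ∨ m + B.card ≤ j + ell B i) := by
    intro i hi
    simp only [Finset.mem_union, Finset.mem_range, Finset.mem_Ico, Finset.mem_filter] at hi ⊢
    rcases hi with hi | hi
    · exact ⟨by omega, Or.inl (hp i hi)⟩
    · exact ⟨by omega, Or.inr (hq i hi.1 hi.2)⟩
  have h := Finset.card_le_card hsub
  rw [Finset.card_union_of_disjoint, Finset.card_range, Nat.card_Ico] at h
  · omega
  · rw [Finset.disjoint_left]
    intro x
    simp only [Finset.mem_range, Finset.mem_Ico]; omega

lemma positions (hk : B.card = k) (hm : k + 2 ≤ m) (hB : ∀ i ∈ B, 1 ≤ i ∧ i + 2 ≤ m)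
    (H : ∀ j, 1 ≤ j → j ≤ k + 1 → k + ((Finset.range (m - 1)).filter
      fun i => ell B i ≤ j ∨ m + B.card ≤ j + ell B i).card
      ≤ max (2 * j) (k + 2 * ((j + 1) / 2))) :
    B = BO m ((k + 1) / 2) (k / 2) ∨
      B.image (fun i => m - 1 - i) = BO m ((k + 1) / 2) (k / 2) := by
  set a := (k + 1) / 2 with ha
  set b := k / 2 with hb
  have hL : ∀ i0, 1 ≤ i0 → i0 ≤ b → i0 ∈ B := by
    intro i0 h1 h2
    by_contra h3
    have c := count_ge (m := m) (B := B) (2 * b) (b + 1) b (by omega) (by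
        intro i hi
        unfold ell
        have e1 := left_le hB i
        by_cases hib : i = b
        · have e2 := left_lt hB i i0 h1 (by omega) h3
          omega
        · omega) (by
        intro i hi hi'
        unfold ell
        have e1 := right_le hB i
        have e2 := split_card B i
        omega)
    have := H (2 * b) (by omega) (by omega)
    omega
  have hR : ∀ i0, m - 1 - b ≤ i0 → i0 ≤ m - 2 → i0 ∈ B := by
    intro i0 h1 h2
    by_contra h3
    have c := count_ge (m := m) (B := B) (2 * b) b (b + 1) (by omega) (by
        intro i hi
        unfold ell
        have e1 := left_le hB i
        omega) (by
        intro i hi hi'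
        unfold ell
        have e1 := right_le hB i
        have e2 := split_card B i
        by_cases hib : i = m - 1 - (b + 1)
        · have e2 := right_lt hB i i0 (by omega) (by omega) h3
          omega
        · omega)
    have := H (2 * b) (by omega) (by omega)
    omega
  have hfin : ∀ B' : Finset ℕ, BO m a b ⊆ B' → B'.card = k → B' = BO m a b := by
    intro B' h1 h2
    symm
    apply Finset.eq_of_subset_of_card_le h1
    rw [card_BO m a b (by omega)]; omega
  have hLor : a ∈ B ∨ m - 1 - a ∈ B ∨ a = b := by
    by_contra hcon
    push Not at hcon
    obtain ⟨n1, n2, n3⟩ := hcon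
    have hab : a = b + 1 := by omega
    by_cases hbig : k + 4 ≤ m
    · have c := count_ge (m := m) (B := B) (2 * a) (a + 1) (a + 1) (by omega) (by
        intro i hi
        unfold ell
        have e1 := left_le hB i
        by_cases hib : i = a
        · have e2 := left_lt hB i a (by omega) (by omega) n1
          omega
        · omega) (by
        intro i hi hi'
        unfold ell
        have e1 := right_le hB i
        have e2 := split_card B i
        by_cases hib : i = m - 1 - (a + 1)
        · have e2 := right_lt hB i (m - 1 - a) (by omega) (by omega) n2
          omega
        · omega)
      have := H (2 * a) (by omega) (by omega)
      omega
    · have : B ⊆ BO m b b := by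
        intro q hq
        have := hB q hq
        have q1 : q ≠ a := by rintro rfl; exact n1 hq
        have q2 : q ≠ m - 1 - a := by rintro rfl; exact n2 hq
        simp only [BO, Finset.mem_union, Finset.mem_Icc]
        omega
      have := Finset.card_le_card this
      rw [card_BO m b b (by omega)] at this
      omega
  rcases hLor with h | h | h
  · left
    apply hfin _ _ hk
    intro q hq
    simp only [BO, Finset.mem_union, Finset.mem_Icc] at hq
    rcases hq with hq | hq
    · by_cases hqa : q = a
      · rw [hqa]; exact h
      · exact hL q hq.1 (by omega)
    · exact hR q hq.1 hq.2
  · right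
    apply hfin
    · intro q hq
      simp only [BO, Finset.mem_union, Finset.mem_Icc] at hq
      rw [Finset.mem_image]
      refine ⟨m - 1 - q, ?_, by omega⟩
      rcases hq with hq | hq
      · by_cases hqa : q = a
        · rw [hqa]; exact h
        · exact hR _ (by omega) (by omega)
      · exact hL _ (by omega) (by omega)
    · rw [Finset.card_image_of_injOn, hk]
      intro x hx y hy hxy
      have h1 := hB x hx
      have h2 := hB y hy
      simp only at hxy
      omega
  · left
    apply hfin _ _ hk
    intro q hq
    simp only [BO, Finset.mem_union, Finset.mem_Icc] at hq
    rcases hq with hq | hq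
    · exact hL q hq.1 (by omega)
    · exact hR q hq.1 hq.2

end

lemma parentGraph_adj {n : ℕ} {p : ℕ → ℕ} {u v : Fin n} :
    (parentGraph n p).Adj u v ↔ u ≠ v ∧ (p u.val = v.val ∨ p v.val = u.val) := by
  simp [parentGraph]

lemma parentGraph_isTree (n : ℕ) (p : ℕ → ℕ) (hn : 0 < n)
    (hp : ∀ v, 0 < v → v < n → p v < v) (h0 : p 0 = 0) : (parentGraph n p).IsTree := by
  have hr : ∀ (N : ℕ) (v : Fin n), v.val ≤ N → (parentGraph n p).Reachable v ⟨0, hn⟩ := by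
    intro N
    induction N with
    | zero =>
      intro v hv
      have : v = ⟨0, hn⟩ := Fin.ext (by simpa using hv)
      rw [this]
    | succ N ih =>
      intro v hv
      by_cases hv0 : v.val = 0
      · have : v = ⟨0, hn⟩ := Fin.ext hv0
        rw [this]
      · have h1 := hp v.val (by omega) v.2
        have hv2 := v.2
        refine Reachable.trans (Adj.reachable (v := ⟨p v.val, by omega⟩) ?_)
          (ih ⟨p v.val, by omega⟩ (by simp only; omega))
        rw [parentGraph_adj]
        refine ⟨?_, Or.inl rfl⟩
        intro h
        have := congrArg Fin.val h
        simp only at this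
        omega
  have hconn : (parentGraph n p).Connected := by
    have : Nonempty (Fin n) := ⟨⟨0, hn⟩⟩
    exact Connected.mk fun u v => (hr _ u le_rfl).trans (hr _ v le_rfl).symm
  rw [isTree_iff_connected_and_card]
  refine ⟨hconn, ?_⟩
  have h1 := hconn.card_vert_le_card_edgeSet_add_one
  refine le_antisymm ?_ h1
  rw [Nat.card_eq_fintype_card, ← edgeFinset_card]
  have hsub : (parentGraph n p).edgeFinset ⊆
      (Finset.univ.erase (⟨0, hn⟩ : Fin n)).image
        (fun v => s(v, if h : p v.val < n then ⟨p v.val, h⟩ else v)) := by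
    intro e he
    induction e using Sym2.ind with
    | _ u v =>
    rw [mem_edgeFinset, mem_edgeSet, parentGraph_adj] at he
    obtain ⟨hne, he⟩ := he
    wlog h : p u.val = v.val generalizing u v
    · rw [Sym2.eq_swap]
      exact this v u hne.symm he.symm (by tauto)
    rw [Finset.mem_image]
    refine ⟨u, ?_, ?_⟩
    · simp only [Finset.mem_erase, Finset.mem_univ, and_true]
      rintro rfl
      simp only [h0] at h
      exact hne (Fin.ext h)
    · have hv := v.2
      rw [dif_pos (by omega)]
      congr 2
  have h2 := (Finset.card_le_card hsub).trans Finset.card_image_le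
  rw [Finset.card_erase_of_mem (Finset.mem_univ _)] at h2
  simp only [Finset.card_univ, Fintype.card_fin] at h2
  simp only [Nat.card_eq_fintype_card, Fintype.card_fin]
  omega

lemma Lab.branch {V : Type*} {G : SimpleGraph V} [Fintype V] {m : ℕ} {B : Finset ℕ}
    {l : V → ℕ × Bool} (h : Lab G m B l) : branchCount G = B.card := by
  unfold branchCount
  have key : (Finset.univ.filter fun v => 3 ≤ G.degree v).image l = B ×ˢ {false} := by
    have himg : ∀ x, G.degree x = ((G.neighborFinset x).image l).card := fun x => by
      rw [Finset.card_image_of_injective _ h.inj, card_neighborFinset_eq_degree]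
    ext ⟨i, s⟩
    simp only [Finset.mem_image, Finset.mem_filter, Finset.mem_univ, true_and,
      Finset.mem_product, Finset.mem_singleton]
    constructor
    · rintro ⟨x, hx, hxl⟩
      rw [himg] at hx
      cases s
      · refine ⟨?_, rfl⟩
        by_contra hi
        have hsub : (G.neighborFinset x).image l ⊆ {(i - 1, false), (i + 1, false)} := by
          intro y0 hy0
          obtain ⟨y, hy, rfl⟩ := Finset.mem_image.1 hy0
          rw [mem_neighborFinset, h.adj, hxl] at hy
          simp only [Finset.mem_insert, Finset.mem_singleton]
          rcases hy with ⟨-, h2, h3⟩ | ⟨h2, h3⟩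
          · simp only at h3
            rcases h3 with h3 | h3
            · right; exact Prod.ext h3.symm h2
            · left; exact Prod.ext (by simp only; omega) h2
          · exfalso
            apply hi
            simp only at h2 h3
            rw [h3]
            apply h.memB
            cases hh : (l y).2
            · rw [hh] at h2; exact absurd rfl h2
            · rfl
        have h1 := Finset.card_le_card hsub
        have h2 := Finset.card_le_two (a := (i - 1, false)) (b := (i + 1, false))
        omega
      · exfalso
        have hsub : (G.neighborFinset x).image l ⊆ {(i, false)} := by
          intro y0 hy0
          obtain ⟨y, hy, rfl⟩ := Finset.mem_image.1 hy0
          rw [mem_neighborFinset, h.adj, hxl] at hy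
          simp only [Finset.mem_singleton]
          rcases hy with ⟨h1, -⟩ | ⟨h2, h3⟩
          · simp at h1
          · refine Prod.ext h3.symm ?_
            cases hh : (l y).2
            · rfl
            · rw [hh] at h2; exact absurd rfl h2
        have h1 := Finset.card_le_card hsub
        simp only [Finset.card_singleton] at h1
        omega
    · rintro ⟨hi, rfl⟩
      have hb := h.hB i hi
      obtain ⟨x, hx⟩ := h.surj0 i (by omega)
      obtain ⟨y1, hy1⟩ := h.surj0 (i - 1) (by omega)
      obtain ⟨y2, hy2⟩ := h.surj0 (i + 1) (by omega)
      obtain ⟨y3, hy3⟩ := h.surj1 i hi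
      refine ⟨x, ?_, hx⟩
      rw [himg]
      have hsub : {(i - 1, false), (i + 1, false), (i, true)} ⊆ (G.neighborFinset x).image l := by
        intro z hz
        simp only [Finset.mem_insert, Finset.mem_singleton] at hz
        rw [Finset.mem_image]
        rcases hz with rfl | rfl | rfl
        · refine ⟨y1, ?_, hy1⟩
          rw [mem_neighborFinset, h.adj, hx, hy1]
          left; simp; omega
        · refine ⟨y2, ?_, hy2⟩
          rw [mem_neighborFinset, h.adj, hx, hy2]
          left; simp
        · refine ⟨y3, ?_, hy3⟩
          rw [mem_neighborFinset, h.adj, hx, hy3]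
          right; simp
      have h1 := Finset.card_le_card hsub
      rw [Finset.card_insert_of_notMem, Finset.card_insert_of_notMem, Finset.card_singleton] at h1
      · exact h1
      · simp
      · simp
  rw [← Finset.card_image_of_injective _ h.inj, key]
  simp

lemma catC_isTree (n a b : ℕ) (hn : 1 ≤ n) (h : a = 0 ∧ b = 0 ∨ 2 * (a + b) + 2 ≤ n) :
    (catC n a b).IsTree := by
  apply parentGraph_isTree
  · omega
  · intro v h0 hv
    split_ifs <;> omega
  · split_ifs <;> omega

lemma catC_lab (n a b : ℕ) (h : 2 * (a + b) + 2 ≤ n) :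
    Lab (catC n a b) (n - a - b) (BO (n - a - b) a b) (fun v =>
      if v.val < n - a - b then (v.val, false)
      else if v.val < n - b then (v.val - (n - a - b) + 1, true)
      else (v.val - a - b - 1, true)) where
  inj := by
    intro x y hxy
    have hx := x.2
    have hy := y.2
    apply Fin.ext
    simp only at hxy
    split_ifs at hxy <;> simp at hxy <;> omega
  lt := by
    intro x
    have hx := x.2
    split_ifs <;> simp only <;> omega
  memB := by
    intro x
    have hx := x.2
    simp only [BO, Finset.mem_union, Finset.mem_Icc]
    split_ifs <;> simp <;> omega
  surj0 := by
    intro i hi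
    refine ⟨⟨i, by omega⟩, ?_⟩
    simp [hi]
  surj1 := by
    intro i hi
    simp only [BO, Finset.mem_union, Finset.mem_Icc] at hi
    by_cases hia : i ≤ a
    · refine ⟨⟨n - a - b + i - 1, by omega⟩, ?_⟩
      simp only
      rw [if_neg (by omega), if_pos (by omega)]
      simp; omega
    · refine ⟨⟨i + a + b + 1, by omega⟩, ?_⟩
      simp only
      rw [if_neg (by omega), if_neg (by omega)]
      simp; omega
  hB := by
    intro i hi
    simp only [BO, Finset.mem_union, Finset.mem_Icc] at hi
    omega
  adj := by
    intro x y
    have hx := x.2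
    have hy := y.2
    rw [catC, parentGraph_adj, ne_eq, Fin.ext_iff]
    unfold LA
    split_ifs <;> simp <;> omega

section
variable {V : Type*} {G : SimpleGraph V} [Fintype V]

lemma side_leaf (hG : G.IsTree) {a b : V} (hab : G.Adj a b) (hb : G.degree b = 1) :
    (side G a b).card = 1 := by
  have h1 := card_ch hab
  have h2 : ch G a b = ∅ := Finset.card_eq_zero.1 (by omega)
  rw [card_side hG hab, h2]
  simp

lemma side_nonleaf (hG : G.IsTree) {a b : V} (hab : G.Adj a b) (hb : 2 ≤ G.degree b) :
    2 ≤ (side G a b).card := by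
  have h1 := card_ch hab
  obtain ⟨c, hc⟩ := Finset.card_pos.1 (show 0 < (ch G a b).card by omega)
  have h2 := card_side_lt hG hab hc
  have h3 := Finset.card_pos.2 ⟨_, self_mem_side hG.1 (mem_ch.1 hc).2⟩
  omega

lemma exists_nbr (hG : G.IsTree) (hn : 3 ≤ Fintype.card V) (x : V) : ∃ y, G.Adj y x := by
  obtain ⟨z, hz⟩ : ∃ z, z ≠ x := by
    by_contra h
    push Not at h
    have := Fintype.card_le_one_iff.2 (fun a b => (h a).trans (h b).symm)
    omega
  obtain ⟨p⟩ := hG.1.preconnected x z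
  cases p with
  | nil => exact absurd rfl hz
  | cons h p => exact ⟨_, h.symm⟩

lemma degree_pos' (hG : G.IsTree) (hn : 3 ≤ Fintype.card V) (x : V) : 1 ≤ G.degree x := by
  obtain ⟨y, hy⟩ := exists_nbr hG hn x
  have := card_ch hy
  omega

lemma leaves_le (hG : G.IsTree) (hn : 3 ≤ Fintype.card V) :
    (Finset.univ.filter fun x => G.degree x = 1).card ≤ cnt G 1 := by
  choose p hp using exists_nbr hG hn
  unfold cnt
  apply Finset.card_le_card_of_injOn (fun x => s(p x, x))
  · intro x hx
    simp only [Finset.coe_filter, Finset.mem_univ, true_and, Set.mem_setOf_eq] at hx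
    simp only [Finset.coe_filter, Set.mem_setOf_eq, mem_edgeFinset, mem_edgeSet]
    refine ⟨hp x, ?_⟩
    rw [msz_mk, side_leaf hG (hp x) hx]
    omega
  · intro x hx y hy hxy
    simp only [Finset.coe_filter, Finset.mem_univ, true_and, Set.mem_setOf_eq] at hx hy
    simp only [Sym2.eq_iff] at hxy
    rcases hxy with ⟨-, h⟩ | ⟨h1, h2⟩
    · exact h
    · exfalso
      have h3 := hp x
      rw [h1] at h3
      have h4 := card_side_add hG h3
      rw [side_leaf hG h3 hx, side_leaf hG h3.symm hy] at h4
      omega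

lemma leaves_deg (hG : G.IsTree) (hn : 3 ≤ Fintype.card V) :
    branchCount G + 2 + (Finset.univ.filter fun x => 4 ≤ G.degree x).card
      ≤ (Finset.univ.filter fun x => G.degree x = 1).card := by
  have h1 := G.sum_degrees_eq_twice_card_edges
  have h2 := (isTree_iff_connected_and_card.1 hG).2
  rw [Nat.card_eq_fintype_card, Nat.card_eq_fintype_card, ← edgeFinset_card] at h2
  unfold branchCount
  simp only [Finset.card_filter]
  have h3 : ∑ x : V, (2 + (if 3 ≤ G.degree x then 1 else 0) + (if 4 ≤ G.degree x then 1 else 0))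
      ≤ ∑ x : V, (G.degree x + if G.degree x = 1 then 1 else 0) := by
    apply Finset.sum_le_sum
    intro x _
    have := degree_pos' hG hn x
    split_ifs <;> omega
  simp only [Finset.sum_add_distrib, h1] at h3
  simp only [Finset.sum_const, Finset.card_univ, smul_eq_mul] at h3
  omega

lemma find_dart (hG : G.IsTree) (c N : ℕ) : ∀ a b : V, G.Adj a b → (side G a b).card ≤ N →
    2 ≤ (side G a b).card → (∀ x ∈ side G a b, G.degree x ≤ c + 1) →
    ∃ a' b', G.Adj a' b' ∧ side G a' b' ⊆ side G a b ∧ 2 ≤ (side G a' b').card ∧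
      (side G a' b').card ≤ c + 1 := by
  induction N with
  | zero => intro a b _ h1 h2; omega
  | succ N ih =>
    intro a b hab h1 h2 h3
    by_cases hc : ∃ x ∈ ch G a b, 2 ≤ (side G b x).card
    · obtain ⟨x, hx, hx2⟩ := hc
      obtain ⟨a', b', h4, h5, h6⟩ := ih b x (mem_ch.1 hx).2
        (by have := card_side_lt hG hab hx; omega) hx2
        (fun y hy => h3 y (side_sub hG hab hx hy))
      exact ⟨a', b', h4, h5.trans (side_sub hG hab hx), h6⟩
    · push Not at hc
      refine ⟨a, b, hab, subset_rfl, h2, ?_⟩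
      rw [card_side hG hab]
      have h4 : ∑ x ∈ ch G a b, (side G b x).card ≤ ∑ x ∈ ch G a b, 1 :=
        Finset.sum_le_sum fun x hx => by have := hc x hx; omega
      simp only [Finset.sum_const, smul_eq_mul, mul_one] at h4
      have h5 := card_ch hab
      have h6 := h3 b (self_mem_side hG.1 hab)
      omega

lemma dart_ne (hG : G.IsTree) {a b a' b' w : V} (h : G.Adj a b) (h' : G.Adj a' b')
    (hd : Disjoint (side G a b) (side G a' b')) (hw : w ∉ side G a b) (hw' : w ∉ side G a' b') :
    s(a, b) ≠ s(a', b') := by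
  intro he
  rw [Sym2.eq_iff] at he
  rcases he with ⟨rfl, rfl⟩ | ⟨rfl, rfl⟩
  · exact Finset.disjoint_left.1 hd (self_mem_side hG.1 h) (self_mem_side hG.1 h)
  · exact hw' ((mem_side_swap hG h).2 hw)

lemma three (hG : G.IsTree) (c : ℕ) {w x1 x2 x3 : V} (h1 : G.Adj w x1) (h2 : G.Adj w x2)
    (h3 : G.Adj w x3) (h12 : x1 ≠ x2) (h13 : x1 ≠ x3) (h23 : x2 ≠ x3) (d1 : 2 ≤ G.degree x1)
    (d2 : 2 ≤ G.degree x2) (d3 : 2 ≤ G.degree x3) (hd : ∀ x, x ≠ w → G.degree x ≤ c + 1)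
    (hc : 1 ≤ c) :
    cnt G 1 + 3 ≤ cnt G (c + 1) := by
  have key : ∀ x y, G.Adj w x → G.Adj w y → x ≠ y → 2 ≤ G.degree x → 2 ≤ G.degree y →
      ∃ a b, G.Adj a b ∧ side G a b ⊆ side G w x ∧ 2 ≤ msz G s(a, b) ∧ msz G s(a, b) ≤ c + 1 := by
    intro x y hx hy hxy dx dy
    obtain ⟨a, b, h4, h5, h6, h7⟩ := find_dart hG c _ w x hx le_rfl (side_nonleaf hG hx dx)
      (fun z hz => hd z (by rintro rfl; exact not_mem_side hz))
    refine ⟨a, b, h4, h5, ?_, ?_⟩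
    · rw [msz_mk]
      refine le_min h6 ((side_nonleaf hG hy dy).trans (Finset.card_le_card ?_))
      intro z hz
      rw [mem_side_swap hG h4]
      exact fun hz' => Finset.disjoint_left.1 (side_disj hG hx hy hxy) (h5 hz') hz
    · rw [msz_mk]
      exact (min_le_left _ _).trans h7
  obtain ⟨a1, b1, p1, q1, r1, s1⟩ := key x1 x2 h1 h2 h12 d1 d2
  obtain ⟨a2, b2, p2, q2, r2, s2⟩ := key x2 x1 h2 h1 h12.symm d2 d1
  obtain ⟨a3, b3, p3, q3, r3, s3⟩ := key x3 x1 h3 h1 h13.symm d3 d1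
  have w1 : w ∉ side G a1 b1 := fun h => not_mem_side (q1 h)
  have w2 : w ∉ side G a2 b2 := fun h => not_mem_side (q2 h)
  have w3 : w ∉ side G a3 b3 := fun h => not_mem_side (q3 h)
  have e12 := dart_ne hG p1 p2 ((side_disj hG h1 h2 h12).mono q1 q2) w1 w2
  have e13 := dart_ne hG p1 p3 ((side_disj hG h1 h3 h13).mono q1 q3) w1 w3
  have e23 := dart_ne hG p2 p3 ((side_disj hG h2 h3 h23).mono q2 q3) w2 w3
  have hcard : ({s(a1, b1), s(a2, b2), s(a3, b3)} : Finset (Sym2 V)).card = 3 :=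
    Finset.card_eq_three.2 ⟨_, _, _, e12, e13, e23, rfl⟩
  unfold cnt
  rw [← hcard, ← Finset.card_union_of_disjoint]
  · apply Finset.card_le_card
    intro e he
    simp only [Finset.mem_union, Finset.mem_filter, Finset.mem_insert,
      Finset.mem_singleton] at he ⊢
    rcases he with ⟨he, he'⟩ | rfl | rfl | rfl
    · exact ⟨he, by omega⟩
    · exact ⟨mem_edgeFinset.2 p1, s1⟩
    · exact ⟨mem_edgeFinset.2 p2, s2⟩
    · exact ⟨mem_edgeFinset.2 p3, s3⟩
  · rw [Finset.disjoint_left]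
    intro e he he'
    simp only [Finset.mem_filter, Finset.mem_insert, Finset.mem_singleton] at he he'
    rcases he' with rfl | rfl | rfl <;> omega

/-- distance facts -/
lemma dist_adj (hG : G.IsTree) (r : V) {x y : V} (h : G.Adj x y) :
    G.dist r y = G.dist r x + 1 ∨ G.dist r x = G.dist r y + 1 := by
  have h1 := h.diff_dist_adj (u := r)
  by_cases hr : r ∈ side G x y
  · rw [mem_side] at hr; omega
  · rw [← mem_side_swap hG h, mem_side] at hr; omega

lemma parent_unique (hG : G.IsTree) (r : V) {x y y' : V} (h : G.Adj x y) (h' : G.Adj x y')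
    (hd : G.dist r y + 1 = G.dist r x) (hd' : G.dist r y' + 1 = G.dist r x) : y = y' := by
  by_contra hne
  have h1 : r ∈ side G x y := mem_side.2 (by omega)
  have h2 : r ∈ side G x y' := mem_side.2 (by omega)
  exact Finset.disjoint_left.1 (side_disj hG h h' hne) h1 h2

lemma parent_exists (hG : G.IsTree) (r : V) {x : V} (hx : x ≠ r) :
    ∃ y, G.Adj x y ∧ G.dist r y + 1 = G.dist r x := by
  obtain ⟨p, hp⟩ := hG.1.exists_walk_length_eq_dist x r
  cases p with
  | nil => exact absurd rfl hx
  | @cons _ y _ h p =>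
    refine ⟨y, h, ?_⟩
    rw [Walk.length_cons] at hp
    have h1 := dist_le p
    rw [dist_comm (u := r) (v := y), dist_comm (u := r) (v := x)]
    have h2 := dist_adj hG r h
    rw [dist_comm (u := r) (v := y), dist_comm (u := r) (v := x)] at h2
    omega

lemma deg_one_of (hG : G.IsTree) (hn : 3 ≤ Fintype.card V) {x : V}
    (h : ∀ y y', G.Adj x y → G.Adj x y' → y = y') : G.degree x = 1 := by
  have h1 := degree_pos' hG hn x
  have h2 : (G.neighborFinset x).card ≤ 1 := by
    rw [Finset.card_le_one]
    intro a ha b hb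
    exact h a b (by simpa using ha) (by simpa using hb)
  rw [card_neighborFinset_eq_degree] at h2
  omega

lemma deg_two_of {x y y' : V} (h : G.Adj x y) (h' : G.Adj x y') (hne : y ≠ y') :
    2 ≤ G.degree x := by
  rw [← card_neighborFinset_eq_degree]
  have : 1 < (G.neighborFinset x).card :=
    Finset.one_lt_card.2 ⟨y, by simpa using h, y', by simpa using h', hne⟩
  omega

lemma deg_four_of {x a b c d : V} (ha : G.Adj x a) (hb : G.Adj x b) (hc : G.Adj x c)
    (hd : G.Adj x d) (hab : a ≠ b) (hac : a ≠ c) (had : a ≠ d) (hbc : b ≠ c) (hbd : b ≠ d)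
    (hcd : c ≠ d) : 4 ≤ G.degree x := by
  rw [← card_neighborFinset_eq_degree]
  have h1 : ({a, b, c, d} : Finset V).card = 4 := by
    rw [Finset.card_insert_of_notMem (by simp [hab, hac, had]),
      Finset.card_insert_of_notMem (by simp [hbc, hbd]),
      Finset.card_insert_of_notMem (by simp [hcd]), Finset.card_singleton]
  rw [← h1]
  apply Finset.card_le_card
  intro z hz
  simp only [Finset.mem_insert, Finset.mem_singleton] at hz
  rw [mem_neighborFinset]
  rcases hz with rfl | rfl | rfl | rfl <;> assumption

lemma deg_two_cases {x y y' : V} (h : G.degree x = 1) (h1 : G.Adj x y) (h2 : G.Adj x y') :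
    y = y' := by
  by_contra hne
  have := deg_two_of h1 h2 hne
  omega

end

section
variable {V : Type*} {G : SimpleGraph V} [Fintype V]

lemma exists_end (hG : G.IsTree) (hn : 3 ≤ Fintype.card V) :
    ∃ e0 y0, G.Adj e0 y0 ∧ G.degree e0 = 1 ∧ 2 ≤ G.degree y0 ∧
      ∀ x x', G.Adj y0 x → G.Adj y0 x' → 2 ≤ G.degree x → 2 ≤ G.degree x' → x = x' := by
  have : Nonempty V := hG.1.nonempty
  obtain ⟨r⟩ := this
  obtain ⟨e0, -, hmax⟩ := Finset.exists_max_image Finset.univ (fun x => G.dist r x) ⟨r, by simp⟩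
  have hleaf : ∀ x, G.dist r x = G.dist r e0 → G.degree x = 1 := by
    intro x hx
    apply deg_one_of hG hn
    intro y y' h h'
    have h1 := hmax y (by simp)
    have h2 := hmax y' (by simp)
    have h3 := dist_adj hG r h
    have h4 := dist_adj hG r h'
    exact parent_unique hG r h h' (by omega) (by omega)
  obtain ⟨y0, hy0⟩ := exists_nbr hG hn e0
  have hd0 := hleaf e0 rfl
  refine ⟨e0, y0, hy0.symm, hd0, ?_, ?_⟩
  · by_contra hd
    have h1 := degree_pos' hG hn y0
    have h2 := card_side_add hG hy0
    rw [side_leaf hG hy0 hd0, side_leaf hG hy0.symm (by omega)] at h2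
    omega
  · intro x x' hx hx' dx dx'
    have h1 := hmax x (by simp)
    have h2 := hmax x' (by simp)
    have h3 : G.dist r x ≠ G.dist r e0 := fun h => by have := hleaf x h; omega
    have h4 : G.dist r x' ≠ G.dist r e0 := fun h => by have := hleaf x' h; omega
    have h5 := dist_adj hG r hx
    have h6 := dist_adj hG r hx'
    have h7 := dist_adj hG r hy0
    have h8 := hmax y0 (by simp)
    exact parent_unique hG r hx hx' (by omega) (by omega)

lemma exists_lab (hG : G.IsTree) (hn : 3 ≤ Fintype.card V) (hd3 : ∀ x, G.degree x ≤ 3)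
    (h3 : ∀ w x1 x2 x3, G.Adj w x1 → G.Adj w x2 → G.Adj w x3 → x1 ≠ x2 → x1 ≠ x3 → x2 ≠ x3 →
      2 ≤ G.degree x1 → 2 ≤ G.degree x2 → 2 ≤ G.degree x3 → False) :
    ∃ m B l, 3 ≤ m ∧ Lab G m B l := by
  obtain ⟨e0, y0, hey, hde, hdy, hy1⟩ := exists_end hG hn
  obtain ⟨d, hd⟩ : ∃ d : V → ℕ, d = fun x => G.dist e0 x := ⟨_, rfl⟩
  have P1 : ∀ {x y}, G.Adj x y → d y = d x + 1 ∨ d x = d y + 1 := by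
    intro x y h; rw [hd]; exact dist_adj hG e0 h
  have P2 : ∀ {x y y'}, G.Adj x y → G.Adj x y' → d y + 1 = d x → d y' + 1 = d x → y = y' := by
    intro x y y' h h'; rw [hd]; exact parent_unique hG e0 h h'
  have P3 : ∀ {x}, x ≠ e0 → ∃ y, G.Adj x y ∧ d y + 1 = d x := by
    intro x h; rw [hd]; exact parent_exists hG e0 h
  have P0 : d e0 = 0 := by rw [hd]; simp
  clear hd
  have P0' : ∀ {x}, d x ≠ 0 → x ≠ e0 := fun h h' => h (by rw [h', P0])
  have Y1 : ∀ {x}, d x = 1 → x = y0 := by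
    intro x hx
    obtain ⟨p, hp, hpd⟩ := P3 (P0' (x := x) (by omega))
    have : p = e0 := by
      by_contra h
      obtain ⟨q, _, hq⟩ := P3 h
      omega
    subst this
    exact deg_two_cases hde hp.symm hey
  -- a vertex other than `e0` with a child is not a leaf
  have NL : ∀ {p x}, p ≠ e0 → G.Adj x p → d p + 1 = d x → 2 ≤ G.degree p := by
    intro p x hp hx hpd
    obtain ⟨q, hq, hqd⟩ := P3 hp
    exact deg_two_of hq hx.symm (by rintro rfl; omega)
  have NE : ∀ {x}, 2 ≤ G.degree x → x ≠ e0 := by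
    rintro x hx rfl; omega
  have POS : ∀ {x}, x ≠ e0 → 1 ≤ d x := by
    intro x hx
    obtain ⟨q, _, hq⟩ := P3 hx
    omega
  have INJ : ∀ t x x', d x = t → d x' = t → 2 ≤ G.degree x → 2 ≤ G.degree x' → x = x' := by
    intro t
    induction t with
    | zero =>
      intro x x' hx _ dx
      have := POS (NE dx)
      omega
    | succ t ih =>
      intro x x' hx hx' dx dx'
      by_cases ht : t = 0
      · rw [Y1 (x := x) (by omega), Y1 (x := x') (by omega)]
      obtain ⟨p, hp, hpd⟩ := P3 (NE dx)
      obtain ⟨p', hp', hpd'⟩ := P3 (NE dx')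
      have hpe : p ≠ e0 := P0' (by omega)
      have hpe' : p' ≠ e0 := P0' (by omega)
      have := ih p p' (by omega) (by omega) (NL hpe hp hpd) (NL hpe' hp' hpd')
      subst this
      by_contra hne
      by_cases hpy : p = y0
      · subst hpy
        exact hne (hy1 x x' hp.symm hp'.symm dx dx')
      · have h1 : d p ≠ 1 := fun h => hpy (Y1 h)
        obtain ⟨q, hq, hqd⟩ := P3 hpe
        have hqe : q ≠ e0 := P0' (by omega)
        exact h3 p x x' q hp.symm hp'.symm hq hne (by rintro rfl; omega) (by rintro rfl; omega)
          dx dx' (NL hqe hq hqd)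
  obtain ⟨z, hz, hmax⟩ := Finset.exists_max_image
    (Finset.univ.filter fun x => 2 ≤ G.degree x) d ⟨y0, by simp [hdy]⟩
  simp only [Finset.mem_filter, Finset.mem_univ, true_and] at hz hmax
  obtain ⟨M, hM⟩ : ∃ M, M = d z := ⟨_, rfl⟩
  rw [← hM] at hmax
  have hM1 : 1 ≤ M := by have := POS (NE hz); omega
  obtain ⟨e1, he1, hde1⟩ : ∃ e1, G.Adj z e1 ∧ d e1 = M + 1 := by
    by_contra h
    push Not at h
    have := deg_one_of hG hn (x := z) (fun y y' hy hy' => by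
      have a1 := P1 hy
      have a2 := P1 hy'
      have a3 := h y hy
      have a4 := h y' hy'
      exact P2 hy hy' (by omega) (by omega))
    omega
  obtain ⟨sp, hsp⟩ : ∃ sp : V → Prop, ∀ x, sp x ↔ (x = e0 ∨ x = e1 ∨ 2 ≤ G.degree x) :=
    ⟨_, fun _ => Iff.rfl⟩
  have F1 : ∀ {x x'}, sp x → sp x' → d x = d x' → x = x' := by
    intro x x' hx hx' he
    rw [hsp] at hx hx'
    rcases hx with rfl | rfl | hx <;> rcases hx' with rfl | rfl | hx'
    · rfl
    · omega
    · have := POS (NE hx'); omega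
    · omega
    · rfl
    · have := hmax _ hx'; omega
    · have := POS (NE hx); omega
    · have := hmax _ hx; omega
    · exact INJ _ x x' rfl he.symm hx hx'
  have F4 : ∀ {p x}, G.Adj x p → d p + 1 = d x → sp p := by
    intro p x hx hpd
    rw [hsp]
    by_cases hp : p = e0
    · exact Or.inl hp
    · exact Or.inr (Or.inr (NL hp hx hpd))
  have F2' : ∀ i, i ≤ M → ∃ x, sp x ∧ d x + i = M := by
    intro i
    induction i with
    | zero => exact fun _ => ⟨z, (hsp z).2 (Or.inr (Or.inr hz)), by omega⟩
    | succ i ih =>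
      intro hi
      obtain ⟨x, hx, hxd⟩ := ih (by omega)
      obtain ⟨p, hp, hpd⟩ := P3 (P0' (x := x) (by omega))
      exact ⟨p, F4 hp hpd, by omega⟩
  have F2 : ∀ i, i ≤ M + 1 → ∃ x, sp x ∧ d x = i := by
    intro i hi
    by_cases hiM : i = M + 1
    · exact ⟨e1, (hsp e1).2 (Or.inr (Or.inl rfl)), by omega⟩
    · obtain ⟨x, hx, hxd⟩ := F2' (M - i) (by omega)
      exact ⟨x, hx, by omega⟩
  have F3 : ∀ x, d x ≤ M + 1 := by
    intro x
    by_cases hx : x = e0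
    · subst hx; omega
    obtain ⟨p, hp, hpd⟩ := P3 hx
    by_cases hpe : p = e0
    · subst hpe; omega
    · have := hmax p (NL hpe hp hpd)
      omega
  have F5 : ∀ {x}, ¬ sp x → 2 ≤ d x := by
    intro x hx
    rw [hsp] at hx
    push Not at hx
    have h1 := POS hx.1
    by_contra h2
    have := Y1 (x := x) (by omega)
    subst this
    omega
  have PAR : ∀ {x y}, sp x → d x + 1 = d y → G.Adj x y := by
    intro x y hx hxy
    obtain ⟨p, hp, hpd⟩ := P3 (P0' (x := y) (by omega))
    have := F1 (F4 hp hpd) hx (by omega)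
    subst this
    exact hp.symm
  refine ⟨M + 2, (Finset.univ.filter fun x => ¬ sp x).image (fun x => d x - 1),
    fun x => if sp x then (d x, false) else (d x - 1, true), by omega, ?_⟩
  constructor
  · intro x x' hxx
    simp only at hxx
    by_cases hx : sp x <;> by_cases hx' : sp x' <;> simp [hx, hx'] at hxx
    · exact F1 hx hx' hxx
    · have h1 := F5 hx
      have h2 := F5 hx'
      by_contra hne
      obtain ⟨p, hp, hpd⟩ := P3 (P0' (x := x) (by omega))
      obtain ⟨q, hq, hqd⟩ := P3 (P0' (x := p) (by omega))
      obtain ⟨s, hs, hsd⟩ := F2 (d x) (F3 x)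
      have h4 := deg_four_of hp.symm (PAR (F4 hp hpd) (by omega) : G.Adj p x') hq
        (PAR (F4 hp hpd) (by omega) : G.Adj p s) hne (by rintro rfl; omega)
        (by rintro rfl; exact hx hs) (by rintro rfl; omega) (by rintro rfl; exact hx' hs)
        (by rintro rfl; omega)
      have := hd3 p
      omega
  · intro x
    have := F3 x
    split_ifs <;> simp only <;> omega
  · intro x hx
    by_cases h : sp x
    · simp [h] at hx
    · rw [Finset.mem_image]
      exact ⟨x, by simp [h], by simp [h]⟩
  · intro i hi
    obtain ⟨x, hx, hxd⟩ := F2 i (by omega)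
    exact ⟨x, by simp [hx, hxd]⟩
  · intro i hi
    obtain ⟨x, hx, rfl⟩ := Finset.mem_image.1 hi
    simp only [Finset.mem_filter, Finset.mem_univ, true_and] at hx
    exact ⟨x, by simp [hx]⟩
  · intro i hi
    obtain ⟨x, hx, rfl⟩ := Finset.mem_image.1 hi
    simp only [Finset.mem_filter, Finset.mem_univ, true_and] at hx
    have h1 := F5 hx
    have h2 := F3 x
    omega
  · intro x y
    have hup : ∀ x y, G.Adj x y → d y = d x + 1 →
        LA (if sp x then (d x, false) else (d x - 1, true))
          (if sp y then (d y, false) else (d y - 1, true)) := by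
      intro x y h hxy
      have hx : sp x := F4 h.symm (by omega)
      rw [if_pos hx]
      by_cases hy : sp y
      · rw [if_pos hy]
        left
        exact ⟨rfl, rfl, Or.inl hxy.symm⟩
      · rw [if_neg hy]
        right
        refine ⟨by simp, ?_⟩
        simp only
        omega
    have LAsymm : ∀ p q, LA p q → LA q p := by
      intro p q h
      rcases h with ⟨a, b, c⟩ | ⟨a, b⟩
      · exact Or.inl ⟨b, a, c.symm⟩
      · exact Or.inr ⟨a.symm, b.symm⟩
    constructor
    · intro h
      rcases P1 h with h1 | h1
      · exact hup x y h h1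
      · exact LAsymm _ _ (hup y x h.symm h1)
    · intro h
      by_cases hx : sp x <;> by_cases hy : sp y <;> simp [hx, hy, LA] at h
      · rcases h with h | h
        · exact PAR hx h
        · exact (PAR hy h).symm
      · have := F5 hy
        exact PAR hx (by omega)
      · have := F5 hx
        exact (PAR hy (by omega)).symm

lemma cnt_le_edges (hG : G.IsTree) (j : ℕ) : cnt G j ≤ Fintype.card V - 1 := by
  have h2 := (isTree_iff_connected_and_card.1 hG).2
  rw [Nat.card_eq_fintype_card, Nat.card_eq_fintype_card, ← edgeFinset_card] at h2
  have := Finset.card_filter_le G.edgeFinset (fun e => msz G e ≤ j)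
  unfold cnt
  omega

lemma cnt_zero (hG : G.IsTree) : cnt G 0 = 0 := by
  unfold cnt
  rw [Finset.card_eq_zero, Finset.filter_eq_empty_iff]
  intro e he
  have := msz_pos hG (mem_edgeFinset.1 he)
  omega

end

lemma main_ge3 (n k : ℕ) (hn : 3 ≤ n) (hk : 2 * k + 2 ≤ n)
    (T : SimpleGraph (Fin n)) (hT : T.IsTree) (hbr : branchCount T = k)
    (hmin : ∀ T' : SimpleGraph (Fin n), T'.IsTree → branchCount T' = k →
      mostar T ≤ mostar T') :
    Nonempty (T ≃g catC n ((k + 1) / 2) (k / 2)) := by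
  have hC := catC_isTree n ((k + 1) / 2) (k / 2) (by omega) (by omega)
  have hlab := catC_lab n ((k + 1) / 2) (k / 2) (by omega)
  have hm : n - (k + 1) / 2 - k / 2 = n - k := by omega
  have hBOc := card_BO (n - k) ((k + 1) / 2) (k / 2) (by omega)
  have hBOk : (BO (n - k) ((k + 1) / 2) (k / 2)).card = k := by omega
  generalize hl : (fun v : Fin n => if v.val < n - (k + 1) / 2 - k / 2 then (v.val, false)
      else if v.val < n - k / 2 then (v.val - (n - (k + 1) / 2 - k / 2) + 1, true)
      else (v.val - (k + 1) / 2 - k / 2 - 1, true)) = lC at hlab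
  rw [hm] at hlab
  have hbC : branchCount (catC n ((k + 1) / 2) (k / 2)) = k := by
    rw [hlab.branch, hBOk]
  have hle := hmin _ hC hbC
  have hCup : ∀ j, 1 ≤ j → cnt (catC n ((k + 1) / 2) (k / 2)) j
      ≤ max (2 * j) (k + 2 * ((j + 1) / 2)) := by
    intro j hj
    rw [hlab.cnt hC (by omega) j hj]
    have := BO_upper (n - k) k j (by omega)
    rw [hBOk]
    exact this
  have hcmp : ∀ j, j < n → cnt T j ≤ cnt (catC n ((k + 1) / 2) (k / 2)) j := by
    intro j hj
    refine cnt_compare hT hC hle (fun i => ?_) j (by simpa using hj)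
    by_cases hi : i = 0
    · subst hi
      rw [cnt_zero hC]; omega
    · have h1 := cnt_lower hT i (by omega)
      have h2 := hCup i (by omega)
      have h3 := cnt_le_edges hC i
      rw [hbr] at h1
      exact (le_min h3 h2).trans h1
  have hup : ∀ j, 1 ≤ j → j < n → cnt T j ≤ max (2 * j) (k + 2 * ((j + 1) / 2)) :=
    fun j h1 h2 => (hcmp j h2).trans (hCup j h1)
  have hn' : 3 ≤ Fintype.card (Fin n) := by simpa using hn
  have hl1 := leaves_le hT hn'
  have hl2 := leaves_deg hT hn'
  have hl3 := hup 1 le_rfl (by omega)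
  rw [hbr] at hl2
  have hl4 : cnt T 1 = k + 2 := by omega
  have hl5 : (Finset.univ.filter fun x => 4 ≤ T.degree x).card = 0 := by omega
  have hd3 : ∀ x, T.degree x ≤ 3 := by
    intro x
    rw [Finset.card_eq_zero, Finset.filter_eq_empty_iff] at hl5
    have := hl5 (Finset.mem_univ x)
    omega
  have h3 : ∀ w x1 x2 x3, T.Adj w x1 → T.Adj w x2 → T.Adj w x3 → x1 ≠ x2 → x1 ≠ x3 → x2 ≠ x3 →
      2 ≤ T.degree x1 → 2 ≤ T.degree x2 → 2 ≤ T.degree x3 → False := by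
    intro w x1 x2 x3 a1 a2 a3 h12 h13 h23 d1 d2 d3
    have hw : 3 ≤ T.degree w := by
      rw [← card_neighborFinset_eq_degree]
      have : ({x1, x2, x3} : Finset (Fin n)).card = 3 :=
        Finset.card_eq_three.2 ⟨_, _, _, h12, h13, h23, rfl⟩
      rw [← this]
      apply Finset.card_le_card
      intro z hz
      simp only [Finset.mem_insert, Finset.mem_singleton] at hz
      rw [mem_neighborFinset]
      rcases hz with rfl | rfl | rfl <;> assumption
    have hwm : w ∈ Finset.univ.filter fun v => 3 ≤ T.degree v := by simpa using hw
    unfold branchCount at hbr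
    by_cases hk2 : 2 ≤ k
    · have h4 := three hT 2 a1 a2 a3 h12 h13 h23 d1 d2 d3 (fun x _ => hd3 x) (by omega)
      have h5 := hup 3 (by omega) (by omega)
      norm_num at h4 h5
      omega
    · have hk0 := Finset.card_pos.2 ⟨w, hwm⟩
      have hk1 : k = 1 := by omega
      have h4 := three hT 1 a1 a2 a3 h12 h13 h23 d1 d2 d3 (fun x hx => by
        by_contra hc
        have h5 := Finset.card_le_one.1 (le_of_eq (hbr.trans hk1)) x
          (by simp only [Finset.mem_filter, Finset.mem_univ, true_and]; omega) w hwm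
        exact hx h5) (by omega)
      have h5 := hup 2 (by omega) (by omega)
      norm_num at h4 h5
      omega
  obtain ⟨m, B, l, hm3, hB⟩ := exists_lab hT hn' hd3 h3
  have hBk : B.card = k := by rw [← hB.branch, hbr]
  have hmn := hB.card (by omega)
  rw [Fintype.card_fin, hBk] at hmn
  have hm' : n - k = m := by omega
  rw [hm'] at hlab
  rcases positions hBk (by omega) hB.hB (fun j h1 h2 => by
    have h4 := hup j h1 (by omega)
    rw [hB.cnt hT (by omega) j h1, hBk] at h4
    rw [hBk]
    exact h4) with h | h
  · rw [h] at hB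
    exact hB.iso hlab
  · have hB' := hB.reflect
    rw [h] at hB'
    exact hB'.iso hlab

lemma main_le2 (n : ℕ) (hn : n ≤ 2) (T T' : SimpleGraph (Fin n)) (hT : T.IsTree)
    (hT' : T'.IsTree) : Nonempty (T ≃g T') := by
  have key : ∀ S : SimpleGraph (Fin n), S.IsTree → S = ⊤ := by
    intro S hS
    ext x y
    rw [top_adj]
    refine ⟨fun h => h.ne, fun hne => ?_⟩
    obtain ⟨p⟩ := hS.1.preconnected x y
    cases p with
    | nil => exact absurd rfl hne
    | @cons _ z _ h p =>
      have hz : z = y := by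
        have h1 := h.ne
        apply Fin.ext
        have h2 : x.val ≠ z.val := fun h => h1 (Fin.ext h)
        have h3 : x.val ≠ y.val := fun h => hne (Fin.ext h)
        have := x.2
        have := y.2
        have := z.2
        omega
      rw [← hz]
      exact h
  rw [key T hT, key T' hT']
  exact ⟨Iso.refl⟩

lemma main_final (n k : ℕ) (hk : k ≤ n / 2 - 1)
    (T : SimpleGraph (Fin n)) (hT : T.IsTree) (hbr : branchCount T = k)
    (hmin : ∀ T' : SimpleGraph (Fin n), T'.IsTree → branchCount T' = k →
      mostar T ≤ mostar T') :
    Nonempty (T ≃g catC n ((k + 1) / 2) (k / 2)) := by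
  by_cases hn : 3 ≤ n
  · exact main_ge3 n k hn (by omega) T hT hbr hmin
  · have hk0 : k = 0 := by omega
    have hn0 : 1 ≤ n := by
      obtain ⟨x⟩ := hT.1.nonempty
      have := x.2
      omega
    exact main_le2 n (by omega) _ _ hT (catC_isTree _ _ _ hn0 (by omega))

end MB

/-- the tree minimizing the Mostar index among trees of order n with exactly
k branch vertices (0 ≤ k ≤ n/2 - 1) is C_{n,⌈k/2⌉,⌊k/2⌋}. -/
theorem min_mostar_branch_vertices (n k : ℕ) (hk : k ≤ n / 2 - 1)
    (T : SimpleGraph (Fin n)) (hT : T.IsTree) (hbr : branchCount T = k)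
    (hmin : ∀ T' : SimpleGraph (Fin n), T'.IsTree → branchCount T' = k →
      mostar T ≤ mostar T') :
    Nonempty (T ≃g catC n ((k + 1) / 2) (k / 2)) := by
  exact MB.main_final n k hk T hT hbr hmin
end

section
/- Let T be a tree on 2n vertices all of which have odd degree, and suppose T has the maximum Mostar index among all such trees. Then T is isomorphic to the star S_{2n}. -/
open Finset SimpleGraph

open scoped Classical

lemma psi_bound {V : Type*} [Fintype V] (G : SimpleGraph V) (hG : G.IsTree) {u v : V}
    (h : G.Adj u v) :
    mostarPsi G s(u, v) ≤ Fintype.card V - 2 ∧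
    (mostarPsi G s(u, v) = Fintype.card V - 2 →
      (∀ w, G.Adj u w → w = v) ∨ (∀ w, G.Adj v w → w = u)) := by
  have key : ∀ {a b : V}, G.Adj a b →
      (Finset.univ.filter fun w => G.dist w a < G.dist w b).card ≤ 1 →
      ∀ w, G.Adj a w → w = b := by
    intro a b hab hc w haw
    by_contra hwb
    have hwa : G.dist w a = 1 := dist_eq_one_iff_adj.mpr haw.symm
    have h0 : 0 < G.dist w b := hG.1.pos_dist_of_ne hwb
    have h1 := hG.dist_ne_of_adj w hab
    have ha : a ∈ Finset.univ.filter fun w => G.dist w a < G.dist w b := by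
      simpa using hG.1.pos_dist_of_ne hab.ne
    have hw : w ∈ Finset.univ.filter fun w => G.dist w a < G.dist w b := by
      simp only [Finset.mem_filter, Finset.mem_univ, true_and]
      omega
    exact haw.ne (Finset.card_le_one.mp hc _ ha _ hw)
  have hdisj : Disjoint (Finset.univ.filter fun w => G.dist w u < G.dist w v)
      (Finset.univ.filter fun w => G.dist w v < G.dist w u) := by
    rw [Finset.disjoint_left]
    intro w h1 h2
    simp only [Finset.mem_filter, Finset.mem_univ, true_and] at h1 h2
    omega
  have hle := Finset.card_le_univ ((Finset.univ.filter fun w => G.dist w u < G.dist w v) ∪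
      (Finset.univ.filter fun w => G.dist w v < G.dist w u))
  rw [Finset.card_union_of_disjoint hdisj] at hle
  have hu : 0 < (Finset.univ.filter fun w => G.dist w u < G.dist w v).card :=
    Finset.card_pos.mpr ⟨u, by simpa using hG.1.pos_dist_of_ne h.ne⟩
  have hv : 0 < (Finset.univ.filter fun w => G.dist w v < G.dist w u).card :=
    Finset.card_pos.mpr ⟨v, by simpa using hG.1.pos_dist_of_ne h.ne.symm⟩
  have hk1 := key h
  have hk2 := key h.symm
  simp only [mostarPsi, Sym2.lift_mk]
  refine ⟨by omega, fun heq => ?_⟩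
  by_cases hc : (Finset.univ.filter fun w => G.dist w u < G.dist w v).card ≤ 1
  · exact Or.inl (hk1 hc)
  · exact Or.inr (hk2 (by omega))

lemma psi_star {V : Type*} [Fintype V] (r v : V) (h : r ≠ v) :
    mostarPsi (starGraph r) s(r, v) = Fintype.card V - 2 := by
  have hc := connected_starGraph r
  have hlt : ∀ w, w ≠ v → (starGraph r).dist w r < (starGraph r).dist w v := by
    intro w hw
    have h0 := hc.pos_dist_of_ne hw
    by_cases hwr : w = r
    · subst hwr
      simpa using h0
    · have h1 : (starGraph r).dist w r = 1 := dist_eq_one_iff_adj.mpr (by simp [hwr])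
      have h2 : (starGraph r).dist w v ≠ 1 := by
        intro h3
        have := dist_eq_one_iff_adj.mp h3
        grind [starGraph_adj]
      omega
  have hv : (starGraph r).dist v v < (starGraph r).dist v r := by
    simpa using hc.pos_dist_of_ne h.symm
  have e1 : (Finset.univ.filter fun w => (starGraph r).dist w r < (starGraph r).dist w v)
      = Finset.univ.erase v := by
    ext w
    by_cases hw : w = v
    · subst hw
      simp
    · simp [hw, hlt w hw]
  have e2 : (Finset.univ.filter fun w => (starGraph r).dist w v < (starGraph r).dist w r)
      = {v} := by
    ext w
    by_cases hw : w = v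
    · subst hw
      simpa using hv
    · simpa [hw] using (hlt w hw).le
  have hcard : 2 ≤ Fintype.card V := by
    have := Fintype.one_lt_card_iff.mpr ⟨r, v, h⟩
    omega
  simp only [mostarPsi, Sym2.lift_mk, e1, e2, Finset.card_singleton,
    Finset.card_erase_of_mem (Finset.mem_univ v), Finset.card_univ]
  omega

lemma mostar_star {V : Type*} [Fintype V] (r : V) :
    mostar (starGraph r) = (Fintype.card V - 1) * (Fintype.card V - 2) := by
  have c1 : (starGraph r).edgeFinset.card = Fintype.card V - 1 := by
    have := (isTree_starGraph r).card_edgeFinset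
    omega
  rw [← c1, ← smul_eq_mul, ← Finset.sum_const]
  unfold mostar
  refine Finset.sum_congr (by ext; simp) fun e he => ?_
  induction e using Sym2.ind with
  | _ x y =>
    rw [mem_edgeFinset, mem_edgeSet, starGraph_adj] at he
    obtain ⟨hne, rfl | rfl⟩ := he
    · exact psi_star _ _ hne
    · rw [Sym2.eq_swap]
      exact psi_star _ _ hne.symm

/-- the tree maximizing the Mostar index among trees on 2n vertices all of
odd degree is the star S_{2n}. -/
theorem max_mostar_all_odd (n : ℕ) (T : SimpleGraph (Fin (2 * n))) (hT : T.IsTree)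
    (hodd : ∀ v, Odd (T.degree v))
    (hmax : ∀ T' : SimpleGraph (Fin (2 * n)), T'.IsTree → (∀ v, Odd (T'.degree v)) →
      mostar T' ≤ mostar T) :
    Nonempty (T ≃g starG (2 * n)) := by
  have hne : Nonempty (Fin (2 * n)) := hT.1.nonempty
  obtain ⟨z⟩ := hne
  have hn : 0 < 2 * n := z.pos
  set r : Fin (2 * n) := ⟨0, hn⟩ with hr
  have hstarodd : ∀ v, Odd ((starGraph r).degree v) := by
    intro v
    by_cases hv : v = r
    · have h1 : (starGraph r).degree r = 2 * n - 1 := by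
        have := degree_starGraph_center (r := r)
        rw [Fintype.card_fin] at this
        convert this
      rw [hv, h1]
      exact ⟨n - 1, by omega⟩
    · have h1 : (starGraph r).degree v = 1 := by
        convert degree_starGraph_of_ne_center hv
      rw [h1]
      exact odd_one
  have hge := hmax _ (isTree_starGraph r) (by
    intro v
    convert hstarodd v)
  rw [mostar_star, Fintype.card_fin] at hge
  have c2 := hT.card_edgeFinset
  have c3 : 2 * n - 1 = T.edgeFinset.card := by
    have c2' : T.edgeFinset.card + 1 = Fintype.card (Fin (2 * n)) := by
      convert c2
    rw [Fintype.card_fin] at c2'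
    omega
  rw [c3, ← smul_eq_mul, ← Finset.sum_const] at hge
  have hle : ∀ e ∈ T.edgeFinset, mostarPsi T e ≤ 2 * n - 2 := by
    intro e he
    induction e using Sym2.ind with
    | _ x y =>
      rw [mem_edgeFinset, mem_edgeSet] at he
      simpa using (psi_bound T hT he).1
  have heq := (Finset.sum_eq_sum_iff_of_le hle).mp (le_antisymm (Finset.sum_le_sum hle) hge)
  have hleaf : ∀ u v, T.Adj u v → (∀ w, T.Adj u w → w = v) ∨ (∀ w, T.Adj v w → w = u) := by
    intro u v h
    refine (psi_bound T hT h).2 ?_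
    rw [Fintype.card_fin]
    exact heq _ (by rw [mem_edgeFinset, mem_edgeSet]; exact h)
  have hcent : ∃ c, ∀ x, T.Adj c x → ∀ w, T.Adj x w → w = c := by
    by_contra hcon
    push Not at hcon
    obtain ⟨x, hx, w, hxw, hw⟩ := hcon r
    obtain ⟨y, hy, w', hyw, hw'⟩ := hcon x
    rcases hleaf x y hy with h | h
    · exact hw ((h w hxw).trans (h r hx.symm).symm)
    · exact hw' (h w' hyw)
  obtain ⟨c, hc⟩ := hcent
  have hall : ∀ x, x = c ∨ T.Adj c x := by
    intro x
    obtain ⟨p⟩ := hT.1.preconnected x c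
    induction p with
    | nil => exact Or.inl rfl
    | cons h p ih =>
      rcases ih hc with rfl | h2
      · exact Or.inr h.symm
      · exact Or.inl (hc _ h2 _ h.symm)
  have hadj : ∀ x y, T.Adj x y ↔ x ≠ y ∧ (x = c ∨ y = c) := by
    intro x y
    constructor
    · intro h
      refine ⟨h.ne, ?_⟩
      rcases hall x with h1 | h1
      · exact Or.inl h1
      · exact Or.inr (hc x h1 y h)
    · rintro ⟨h, rfl | rfl⟩
      · exact (hall y).resolve_left h.symm
      · exact ((hall x).resolve_left h).symm
  have hsadj : ∀ x y, (starG (2 * n)).Adj x y ↔ x ≠ y ∧ (x = r ∨ y = r) := by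
    intro x y
    simp only [starG, parentGraph, SimpleGraph.fromRel_adj, hr, Fin.ext_iff]
    grind
  refine ⟨⟨Equiv.swap c r, ?_⟩⟩
  intro x y
  have hs : ∀ x, Equiv.swap c r x = r ↔ x = c := by
    intro x
    rw [Equiv.swap_apply_eq_iff, Equiv.swap_apply_right]
  rw [hsadj, hadj, hs, hs, (Equiv.swap c r).injective.ne_iff]
end

section
/- Let T be a tree on 2n vertices all of which have odd degree, and suppose T has the minimum Mostar index among all such trees. Then T is isomorphic to C_{2n,0,n−1}. -/
open Finset SimpleGraph

open scoped Classical

section TreeToolkit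

variable {V : Type*} {T : SimpleGraph V}

lemma tree_closer_unique (hT : T.IsTree) {w v x y : V} (hx : T.Adj v x) (hy : T.Adj v y)
    (h1 : T.dist w x < T.dist w v) (h2 : T.dist w y < T.dist w v) : x = y := by
  obtain ⟨p, hp, hp'⟩ := hT.connected.exists_path_of_dist w x
  obtain ⟨q, hq, hq'⟩ := hT.connected.exists_path_of_dist w y
  have hvp : v ∉ p.support := by
    intro h
    have := T.dist_le (p.takeUntil v h)
    have := p.length_takeUntil_le_length h
    omega
  have hvq : v ∉ q.support := by
    intro h
    have := T.dist_le (q.takeUntil v h)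
    have := q.length_takeUntil_le_length h
    omega
  have := (hT.isAcyclic.subsingleton_path w v).elim ⟨_, hp.concat hvp hx.symm⟩
    ⟨_, hq.concat hvq hy.symm⟩
  have h3 := congrArg (fun r : T.Path w v => r.1.penultimate) this
  simpa using h3

lemma tree_exists_closer (hT : T.IsTree) {w v : V} (h : v ≠ w) :
    ∃ x, T.Adj v x ∧ T.dist w v = T.dist w x + 1 := by
  obtain ⟨p, hp⟩ := hT.connected.exists_walk_length_eq_dist v w
  cases p with
  | nil => exact absurd rfl h
  | cons hadj q =>
    refine ⟨_, hadj, ?_⟩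
    have h1 := T.dist_le q
    have h2 := hT.dist_eq_dist_add_one_of_adj w hadj
    simp only [Walk.length_cons] at hp
    rw [T.dist_comm (u := v)] at hp
    rw [T.dist_comm (v := w)] at h1
    omega

lemma tree_cross (hT : T.IsTree) {a b x y : V} (hab : T.Adj a b) (hxy : T.Adj x y)
    (h1 : T.dist x a < T.dist x b) (h2 : T.dist y b < T.dist y a) : x = a ∧ y = b := by
  have e1 := hT.dist_eq_dist_add_one_of_adj x hab
  have e2 := hT.dist_eq_dist_add_one_of_adj y hab
  have e3 := hT.dist_eq_dist_add_one_of_adj a hxy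
  have e4 := hT.dist_eq_dist_add_one_of_adj b hxy
  rw [T.dist_comm (u := a), T.dist_comm (u := a)] at e3
  rw [T.dist_comm (u := b), T.dist_comm (u := b)] at e4
  by_cases hxa : x = a
  · subst hxa
    have : T.dist x x = 0 := T.dist_self
    refine ⟨rfl, ?_⟩
    have h0 : T.dist y b = 0 := by omega
    exact (hT.connected.dist_eq_zero_iff).1 h0
  · exfalso
    obtain ⟨x', hx', hd⟩ := tree_exists_closer hT hxa
    have e5 := hT.dist_eq_dist_add_one_of_adj x' hab
    have c1 : T.dist a x = T.dist x a := T.dist_comm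
    have c2 : T.dist b x = T.dist x b := T.dist_comm
    have c3 : T.dist b y = T.dist y b := T.dist_comm
    have c4 : T.dist a x' = T.dist x' a := T.dist_comm
    have c5 : T.dist b x' = T.dist x' b := T.dist_comm
    have : x' = y := tree_closer_unique hT (w := b) hx' hxy (by omega) (by omega)
    subst this
    omega

lemma tree_same_side (hT : T.IsTree) {a b x y : V} (hab : T.Adj a b) (hxy : T.Adj x y)
    (hne : s(x, y) ≠ s(a, b)) (h : T.dist x a < T.dist x b) : T.dist y a < T.dist y b := by
  by_contra h2
  have := hT.dist_ne_of_adj y hab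
  obtain ⟨rfl, rfl⟩ := tree_cross hT hab hxy h (by omega)
  exact hne rfl

lemma mostarPsi_mk [Fintype V] (u v : V) : mostarPsi T s(u, v) =
    (((Finset.univ.filter fun w => T.dist w u < T.dist w v).card : ℤ) -
      ((Finset.univ.filter fun w => T.dist w v < T.dist w u).card : ℤ)).natAbs := rfl

lemma side_card [Fintype V] (hT : T.IsTree) {u v : V} (h : T.Adj u v) :
    (Finset.univ.filter fun w => T.dist w u < T.dist w v).card +
      (Finset.univ.filter fun w => T.dist w v < T.dist w u).card = Fintype.card V := by
  rw [← Finset.card_univ, ← Finset.card_filter_add_card_filter_not (s := Finset.univ)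
    (fun w => T.dist w u < T.dist w v)]
  congr 2
  ext w
  have := hT.dist_ne_of_adj w h
  simp only [Finset.mem_filter, Finset.mem_univ, true_and]
  omega

/-- Number of edges separating `w` from the root. -/
lemma sep_card [Fintype V] (hT : T.IsTree) (c : V) (par : V → V)
    (hpar : ∀ v, v ≠ c → T.Adj v (par v) ∧ T.dist c v = T.dist c (par v) + 1) :
    ∀ k w, T.dist c w = k →
    (Finset.univ.filter fun v => v ≠ c ∧ T.dist w v < T.dist w (par v)).card ≤ k := by
  intro k
  induction k with
  | zero =>
    intro w hw
    have : c = w := (hT.connected.dist_eq_zero_iff).1 hw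
    subst this
    rw [Nat.le_zero, Finset.card_eq_zero, Finset.filter_eq_empty_iff]
    rintro v - ⟨h1, h2⟩
    have := (hpar v h1).2
    omega
  | succ k ih =>
    intro w hw
    have hwc : w ≠ c := by
      rintro rfl
      simp at hw
    obtain ⟨ha, hd⟩ := hpar w hwc
    have h1 := ih (par w) (by omega)
    refine le_trans (Finset.card_le_card (t := insert w (Finset.univ.filter fun v => v ≠ c ∧
      T.dist (par w) v < T.dist (par w) (par v))) ?_) (le_trans (Finset.card_insert_le _ _) (by omega))
    intro v hv
    simp only [Finset.mem_filter, Finset.mem_univ, true_and, Finset.mem_insert] at hv ⊢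
    by_cases hvw : v = w
    · exact Or.inl hvw
    · refine Or.inr ⟨hv.1, ?_⟩
      obtain ⟨hb, hd'⟩ := hpar v hv.1
      refine tree_same_side hT hb ha ?_ hv.2
      intro he
      rw [Sym2.eq_iff] at he
      rcases he with ⟨h3, -⟩ | ⟨h3, h4⟩
      · exact hvw h3.symm
      · rw [h4] at hd
        rw [← h3] at hd'
        omega

lemma mostar_lower [Fintype V] (hT : T.IsTree) (c : V) :
    (Fintype.card V : ℤ) * (Fintype.card V - 1) - 2 * ∑ w, (T.dist w c : ℤ) ≤ mostar T := by
  have hex : ∀ v, ∃ x, v ≠ c → T.Adj v x ∧ T.dist c v = T.dist c x + 1 := by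
    intro v
    by_cases h : v = c
    · exact ⟨v, fun h' => absurd h h'⟩
    · obtain ⟨x, hx⟩ := tree_exists_closer hT h
      exact ⟨x, fun _ => hx⟩
  choose par hpar using hex
  have hsub : ((Finset.univ.erase c).image fun v => s(v, par v)) ⊆ T.edgeFinset := by
    intro e he
    simp only [Finset.mem_image, Finset.mem_erase, Finset.mem_univ, and_true] at he
    obtain ⟨v, hv, rfl⟩ := he
    simpa using (hpar v hv).1
  have hinj : Set.InjOn (fun v => s(v, par v)) ((Finset.univ.erase c : Finset V) : Set V) := by
    intro v hv v' hv' he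
    simp only [Finset.coe_erase, Finset.coe_univ, Set.mem_sdiff, Set.mem_univ, true_and,
      Set.mem_singleton_iff] at hv hv'
    simp only [Sym2.eq_iff] at he
    rcases he with ⟨h, -⟩ | ⟨h1, h2⟩
    · exact h
    · have a1 := (hpar v hv).2
      have a2 := (hpar v' hv').2
      rw [h2] at a1
      rw [← h1] at a2
      omega
  have h1 : ∑ v ∈ Finset.univ.erase c, mostarPsi T s(v, par v) ≤ mostar T := by
    rw [mostar, ← Finset.sum_image (f := mostarPsi T) hinj]
    exact Finset.sum_le_sum_of_subset hsub
  have h2 : ∀ v ∈ Finset.univ.erase c, (Fintype.card V : ℤ) -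
      2 * ((Finset.univ.filter fun w => T.dist w v < T.dist w (par v)).card : ℤ) ≤
      mostarPsi T s(v, par v) := by
    intro v hv
    have hv' : v ≠ c := by simpa using hv
    have := side_card hT (hpar v hv').1
    rw [mostarPsi_mk]
    omega
  have h3 : ∑ v ∈ Finset.univ.erase c,
      (Finset.univ.filter fun w => T.dist w v < T.dist w (par v)).card ≤ ∑ w, T.dist w c := by
    simp only [Finset.card_filter]
    rw [Finset.sum_comm]
    refine Finset.sum_le_sum fun w _ => ?_
    have := sep_card hT c par hpar _ w rfl
    rw [T.dist_comm (u := w)]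
    refine le_trans (le_of_eq ?_) this
    rw [← Finset.card_filter]
    congr 1
    ext v
    simp
  have h4 := Finset.sum_le_sum h2
  rw [Finset.sum_sub_distrib, ← Finset.mul_sum, Finset.sum_const, Finset.card_erase_of_mem
    (Finset.mem_univ c), Finset.card_univ, nsmul_eq_mul, Nat.cast_sub
    (Fintype.card_pos_iff.2 ⟨c⟩)] at h4
  have h1' := Int.ofNat_le.2 h1
  have h3' := Int.ofNat_le.2 h3
  push_cast at h4 h1' h3'
  linarith

end TreeToolkit

lemma abs_sum_bound : ∀ e : ℕ, 2 * ∑ k ∈ Finset.range e, |2 * (k : ℤ) + 1 - e| ≤ (e : ℤ) ^ 2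
  | 0 => by simp
  | 1 => by simp
  | e + 2 => by
    have ih := abs_sum_bound e
    rw [Finset.sum_range_succ, Finset.sum_range_succ']
    have h1 : ∑ k ∈ Finset.range e, |2 * ((k + 1 : ℕ) : ℤ) + 1 - ((e + 2 : ℕ) : ℤ)| =
        ∑ k ∈ Finset.range e, |2 * (k : ℤ) + 1 - e| := by
      refine Finset.sum_congr rfl fun k _ => ?_
      congr 1
      push_cast
      ring
    rw [h1]
    have h2 : |2 * ((0 : ℕ) : ℤ) + 1 - ((e + 2 : ℕ) : ℤ)| = e + 1 := by
      rw [abs_of_nonpos] <;> push_cast <;> omega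
    have h3 : |2 * ((e + 1 : ℕ) : ℤ) + 1 - ((e + 2 : ℕ) : ℤ)| = e + 1 := by
      rw [abs_of_nonneg] <;> push_cast <;> omega
    rw [h2, h3]
    push_cast
    nlinarith

section DiamPath

variable {V : Type*} {T : SimpleGraph V}

/-- Walk function from a connected graph. -/
lemma chain_dist (hT : T.IsTree) {d : ℕ} {p : ℕ → V} (hp : ∀ i < d, T.Adj (p i) (p (i + 1)))
    (i k : ℕ) (h : i + k ≤ d) : T.dist (p i) (p (i + k)) ≤ k := by
  induction k with
  | zero => simp
  | succ k ih =>
    have h1 := ih (by omega)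
    have h2 := hT.dist_eq_dist_add_one_of_adj (p i) (hp (i + k) (by omega))
    rw [show i + (k + 1) = i + k + 1 by omega]
    omega

lemma exists_diam_path [Fintype V] (hT : T.IsTree) : ∃ (d : ℕ) (p : ℕ → V),
    (∀ i < d, T.Adj (p i) (p (i + 1))) ∧ (∀ i ≤ d, T.dist (p 0) (p i) = i) ∧
    (∀ i ≤ d, T.dist (p d) (p i) = d - i) ∧ ∀ x y, T.dist x y ≤ d := by
  have := hT.connected.nonempty
  obtain ⟨x, y, hxy⟩ := T.exists_dist_eq_diam
  obtain ⟨q, hq⟩ := hT.connected.exists_walk_length_eq_dist x y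
  have hadj : ∀ i < T.diam, T.Adj (q.getVert i) (q.getVert (i + 1)) := fun i hi =>
    q.adj_getVert_succ (by omega)
  have h0 : q.getVert 0 = x := by simp
  have hd : q.getVert T.diam = y := by
    rw [← hxy, ← hq]; simp
  have key : ∀ i ≤ T.diam, T.dist (q.getVert 0) (q.getVert i) ≤ i ∧
      T.dist (q.getVert T.diam) (q.getVert i) ≤ T.diam - i ∧
      T.diam ≤ T.dist (q.getVert 0) (q.getVert i) + T.dist (q.getVert T.diam) (q.getVert i) := by
    intro i hi
    have h1 := chain_dist hT hadj 0 i (by omega)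
    have h2 := chain_dist hT hadj i (T.diam - i) (by omega)
    rw [Nat.zero_add] at h1
    rw [Nat.add_sub_cancel' hi, T.dist_comm] at h2
    refine ⟨h1, h2, ?_⟩
    have := hT.connected.dist_triangle (u := q.getVert 0) (v := q.getVert i) (w := q.getVert T.diam)
    rw [T.dist_comm (u := q.getVert T.diam)]
    rw [h0, hd] at *
    omega
  refine ⟨T.diam, q.getVert, hadj, fun i hi => ?_, fun i hi => ?_, fun x y => ?_⟩
  · have := key i hi; omega
  · have := key i hi; omega
  · exact dist_le_diam (connected_iff_ediam_ne_top.1 hT.connected)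

lemma exists_off_path [Fintype V] (hT : T.IsTree) (hodd : ∀ v, Odd (T.degree v)) {d : ℕ} {p : ℕ → V}
    (hp : ∀ i < d, T.Adj (p i) (p (i + 1))) (h0 : ∀ i ≤ d, T.dist (p 0) (p i) = i)
    (hd : ∀ i ≤ d, T.dist (p d) (p i) = d - i) : ∃ u : ℕ → V, ∀ i, 1 ≤ i → i < d →
      T.Adj (p i) (u i) ∧ T.dist (p 0) (u i) = i + 1 ∧ T.dist (p d) (u i) = d - i + 1 := by
  have hex : ∀ i, ∃ x, 1 ≤ i → i < d →
      T.Adj (p i) x ∧ T.dist (p 0) x = i + 1 ∧ T.dist (p d) x = d - i + 1 := by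
    intro i
    by_cases hi : 1 ≤ i ∧ i < d
    swap
    · exact ⟨p 0, fun a b => absurd ⟨a, b⟩ hi⟩
    obtain ⟨hi1, hi2⟩ := hi
    have a1 : T.Adj (p i) (p (i - 1)) := by
      have := hp (i - 1) (by omega)
      rw [Nat.sub_add_cancel hi1] at this
      exact this.symm
    have a2 := hp i hi2
    have e1 := h0 (i - 1) (by omega)
    have e2 := h0 i (by omega)
    have e3 := h0 (i + 1) (by omega)
    have f1 := hd (i - 1) (by omega)
    have f2 := hd i (by omega)
    have f3 := hd (i + 1) (by omega)
    have hne : p (i - 1) ≠ p (i + 1) := by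
      intro h
      rw [h] at e1
      omega
    have hsub : ({p (i - 1), p (i + 1)} : Finset V) ⊆ T.neighborFinset (p i) := by
      intro z hz
      simp only [Finset.mem_insert, Finset.mem_singleton] at hz
      rcases hz with rfl | rfl <;> simpa
    have hcard : ({p (i - 1), p (i + 1)} : Finset V).card = 2 := Finset.card_pair hne
    have hlt : ({p (i - 1), p (i + 1)} : Finset V).card < (T.neighborFinset (p i)).card := by
      have h1 := Finset.card_le_card hsub
      rw [hcard, T.card_neighborFinset_eq_degree] at *
      obtain ⟨k, hk⟩ := hodd (p i)
      omega
    obtain ⟨x, hx, hx'⟩ := Finset.exists_mem_notMem_of_card_lt_card hlt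
    simp only [Finset.mem_insert, Finset.mem_singleton, not_or] at hx'
    have ax : T.Adj (p i) x := by simpa using hx
    refine ⟨x, fun _ _ => ⟨ax, ?_, ?_⟩⟩
    · rcases hT.dist_eq_dist_add_one_of_adj (p 0) ax with h | h
      · exact absurd (tree_closer_unique hT (w := p 0) ax a1 (by omega) (by omega)) hx'.1
      · omega
    · rcases hT.dist_eq_dist_add_one_of_adj (p d) ax with h | h
      · exact absurd (tree_closer_unique hT (w := p d) ax a2 (by omega) (by omega)) hx'.2
      · omega
  choose u hu using hex
  exact ⟨u, hu⟩

lemma path_inj {d : ℕ} {p u : ℕ → V}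
    (h0 : ∀ i ≤ d, T.dist (p 0) (p i) = i)
    (hd : ∀ i ≤ d, T.dist (p d) (p i) = d - i) (hu : ∀ i, 1 ≤ i → i < d →
      T.Adj (p i) (u i) ∧ T.dist (p 0) (u i) = i + 1 ∧ T.dist (p d) (u i) = d - i + 1)
    {i j : ℕ} (hi : i < 2 * d) (hj : j < 2 * d)
    (h : (if i ≤ d then p i else u (i - d)) = (if j ≤ d then p j else u (j - d))) : i = j := by
  have g0 := congrArg (T.dist (p 0)) h
  have gd := congrArg (T.dist (p d)) h
  by_cases hid : i ≤ d <;> by_cases hjd : j ≤ d <;> simp only [hid, hjd, if_true, if_false] at g0 gd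
  · rw [h0 i hid, h0 j hjd] at g0
    exact g0
  · obtain ⟨-, q1, q2⟩ := hu (j - d) (by omega) (by omega)
    have := h0 i hid
    have := hd i hid
    omega
  · obtain ⟨-, q1, q2⟩ := hu (i - d) (by omega) (by omega)
    have := h0 j hjd
    have := hd j hjd
    omega
  · obtain ⟨-, q1, q2⟩ := hu (i - d) (by omega) (by omega)
    obtain ⟨-, q1, q2⟩ := hu (j - d) (by omega) (by omega)
    omega

lemma center_sum_le (hT : T.IsTree) {d : ℕ} {p : ℕ → V}
    (hp : ∀ i < d, T.Adj (p i) (p (i + 1))) (h0 : ∀ i ≤ d, T.dist (p 0) (p i) = i)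
    (hmax : ∀ x y, T.dist x y ≤ d) (hd1 : 1 ≤ d) (w : V) :
    T.dist w (p (d / 2)) + T.dist w (p (d - d / 2)) ≤ d := by
  have step : ∀ k < d, T.dist w (p k) = T.dist w (p (k + 1)) + 1 ∨
      T.dist w (p (k + 1)) = T.dist w (p k) + 1 := fun k hk =>
    hT.dist_eq_dist_add_one_of_adj w (hp k hk)
  have up1 : ∀ k, k + 2 ≤ d → T.dist w (p (k + 1)) = T.dist w (p k) + 1 →
      T.dist w (p (k + 2)) = T.dist w (p (k + 1)) + 1 := by
    intro k hk h
    rcases step (k + 1) (by omega) with h1 | h1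
    · exfalso
      have := tree_closer_unique hT (w := w) (hp k (by omega)).symm (hp (k + 1) (by omega))
        (by omega) (by omega)
      have e1 := h0 k (by omega)
      have e2 := h0 (k + 1 + 1) (by omega)
      rw [this] at e1
      omega
    · exact h1
  have up : ∀ k j, k + j + 1 ≤ d → T.dist w (p (k + 1)) = T.dist w (p k) + 1 →
      T.dist w (p (k + j + 1)) = T.dist w (p k) + j + 1 ∧
      T.dist w (p (k + j + 1)) = T.dist w (p (k + j)) + 1 := by
    intro k j
    induction j with
    | zero => intro _ h; exact ⟨by simpa using h, by simpa using h⟩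
    | succ j ih =>
      intro hk h
      obtain ⟨i1, i2⟩ := ih (by omega) h
      have := up1 (k + j) (by omega) i2
      rw [show k + (j + 1) + 1 = k + j + 2 by omega, show k + (j + 1) = k + j + 1 by omega]
      omega
  rcases step (d / 2) (by omega) with h | h
  · have down : ∀ j, j ≤ d / 2 → T.dist w (p (d / 2 - j)) = T.dist w (p (d / 2)) + j := by
      intro j
      induction j with
      | zero => intro _; simp
      | succ j ih =>
        intro hj
        have h1 := ih (by omega)
        have h2 := step (d / 2 - (j + 1)) (by omega)
        have h3 := up (d / 2 - (j + 1)) (j + 1) (by omega)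
        rw [show d / 2 - (j + 1) + 1 = d / 2 - j by omega] at h2 h3
        rw [show d / 2 - (j + 1) + (j + 1) = d / 2 by omega] at h3
        omega
    have h1 := down (d / 2) le_rfl
    have h2 := hmax w (p (d / 2 - d / 2))
    rcases Nat.even_or_odd' d with ⟨m, hm | hm⟩
    · rw [show d - d / 2 = d / 2 by omega]
      omega
    · rw [show d - d / 2 = d / 2 + 1 by omega]
      omega
  · have h1 := (up (d / 2) (d - d / 2 - 1) (by omega) h).1
    have h2 := hmax w (p (d / 2 + (d - d / 2 - 1) + 1))
    rcases Nat.even_or_odd' d with ⟨m, hm | hm⟩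
    · rw [show d - d / 2 = d / 2 by omega] at *
      omega
    · rw [show d - d / 2 = d / 2 + 1 by omega] at *
      omega

lemma mostar_lower_diam [Fintype V] (hT : T.IsTree) {d : ℕ} {p u : ℕ → V}
    (hp : ∀ i < d, T.Adj (p i) (p (i + 1))) (h0 : ∀ i ≤ d, T.dist (p 0) (p i) = i)
    (hd : ∀ i ≤ d, T.dist (p d) (p i) = d - i) (hmax : ∀ x y, T.dist x y ≤ d) (hd1 : 1 ≤ d)
    (hu : ∀ i, 1 ≤ i → i < d →
      T.Adj (p i) (u i) ∧ T.dist (p 0) (u i) = i + 1 ∧ T.dist (p d) (u i) = d - i + 1) :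
    2 * d ≤ Fintype.card V ∧
    (Fintype.card V : ℤ) * (Fintype.card V - 1) -
      (Fintype.card V * d - d ^ 2 + 2 * d - 1) ≤ mostar T := by
  set F : ℕ → V := fun k => if k ≤ d then p k else u (k - d) with hF
  set E : V → ℕ := fun w => T.dist w (p (d / 2)) + T.dist w (p (d - d / 2)) with hE
  have hinj : Set.InjOn F (Finset.range (2 * d) : Set ℕ) := by
    intro i hi j hj h
    simp only [Finset.coe_range, Set.mem_Iio] at hi hj
    exact path_inj h0 hd hu hi hj h
  have hcard : ((Finset.range (2 * d)).image F).card = 2 * d := by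
    rw [Finset.card_image_of_injOn hinj, Finset.card_range]
  have hle : 2 * d ≤ Fintype.card V := by
    rw [← hcard]; exact Finset.card_le_univ _
  refine ⟨hle, ?_⟩
  have hpd : ∀ i j, i ≤ d → j ≤ d → (T.dist (p i) (p j) : ℤ) ≤ |(i : ℤ) - j| := by
    intro i j hi hj
    rcases le_total i j with h | h
    · have := chain_dist hT hp i (j - i) (by omega)
      rw [Nat.add_sub_cancel' h] at this
      rw [abs_of_nonpos] <;> omega
    · have := chain_dist hT hp j (i - j) (by omega)
      rw [Nat.add_sub_cancel' h, T.dist_comm] at this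
      rw [abs_of_nonneg] <;> omega
  have hEp : ∀ k ≤ d, (E (p k) : ℤ) ≤ |2 * (k : ℤ) - d| := by
    intro k hk
    have a1 := hpd k (d / 2) hk (by omega)
    have a2 := hpd k (d - d / 2) hk (by omega)
    simp only [hE]
    push_cast
    rcases abs_cases ((k : ℤ) - ((d / 2 : ℕ) : ℤ)) with b1 | b1 <;>
    rcases abs_cases ((k : ℤ) - ((d - d / 2 : ℕ) : ℤ)) with b2 | b2 <;>
    rcases abs_cases (2 * (k : ℤ) - d) with b3 | b3 <;> omega
  have hEu : ∀ k < d - 1, (E (u (k + 1)) : ℤ) ≤ |2 * (k : ℤ) + 1 - ((d - 1 : ℕ) : ℤ)| + 2 := by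
    intro k hk
    have a0 := hEp (k + 1) (by omega)
    have ha := (hu (k + 1) (by omega) (by omega)).1
    have a1 := hT.dist_eq_dist_add_one_of_adj (p (d / 2)) ha
    have a2 := hT.dist_eq_dist_add_one_of_adj (p (d - d / 2)) ha
    have c1 : ∀ x y, T.dist x y = T.dist y x := fun x y => T.dist_comm
    simp only [hE] at a0 ⊢
    rw [c1 _ (p (d / 2)), c1 _ (p (d - d / 2))] at a0 ⊢
    have e : 2 * ((k + 1 : ℕ) : ℤ) - d = 2 * (k : ℤ) + 1 - ((d - 1 : ℕ) : ℤ) := by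
      push_cast [Nat.cast_sub hd1]; ring
    rw [e] at a0
    push_cast at a0 ⊢
    omega
  have hsum : (∑ w, (E w : ℤ)) ≤ Fintype.card V * d - d ^ 2 + 2 * d - 1 := by
    rw [← Finset.sum_add_sum_compl ((Finset.range (2 * d)).image F), Finset.sum_image hinj]
    have s1 : ∑ w ∈ ((Finset.range (2 * d)).image F)ᶜ, (E w : ℤ) ≤
        (Fintype.card V - 2 * d : ℤ) * d := by
      have := Finset.sum_le_card_nsmul ((Finset.range (2 * d)).image F)ᶜ (fun w => (E w : ℤ)) d
        (fun w _ => by exact_mod_cast center_sum_le hT hp h0 hmax hd1 w)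
      rw [Finset.card_compl, hcard, nsmul_eq_mul, Nat.cast_sub hle] at this
      push_cast at this
      exact this
    have s2 : ∑ k ∈ Finset.range (2 * d), (E (F k) : ℤ) =
        ∑ k ∈ Finset.range (d + 1), (E (p k) : ℤ) +
        ∑ k ∈ Finset.range (d - 1), (E (u (k + 1)) : ℤ) := by
      rw [show 2 * d = (d + 1) + (d - 1) by omega, Finset.sum_range_add]
      congr 1
      · refine Finset.sum_congr rfl fun k hk => ?_
        have : k ≤ d := by simpa [Nat.lt_succ_iff] using hk
        simp only [hF, this, if_true]
      · refine Finset.sum_congr rfl fun k hk => ?_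
        have : ¬ (d + 1 + k ≤ d) := by omega
        simp only [hF, this, if_false]
        rw [show d + 1 + k - d = k + 1 by omega]
    have s3 : ∑ k ∈ Finset.range (d + 1), (E (p k) : ℤ) ≤
        ∑ k ∈ Finset.range (d + 1), |2 * (k : ℤ) + 1 - ((d + 1 : ℕ) : ℤ)| := by
      refine Finset.sum_le_sum fun k hk => ?_
      have := hEp k (by simpa [Nat.lt_succ_iff] using hk)
      rw [show 2 * (k : ℤ) + 1 - ((d + 1 : ℕ) : ℤ) = 2 * k - d by push_cast; ring]
      exact this
    have s4 : ∑ k ∈ Finset.range (d - 1), (E (u (k + 1)) : ℤ) ≤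
        ∑ k ∈ Finset.range (d - 1), |2 * (k : ℤ) + 1 - ((d - 1 : ℕ) : ℤ)| + (d - 1) * 2 := by
      refine le_trans (Finset.sum_le_sum fun k hk => hEu k (by simpa using hk)) (le_of_eq ?_)
      rw [Finset.sum_add_distrib, Finset.sum_const, Finset.card_range, nsmul_eq_mul,
        Nat.cast_sub hd1]
      simp
    have b1 := abs_sum_bound (d + 1)
    have b2 := abs_sum_bound (d - 1)
    have e1 : ((d + 1 : ℕ) : ℤ) ^ 2 = (d : ℤ) ^ 2 + 2 * d + 1 := by push_cast; ring
    have e2 : ((d - 1 : ℕ) : ℤ) ^ 2 = (d : ℤ) ^ 2 - 2 * d + 1 := by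
      push_cast [Nat.cast_sub hd1]; ring
    rw [e1] at b1
    rw [e2] at b2
    rw [s2]
    nlinarith
  have l1 := mostar_lower hT (p (d / 2))
  have l2 := mostar_lower hT (p (d - d / 2))
  have hs : (∑ w, (E w : ℤ)) = ∑ w, (T.dist w (p (d / 2)) : ℤ) +
      ∑ w, (T.dist w (p (d - d / 2)) : ℤ) := by
    rw [← Finset.sum_add_distrib]
    refine Finset.sum_congr rfl fun w _ => ?_
    simp [hE]
  linarith

end DiamPath

section Caterpillar

/-- The parent function of the caterpillar. -/
def catPar (n : ℕ) (v : ℕ) : ℕ := if v ≤ n then v - 1 else v - n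

lemma catPar_lt {n : ℕ} (hn : 1 ≤ n) {v : ℕ} (hv : v ≠ 0) : catPar n v < v := by
  unfold catPar
  split_ifs <;> omega

lemma cat_adj {n : ℕ} (hn : 1 ≤ n) (a b : Fin (2 * n)) : (catC (2 * n) 0 (n - 1)).Adj a b ↔
    a.val ≠ b.val ∧ (catPar n a.val = b.val ∨ catPar n b.val = a.val) := by
  unfold catC parentGraph catPar
  rw [SimpleGraph.fromRel_adj]
  have ha := a.2
  have hb := b.2
  rw [Ne, Fin.ext_iff]
  refine and_congr_right fun _ => ?_
  have e : ∀ v, v < 2 * n → (if v < 2 * n - 0 - (n - 1) then v - 1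
    else if v < 2 * n - (n - 1) then v - (2 * n - 0 - (n - 1)) + 1
    else v - 0 - (n - 1) - 1) = if v ≤ n then v - 1 else v - n := by
    intro v hv
    split_ifs <;> omega
  beta_reduce
  rw [e _ ha, e _ hb]

lemma cat_edges {n : ℕ} (hn : 1 ≤ n) (par : Fin (2 * n) → Fin (2 * n))
    (hpar : ∀ v, (par v).val = catPar n v.val) :
    (catC (2 * n) 0 (n - 1)).edgeFinset ⊆
      (Finset.univ.erase (⟨0, by omega⟩ : Fin (2 * n))).image fun v => s(v, par v) := by
  intro e
  induction e with
  | _ a b =>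
    intro he
    rw [SimpleGraph.mem_edgeFinset, SimpleGraph.mem_edgeSet, cat_adj hn] at he
    obtain ⟨hne, h | h⟩ := he
    · refine Finset.mem_image.2 ⟨a, ?_, ?_⟩
      · simp only [Finset.mem_erase, Finset.mem_univ, and_true, ne_eq, Fin.ext_iff]
        intro h0
        rw [h0] at h hne
        simp [catPar] at h
        omega
      · have : par a = b := Fin.ext (by rw [hpar, h])
        rw [this]
    · refine Finset.mem_image.2 ⟨b, ?_, ?_⟩
      · simp only [Finset.mem_erase, Finset.mem_univ, and_true, ne_eq, Fin.ext_iff]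
        intro h0
        rw [h0] at h hne
        simp [catPar] at h
        omega
      · have : par b = a := Fin.ext (by rw [hpar, h])
        rw [this, Sym2.eq_swap]

lemma exists_cat_par {n : ℕ} (hn : 1 ≤ n) :
    ∃ par : Fin (2 * n) → Fin (2 * n), ∀ v, (par v).val = catPar n v.val := by
  refine ⟨fun v => ⟨catPar n v.val, ?_⟩, fun v => rfl⟩
  by_cases h : v.val = 0
  · rw [h]; simp [catPar]; omega
  · exact lt_trans (catPar_lt hn h) v.2

lemma cat_isTree {n : ℕ} (hn : 1 ≤ n) : (catC (2 * n) 0 (n - 1)).IsTree := by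
  obtain ⟨par, hpar⟩ := exists_cat_par hn
  have hreach : ∀ k, ∀ v : Fin (2 * n), v.val = k →
      (catC (2 * n) 0 (n - 1)).Reachable v ⟨0, by omega⟩ := by
    intro k
    induction k using Nat.strong_induction_on with
    | _ k ih =>
      intro v hv
      by_cases h0 : v.val = 0
      · have : v = ⟨0, by omega⟩ := Fin.ext h0
        rw [this]
      · have hlt := catPar_lt hn h0
        have hadj : (catC (2 * n) 0 (n - 1)).Adj v (par v) := by
          rw [cat_adj hn, hpar]
          exact ⟨by omega, Or.inl rfl⟩
        exact hadj.reachable.trans (ih _ (by omega) (par v) (hpar v))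
  have hconn : (catC (2 * n) 0 (n - 1)).Connected := by
    have : Nonempty (Fin (2 * n)) := ⟨⟨0, by omega⟩⟩
    exact ⟨fun a b => (hreach _ a rfl).trans (hreach _ b rfl).symm⟩
  rw [SimpleGraph.isTree_iff_connected_and_card]
  refine ⟨hconn, ?_⟩
  have h1 := hconn.card_vert_le_card_edgeSet_add_one
  have h2 := (Finset.card_le_card (cat_edges hn par hpar)).trans Finset.card_image_le
  rw [Finset.card_erase_of_mem (Finset.mem_univ _), Finset.card_univ, Fintype.card_fin] at h2
  rw [Nat.card_eq_fintype_card (α := (catC (2 * n) 0 (n - 1)).edgeSet),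
    ← SimpleGraph.edgeFinset_card, Nat.card_fin] at *
  omega

lemma cat_odd {n : ℕ} (hn : 1 ≤ n) (v : Fin (2 * n)) :
    Odd ((catC (2 * n) 0 (n - 1)).degree v) := by
  have hv := v.2
  rw [← SimpleGraph.card_neighborFinset_eq_degree]
  have hone : ∀ x : Fin (2 * n), (∀ w, (catC (2 * n) 0 (n - 1)).Adj v w ↔ w = x) →
      Odd ((catC (2 * n) 0 (n - 1)).neighborFinset v).card := by
    intro x hx
    have : (catC (2 * n) 0 (n - 1)).neighborFinset v = {x} := by
      ext w
      rw [SimpleGraph.mem_neighborFinset, hx, Finset.mem_singleton]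
    rw [this, Finset.card_singleton]
    exact odd_one
  by_cases h0 : v.val = 0
  · refine hone ⟨1, by omega⟩ fun w => ?_
    rw [cat_adj hn, Fin.ext_iff]
    have := w.2
    unfold catPar
    split_ifs <;> dsimp only <;> omega
  by_cases hn' : v.val = n
  · refine hone ⟨n - 1, by omega⟩ fun w => ?_
    rw [cat_adj hn, Fin.ext_iff]
    have := w.2
    unfold catPar
    split_ifs <;> dsimp only <;> omega
  by_cases hgt : n < v.val
  · refine hone ⟨v.val - n, by omega⟩ fun w => ?_
    rw [cat_adj hn, Fin.ext_iff]
    have := w.2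
    unfold catPar
    split_ifs <;> dsimp only <;> omega
  have : (catC (2 * n) 0 (n - 1)).neighborFinset v =
      {⟨v.val - 1, by omega⟩, ⟨v.val + 1, by omega⟩, ⟨n + v.val, by omega⟩} := by
    ext w
    rw [SimpleGraph.mem_neighborFinset, cat_adj hn]
    simp only [Finset.mem_insert, Finset.mem_singleton, Fin.ext_iff]
    have := w.2
    unfold catPar
    split_ifs <;> omega
  rw [this, Finset.card_eq_three.2 ⟨_, _, _, ?_, ?_, ?_, rfl⟩]
  · exact ⟨1, rfl⟩
  all_goals
    rw [Ne, Fin.ext_iff]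
    dsimp only
    omega

lemma cat_side {n : ℕ} (hn : 1 ≤ n) {i : ℕ} (hi : i < n) (a b : Fin (2 * n)) (ha : a.val = i)
    (hb : b.val = i + 1) (w : Fin (2 * n)) :
    (catC (2 * n) 0 (n - 1)).dist w a < (catC (2 * n) 0 (n - 1)).dist w b ↔
      (w.val ≤ i ∨ (n < w.val ∧ w.val ≤ n + i)) := by
  set C := catC (2 * n) 0 (n - 1) with hC
  have hT : C.IsTree := cat_isTree hn
  have hab : C.Adj a b := by
    rw [cat_adj hn]
    unfold catPar
    split_ifs <;> omega
  have down : ∀ k, ∀ w : Fin (2 * n), w.val + k = i → C.dist w a < C.dist w b := by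
    intro k
    induction k with
    | zero =>
      intro w hw
      have : w = a := Fin.ext (by omega)
      rw [this, C.dist_self]
      exact hT.connected.pos_dist_of_ne hab.ne
    | succ k ih =>
      intro w hw
      have h1 := ih ⟨w.val + 1, by omega⟩ (by dsimp only; omega)
      refine tree_same_side hT hab ?_ ?_ h1
      · rw [cat_adj hn]
        unfold catPar
        dsimp only
        split_ifs <;> omega
      · rw [Ne, Sym2.eq_iff]
        simp only [Fin.ext_iff]
        omega
  have up : ∀ k, ∀ w : Fin (2 * n), w.val = i + 1 + k → w.val ≤ n → C.dist w b < C.dist w a := by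
    intro k
    induction k with
    | zero =>
      intro w hw _
      have : w = b := Fin.ext (by omega)
      rw [this, C.dist_self]
      exact hT.connected.pos_dist_of_ne hab.ne'
    | succ k ih =>
      intro w hw hwn
      have h1 := ih ⟨w.val - 1, by omega⟩ (by dsimp only; omega) (by dsimp only; omega)
      refine tree_same_side hT hab.symm ?_ ?_ h1
      · rw [cat_adj hn]
        unfold catPar
        dsimp only
        split_ifs <;> omega
      · rw [Ne, Sym2.eq_iff]
        simp only [Fin.ext_iff]
        omega
  have hpend : ∀ h : n < w.val, C.Adj ⟨w.val - n, by omega⟩ w := by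
    intro h
    rw [cat_adj hn]
    unfold catPar
    dsimp only
    split_ifs <;> omega
  have hw := w.2
  constructor
  · intro h
    by_contra hcon
    suffices C.dist w b < C.dist w a by omega
    by_cases hwn : w.val ≤ n
    · exact up (w.val - (i + 1)) w (by omega) hwn
    · have h1 := up (w.val - n - (i + 1)) ⟨w.val - n, by omega⟩ (by dsimp only; omega)
        (by dsimp only; omega)
      refine tree_same_side hT hab.symm (hpend (by omega)) ?_ h1
      rw [Ne, Sym2.eq_iff]
      simp only [Fin.ext_iff]
      omega
  · rintro (h | ⟨h, h'⟩)
    · exact down (i - w.val) w (by omega)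
    · have h1 := down (i - (w.val - n)) ⟨w.val - n, by omega⟩ (by dsimp only; omega)
      refine tree_same_side hT hab (hpend (by omega)) ?_ h1
      rw [Ne, Sym2.eq_iff]
      simp only [Fin.ext_iff]
      omega

lemma cat_side_card {n i : ℕ} (hi : i < n) :
    (Finset.univ.filter fun w : Fin (2 * n) =>
      (w.val ≤ i ∨ (n < w.val ∧ w.val ≤ n + i))).card = 2 * i + 1 := by
  rw [← Finset.card_map Fin.valEmbedding]
  have : (Finset.univ.filter fun w : Fin (2 * n) =>
      (w.val ≤ i ∨ (n < w.val ∧ w.val ≤ n + i))).map Fin.valEmbedding =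
      Finset.range (i + 1) ∪ Finset.Ioc n (n + i) := by
    ext k
    simp only [Finset.mem_map, Finset.mem_filter, Finset.mem_univ, true_and,
      Fin.valEmbedding_apply, Finset.mem_union, Finset.mem_range, Finset.mem_Ioc]
    constructor
    · rintro ⟨w, h, rfl⟩
      omega
    · intro h
      exact ⟨⟨k, by omega⟩, by dsimp only; omega, rfl⟩
  rw [this, Finset.card_union_of_disjoint]
  · rw [Finset.card_range, Nat.card_Ioc]
    omega
  · rw [Finset.disjoint_left]
    intro k
    simp only [Finset.mem_range, Finset.mem_Ioc]
    omega

lemma cat_mostar_le {n : ℕ} (hn : 1 ≤ n) :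
    (mostar (catC (2 * n) 0 (n - 1)) : ℤ) ≤ 2 * ((n : ℤ) - 1) ^ 2 + n ^ 2 := by
  set C := catC (2 * n) 0 (n - 1) with hC
  have hT : C.IsTree := cat_isTree hn
  obtain ⟨par, hpar⟩ := exists_cat_par hn
  set B : ℕ → ℤ := fun k => if k = 0 then 0 else if k ≤ n then
    2 * |2 * ((k - 1 : ℕ) : ℤ) + 1 - n| else 2 * (n : ℤ) - 2 with hB
  have hB0 : ∀ k, 0 ≤ B k := by
    intro k
    simp only [hB]
    split_ifs
    · exact le_rfl
    · positivity
    · omega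
  have hpsi : ∀ v ∈ Finset.univ.erase (⟨0, by omega⟩ : Fin (2 * n)),
      (mostarPsi C s(v, par v) : ℤ) ≤ B v.val := by
    intro v hv
    have hv0 : v.val ≠ 0 := by
      intro h
      simp only [Finset.mem_erase, Finset.mem_univ, and_true] at hv
      exact hv (Fin.ext h)
    have hlt := catPar_lt hn hv0
    have hadj : C.Adj v (par v) := by
      rw [cat_adj hn, hpar]
      exact ⟨by omega, Or.inl rfl⟩
    have hs := side_card hT hadj
    rw [Fintype.card_fin] at hs
    rw [mostarPsi_mk]
    simp only [hB, hv0, if_false]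
    by_cases hvn : v.val ≤ n
    · simp only [hvn, if_true]
      have hp : (par v).val = v.val - 1 := by rw [hpar]; simp [catPar, hvn]
      have h1 : (Finset.univ.filter fun w => C.dist w (par v) < C.dist w v).card =
          2 * (v.val - 1) + 1 := by
        rw [← cat_side_card (n := n) (i := v.val - 1) (by omega)]
        congr 1
        ext w
        simp only [Finset.mem_filter, Finset.mem_univ, true_and]
        exact cat_side hn (by omega) _ _ hp (by omega) w
      rw [h1] at hs ⊢
      rcases abs_cases (2 * ((v.val - 1 : ℕ) : ℤ) + 1 - n) with b | b <;> omega
    · simp only [hvn, if_false]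
      have h1 : 0 < (Finset.univ.filter fun w => C.dist w v < C.dist w (par v)).card := by
        refine Finset.card_pos.2 ⟨v, ?_⟩
        simp only [Finset.mem_filter, Finset.mem_univ, true_and, C.dist_self]
        exact hT.connected.pos_dist_of_ne hadj.ne
      have h2 : 0 < (Finset.univ.filter fun w => C.dist w (par v) < C.dist w v).card := by
        refine Finset.card_pos.2 ⟨par v, ?_⟩
        simp only [Finset.mem_filter, Finset.mem_univ, true_and, C.dist_self]
        exact hT.connected.pos_dist_of_ne hadj.ne'
      omega
  have h1 : mostar C ≤ ∑ v ∈ Finset.univ.erase (⟨0, by omega⟩ : Fin (2 * n)),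
      mostarPsi C s(v, par v) := by
    refine le_trans (Finset.sum_le_sum_of_subset (cat_edges hn par hpar)) ?_
    exact Finset.sum_image_le_of_nonneg fun _ _ => Nat.zero_le _
  have h1' := Int.ofNat_le.2 h1
  push_cast at h1'
  have h2 := Finset.sum_le_sum hpsi
  have h3 : ∑ v ∈ Finset.univ.erase (⟨0, by omega⟩ : Fin (2 * n)), B v.val ≤
      ∑ k ∈ Finset.range (2 * n), B k := by
    rw [← Fin.sum_univ_eq_sum_range]
    exact Finset.sum_le_sum_of_subset_of_nonneg (Finset.subset_univ _) fun _ _ _ => hB0 _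
  have h4 : ∑ k ∈ Finset.range (2 * n), B k =
      2 * ∑ k ∈ Finset.range n, |2 * (k : ℤ) + 1 - n| + ((n : ℤ) - 1) * (2 * n - 2) := by
    rw [show 2 * n = (n + 1) + (n - 1) by omega, Finset.sum_range_add, Finset.sum_range_succ',
      Finset.mul_sum]
    have z : B 0 = 0 := by simp [hB]
    rw [z, add_zero]
    congr 1
    · refine Finset.sum_congr rfl fun k hk => ?_
      have : k + 1 ≤ n := by simpa [Nat.succ_le_iff] using hk
      simp [hB, this]
    · rw [Finset.sum_congr rfl (g := fun _ => 2 * (n : ℤ) - 2)]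
      · rw [Finset.sum_const, Finset.card_range, nsmul_eq_mul, Nat.cast_sub hn]
        push_cast
        ring
      · intro k _
        have e1 : n + 1 + k ≠ 0 := by omega
        have e2 : ¬ (n + 1 + k ≤ n) := by omega
        simp only [hB, e1, e2, if_false]
  have h5 := abs_sum_bound n
  nlinarith

end Caterpillar

/-- the tree minimizing the Mostar index among trees on 2n vertices all of
odd degree is C_{2n,0,n-1}. -/
theorem min_mostar_all_odd (n : ℕ) (T : SimpleGraph (Fin (2 * n))) (hT : T.IsTree)
    (hodd : ∀ v, Odd (T.degree v))
    (hmin : ∀ T' : SimpleGraph (Fin (2 * n)), T'.IsTree → (∀ v, Odd (T'.degree v)) →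
      mostar T ≤ mostar T') :
    Nonempty (T ≃g catC (2 * n) 0 (n - 1)) := by
  have hn : 1 ≤ n := by
    obtain ⟨x⟩ := hT.connected.nonempty
    have := x.2
    omega
  obtain ⟨d, p, hp, h0, hd, hmax⟩ := exists_diam_path hT
  obtain ⟨u, hu⟩ := exists_off_path hT hodd hp h0 hd
  have hd1 : 1 ≤ d := by
    by_contra h
    have h1 := hmax ⟨0, by omega⟩ ⟨1, by omega⟩
    have h2 : T.dist ⟨0, by omega⟩ ⟨1, by omega⟩ = 0 := by omega
    have := (hT.connected.dist_eq_zero_iff).1 h2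
    simp [Fin.ext_iff] at this
  obtain ⟨hle, hlow⟩ := mostar_lower_diam hT hp h0 hd hmax hd1 hu
  rw [Fintype.card_fin] at hle hlow
  have hup := cat_mostar_le hn
  have hm := Int.ofNat_le.2 (hmin _ (cat_isTree hn) (cat_odd hn))
  have hdn : d = n := by
    by_contra hne
    have hlt : d + 1 ≤ n := by omega
    obtain ⟨t, rfl⟩ := Nat.exists_eq_add_of_le hlt
    push_cast at hlow hup hm
    nlinarith [Int.natCast_nonneg t, Int.natCast_nonneg d]
  subst hdn
  set F : Fin (2 * d) → Fin (2 * d) := fun k => if k.val ≤ d then p k.val else u (k.val - d) with hF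
  have hinj : Function.Injective F := fun i j h =>
    Fin.ext (path_inj h0 hd hu i.2 j.2 h)
  have hbij := Finite.injective_iff_bijective.1 hinj
  have hpar : ∀ a b : Fin (2 * d), a.val ≠ b.val → catPar d a.val = b.val →
      T.Adj (F a) (F b) := by
    intro a b hne h
    have ha := a.2
    unfold catPar at h
    simp only [hF]
    by_cases had : a.val ≤ d
    · simp only [had, if_true] at h ⊢
      have hb : b.val ≤ d := by omega
      simp only [hb, if_true]
      have := hp b.val (by omega)
      rw [show b.val + 1 = a.val by omega] at this
      exact this.symm
    · simp only [had, if_false] at h ⊢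
      have hb : b.val ≤ d := by omega
      simp only [hb, if_true]
      rw [h]
      exact (hu b.val (by omega) (by omega)).1.symm
  have hhom : catC (2 * d) 0 (d - 1) ≤ T.comap F := by
    intro a b hab
    rw [cat_adj hn] at hab
    rw [SimpleGraph.comap_adj]
    rcases hab with ⟨hne, h | h⟩
    · exact hpar a b hne h
    · exact (hpar b a hne.symm h).symm
  have hac : (T.comap F).IsAcyclic :=
    SimpleGraph.IsAcyclic.comap ⟨F, fun {a b} h => h⟩ hinj hT.isAcyclic
  have hle' := (SimpleGraph.isTree_iff_maximal_isAcyclic.1 (cat_isTree hn)).2.le_of_ge hac hhom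
  have heq : T.comap F = catC (2 * d) 0 (d - 1) := le_antisymm hle' hhom
  refine ⟨SimpleGraph.Iso.symm ⟨Equiv.ofBijective F hbij, ?_⟩⟩
  intro a b
  rw [← heq]
  rfl
end

section
/- Let n and t be integers with 0 ≤ t ≤ n−4, and let T be a tree of order n with exactly t vertices of degree two that has the maximum Mostar index among all such trees. Then T is isomorphic to S_{n,n−t−1}. -/
open Finset SimpleGraph

open scoped Classical

section TreeFacts

variable {V : Type*} {G : SimpleGraph V}

lemma tree_closer_unique_s9 (hG : G.IsTree) {b u x y : V} (hx : G.Adj u x) (hy : G.Adj u y)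
    (hdx : G.dist b x + 1 = G.dist b u) (hdy : G.dist b y + 1 = G.dist b u) : x = y := by
  have hc := hG.connected
  obtain ⟨p, hp⟩ := hc.exists_walk_length_eq_dist b x
  obtain ⟨q, hq⟩ := hc.exists_walk_length_eq_dist b y
  have h1 : (p.concat hx.symm).IsPath :=
    Walk.isPath_of_length_eq_dist _ (by rw [Walk.length_concat]; omega)
  have h2 : (q.concat hy.symm).IsPath :=
    Walk.isPath_of_length_eq_dist _ (by rw [Walk.length_concat]; omega)
  have h3 := (hG.existsUnique_path b u).unique h1 h2
  have h4 := congrArg Walk.penultimate h3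
  simpa using h4

lemma tree_side (hG : G.IsTree) (w : V) {u v : V} (h : G.Adj u v) :
    G.dist w u = G.dist w v + 1 ∨ G.dist w v = G.dist w u + 1 := by
  have := hG.dist_eq_dist_add_one_of_adj w h
  omega

lemma exists_closer (hG : G.Connected) (c v : V) (hv : v ≠ c) :
    ∃ u, G.Adj v u ∧ G.dist c u + 1 = G.dist c v := by
  obtain ⟨p, hp⟩ := hG.exists_walk_length_eq_dist v c
  cases p with
  | nil => exact absurd rfl hv
  | cons h q =>
    rename_i u
    refine ⟨u, h, ?_⟩
    have h1 := dist_le q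
    have h2 := hG.dist_triangle (u := v) (v := u) (w := c)
    have h3 : G.dist v u = 1 := dist_eq_one_iff_adj.2 h
    rw [Walk.length_cons] at hp
    rw [dist_comm (u := c), dist_comm (u := c)]
    omega

lemma exists_parent (hG : G.Connected) (c : V) :
    ∃ p : V → V, ∀ v, v ≠ c → G.Adj v (p v) ∧ G.dist c (p v) + 1 = G.dist c v := by
  have : ∀ v, ∃ u, v ≠ c → G.Adj v u ∧ G.dist c u + 1 = G.dist c v := by
    intro v
    by_cases hv : v = c
    · exact ⟨v, fun h => absurd hv h⟩
    · obtain ⟨u, hu⟩ := exists_closer hG c v hv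
      exact ⟨u, fun _ => hu⟩
  choose p hp using this
  exact ⟨p, hp⟩

/-- An edge `ab` separating adjacent vertices `w`, `x` is the edge `wx`. -/
lemma tree_separate (hG : G.IsTree) {w x a b : V} (hwx : G.Adj w x) (hab : G.Adj a b)
    (h1 : G.dist w a < G.dist w b) (h2 : G.dist x b < G.dist x a) : w = a ∧ x = b := by
  have e1 := tree_side hG w hab
  have e2 := tree_side hG x hab
  have e3 := tree_side hG a hwx
  have e4 := tree_side hG b hwx
  have s1 := G.dist_comm (u := a) (v := w)
  have s2 := G.dist_comm (u := a) (v := x)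
  have s3 := G.dist_comm (u := b) (v := w)
  have s4 := G.dist_comm (u := b) (v := x)
  have hwa : w = a := by
    by_contra hne
    obtain ⟨y, hy, hyd⟩ := exists_closer hG.connected a w hne
    have e5 := tree_side hG b hy
    have e6 := tree_side hG y hab
    have s5 := G.dist_comm (u := a) (v := y)
    have s6 := G.dist_comm (u := b) (v := y)
    have : x = y := tree_closer_unique_s9 hG (b := b) hwx hy (by omega) (by omega)
    subst this
    omega
  refine ⟨hwa, ?_⟩
  subst hwa
  have : G.dist w w = 0 := dist_self
  exact hG.connected.dist_eq_zero_iff.1 (by omega : G.dist x b = 0)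

end TreeFacts

section Rooted

variable {V : Type*} [Fintype V] {G : SimpleGraph V}

lemma parent_unique (hG : G.IsTree) {c : V} {p : V → V}
    (hp : ∀ v, v ≠ c → G.Adj v (p v) ∧ G.dist c (p v) + 1 = G.dist c v)
    {u v : V} (h : G.Adj u v) (hd : G.dist c v + 1 = G.dist c u) : u ≠ c ∧ p u = v := by
  have hne : u ≠ c := by
    rintro rfl
    have : G.dist u u = 0 := dist_self
    omega
  exact ⟨hne, tree_closer_unique_s9 hG (hp u hne).1 h (hp u hne).2 hd⟩

lemma adj_iff_parent (hG : G.IsTree) {c : V} {p : V → V}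
    (hp : ∀ v, v ≠ c → G.Adj v (p v) ∧ G.dist c (p v) + 1 = G.dist c v)
    (u v : V) : G.Adj u v ↔ (u ≠ c ∧ p u = v) ∨ (v ≠ c ∧ p v = u) := by
  constructor
  · intro h
    rcases tree_side hG c h with h1 | h1
    · exact Or.inl (parent_unique hG hp h h1.symm)
    · exact Or.inr (parent_unique hG hp h.symm h1.symm)
  · rintro (⟨h, rfl⟩ | ⟨h, rfl⟩)
    · exact (hp u h).1
    · exact (hp v h).1.symm

lemma sum_edges (hG : G.IsTree) {c : V} {p : V → V}
    (hp : ∀ v, v ≠ c → G.Adj v (p v) ∧ G.dist c (p v) + 1 = G.dist c v) (f : Sym2 V → ℤ) :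
    ∑ e ∈ G.edgeFinset, f e = ∑ v ∈ Finset.univ.erase c, f s(v, p v) := by
  symm
  refine Finset.sum_bij (fun v _ => s(v, p v)) ?_ ?_ ?_ ?_
  · intro v hv
    rw [mem_edgeFinset, mem_edgeSet]
    exact (hp v (Finset.ne_of_mem_erase hv)).1
  · intro u hu v hv h
    have h1 := (hp u (Finset.ne_of_mem_erase hu)).2
    have h2 := (hp v (Finset.ne_of_mem_erase hv)).2
    rw [Sym2.eq_iff] at h
    rcases h with h | ⟨h3, h4⟩
    · exact h.1
    · rw [← h3] at h2
      rw [h4] at h1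
      omega
  · intro e he
    induction e using Sym2.ind with
    | _ u v =>
      rw [mem_edgeFinset, mem_edgeSet, adj_iff_parent hG hp] at he
      rcases he with ⟨h, rfl⟩ | ⟨h, rfl⟩
      · exact ⟨u, by simp [h], rfl⟩
      · exact ⟨v, by simp [h], Sym2.eq_swap⟩
  · intros; rfl

/-- The side of `v` on the edge `v, p v`. -/
noncomputable def sideSet (G : SimpleGraph V) (p : V → V) (v : V) : Finset V :=
  Finset.univ.filter fun w => G.dist w v < G.dist w (p v)

lemma psi_eq (hG : G.IsTree) {u v : V} (h : G.Adj u v) :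
    (mostarPsi G s(u, v) : ℤ) = |(Fintype.card V : ℤ) -
      2 * ((Finset.univ.filter fun w => G.dist w u < G.dist w v).card : ℤ)| := by
  have h1 : (Finset.univ.filter fun w => G.dist w v < G.dist w u) =
      (Finset.univ.filter fun w => ¬ G.dist w u < G.dist w v) := by
    ext w
    have := tree_side hG w h
    simp only [Finset.mem_filter, Finset.mem_univ, true_and]
    omega
  have h2 := Finset.card_filter_add_card_filter_not (s := (Finset.univ : Finset V))
    (fun w => G.dist w u < G.dist w v)
  rw [Finset.card_univ] at h2
  simp only [mostarPsi, Sym2.lift_mk, h1]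
  rw [Int.natCast_natAbs, ← h2, abs_sub_comm]
  push_cast
  congr 1
  ring

lemma mostar_eq (hG : G.IsTree) {c : V} {p : V → V}
    (hp : ∀ v, v ≠ c → G.Adj v (p v) ∧ G.dist c (p v) + 1 = G.dist c v) :
    (mostar G : ℤ) = ∑ v ∈ Finset.univ.erase c,
      |(Fintype.card V : ℤ) - 2 * ((sideSet G p v).card : ℤ)| := by
  unfold mostar
  rw [Nat.cast_sum, sum_edges hG hp]
  refine Finset.sum_congr rfl fun v hv => ?_
  exact psi_eq hG (hp v (Finset.ne_of_mem_erase hv)).1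

lemma card_anc (hG : G.IsTree) {c : V} {p : V → V}
    (hp : ∀ v, v ≠ c → G.Adj v (p v) ∧ G.dist c (p v) + 1 = G.dist c v) :
    ∀ (k : ℕ) (w : V), G.dist c w = k →
      ((Finset.univ.erase c).filter fun v => G.dist w v < G.dist w (p v)).card = k := by
  intro k
  induction k with
  | zero =>
    intro w hw
    have : c = w := hG.connected.dist_eq_zero_iff.1 hw
    subst this
    rw [Finset.card_eq_zero, Finset.filter_eq_empty_iff]
    intro v hv
    have := (hp v (Finset.ne_of_mem_erase hv)).2
    omega
  | succ k ih =>
    intro w hw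
    have hwc : w ≠ c := by
      rintro rfl
      have : G.dist w w = 0 := dist_self
      omega
    obtain ⟨ha, hd⟩ := hp w hwc
    have h1 := ih (p w) (by omega)
    have hself : G.dist w w = 0 := dist_self
    have hself' : G.dist (p w) (p w) = 0 := dist_self
    have hpos : G.dist w (p w) = 1 := dist_eq_one_iff_adj.2 ha
    have hpos' : G.dist (p w) w = 1 := dist_eq_one_iff_adj.2 ha.symm
    have h2 : ((Finset.univ.erase c).filter fun v => G.dist w v < G.dist w (p v)) =
        insert w ((Finset.univ.erase c).filter fun v => G.dist (p w) v < G.dist (p w) (p v)) := by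
      ext v
      simp only [Finset.mem_filter, Finset.mem_insert, Finset.mem_erase, Finset.mem_univ, and_true]
      by_cases hvw : v = w
      · subst hvw
        simp [hwc, hself, hpos]
      · constructor
        · rintro ⟨hv, h3⟩
          refine Or.inr ⟨hv, ?_⟩
          by_contra h4
          have h5 := tree_side hG (p w) (hp v hv).1
          exact hvw (tree_separate hG ha (hp v hv).1 h3 (by omega)).1.symm
        · rintro (h | ⟨hv, h3⟩)
          · exact absurd h hvw
          refine ⟨hv, ?_⟩
          by_contra h4
          have h5 := tree_side hG w (hp v hv).1
          have h6 := tree_separate hG ha.symm (hp v hv).1 h3 (by omega)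
          have h7 := (hp v hv).2
          rw [← h6.2, ← h6.1] at h7
          omega
    rw [h2, Finset.card_insert_of_notMem, h1]
    simp only [Finset.mem_filter, not_and]
    intro _
    omega

lemma sum_side (hG : G.IsTree) {c : V} {p : V → V}
    (hp : ∀ v, v ≠ c → G.Adj v (p v) ∧ G.dist c (p v) + 1 = G.dist c v) :
    ∑ v ∈ Finset.univ.erase c, (sideSet G p v).card = ∑ w, G.dist c w := by
  have h := Finset.sum_card_bipartiteAbove_eq_sum_card_bipartiteBelow
    (s := Finset.univ.erase c) (t := (Finset.univ : Finset V))
    (fun v w => G.dist w v < G.dist w (p v))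
  simp only [Finset.bipartiteAbove, Finset.bipartiteBelow] at h
  unfold sideSet
  rw [h]
  exact Finset.sum_congr rfl fun w _ => card_anc hG hp _ w rfl

lemma card_erase_int (c : V) : ((Finset.univ.erase c).card : ℤ) = (Fintype.card V : ℤ) - 1 := by
  have := Finset.card_erase_add_one (Finset.mem_univ c)
  rw [Finset.card_univ] at this
  omega

lemma sum_linear (hG : G.IsTree) {c : V} {p : V → V}
    (hp : ∀ v, v ≠ c → G.Adj v (p v) ∧ G.dist c (p v) + 1 = G.dist c v) :
    ∑ v ∈ Finset.univ.erase c, ((Fintype.card V : ℤ) - 2 * ((sideSet G p v).card : ℤ)) =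
      ((Fintype.card V : ℤ) - 1) * Fintype.card V - 2 * ∑ w, (G.dist c w : ℤ) := by
  rw [Finset.sum_sub_distrib, Finset.sum_const, nsmul_eq_mul, card_erase_int, ← Finset.mul_sum]
  congr 2
  exact_mod_cast sum_side hG hp

/-- Lower bound on the Mostar index by the transmission of any vertex. -/
lemma mostar_ge (hG : G.IsTree) (c : V) :
    ((Fintype.card V : ℤ) - 1) * Fintype.card V - 2 * ∑ w, (G.dist c w : ℤ) ≤ mostar G := by
  obtain ⟨p, hp⟩ := exists_parent hG.connected c
  rw [← sum_linear hG hp, mostar_eq hG hp]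
  exact Finset.sum_le_sum fun v _ => le_abs_self _

lemma side_half (hG : G.IsTree) {c : V} {p : V → V}
    (hp : ∀ v, v ≠ c → G.Adj v (p v) ∧ G.dist c (p v) + 1 = G.dist c v)
    (hmin : ∀ v, ∑ w, G.dist c w ≤ ∑ w, G.dist v w) :
    ∀ (k : ℕ) (v : V), v ≠ c → G.dist c v = k → 2 * (sideSet G p v).card ≤ Fintype.card V := by
  intro k
  induction k with
  | zero =>
    intro v hv h
    exact absurd (hG.connected.dist_eq_zero_iff.1 h).symm hv
  | succ k ih =>
    intro v hv hk
    obtain ⟨ha, hd⟩ := hp v hv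
    by_cases hc : p v = c
    · have h1 : ∀ w, (G.dist v w : ℤ) = G.dist c w + 1 -
          2 * (if G.dist w v < G.dist w (p v) then 1 else 0) := by
        intro w
        have h2 := tree_side hG w ha
        have s1 := G.dist_comm (u := v) (v := w)
        have s2 := G.dist_comm (u := c) (v := w)
        rw [hc] at *
        split_ifs <;> omega
      have h2 : ∑ w, (G.dist v w : ℤ) = ∑ w, (G.dist c w : ℤ) + Fintype.card V -
          2 * (sideSet G p v).card := by
        rw [Finset.sum_congr rfl fun w _ => h1 w, Finset.sum_sub_distrib, Finset.sum_add_distrib,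
          ← Finset.mul_sum, Finset.sum_boole]
        simp [sideSet]
      have h3 : ∑ w, (G.dist c w : ℤ) ≤ ∑ w, (G.dist v w : ℤ) := by exact_mod_cast hmin v
      omega
    · have h1 := ih (p v) hc (by omega)
      have h2 : sideSet G p v ⊆ sideSet G p (p v) := by
        intro w hw
        simp only [sideSet, Finset.mem_filter, Finset.mem_univ, true_and] at hw ⊢
        by_contra h3
        obtain ⟨ha', hd'⟩ := hp (p v) hc
        have h4 := tree_side hG w ha
        have h5 := tree_side hG w ha'
        have h6 : v = p (p v) :=
          tree_closer_unique_s9 hG (b := w) ha.symm ha' (by omega) (by omega)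
        rw [← h6] at hd'
        omega
      have h3 := Finset.card_le_card h2
      omega

/-- For a median vertex the bound is attained. -/
lemma exists_center [Nonempty V] (hG : G.IsTree) : ∃ c : V,
    (mostar G : ℤ) =
      ((Fintype.card V : ℤ) - 1) * Fintype.card V - 2 * ∑ w, (G.dist c w : ℤ) := by
  obtain ⟨c, -, hc⟩ := Finset.exists_min_image Finset.univ (fun v => ∑ w, G.dist v w)
    Finset.univ_nonempty
  refine ⟨c, ?_⟩
  obtain ⟨p, hp⟩ := exists_parent hG.connected c
  rw [← sum_linear hG hp, mostar_eq hG hp]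
  refine Finset.sum_congr rfl fun v hv => abs_of_nonneg ?_
  have := side_half hG hp (fun v => hc v (Finset.mem_univ v)) _ v (Finset.ne_of_mem_erase hv) rfl
  omega

end Rooted

section Levels

variable {V : Type*} [Fintype V] {G : SimpleGraph V}

lemma dist_iter {c : V} {p : V → V}
    (hp : ∀ v, v ≠ c → G.Adj v (p v) ∧ G.dist c (p v) + 1 = G.dist c v) :
    ∀ (j : ℕ) (v : V), j ≤ G.dist c v → G.dist c (p^[j] v) = G.dist c v - j := by
  intro j
  induction j with
  | zero => intro v _; simp
  | succ j ih =>
    intro v h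
    have hv : v ≠ c := by
      rintro rfl
      have : G.dist v v = 0 := dist_self
      omega
    have h1 := (hp v hv).2
    rw [Function.iterate_succ_apply, ih (p v) (by omega)]
    omega

lemma exists_leaf_below (hG : G.IsTree) {c : V} {p : V → V}
    (hp : ∀ v, v ≠ c → G.Adj v (p v) ∧ G.dist c (p v) + 1 = G.dist c v)
    (v : V) (hv : v ≠ c) :
    ∃ w, w ≠ c ∧ G.degree w = 1 ∧ G.dist c v ≤ G.dist c w ∧
      p^[G.dist c w - G.dist c v] w = v := by
  obtain ⟨w, hw, hmax⟩ := Finset.exists_max_image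
    (Finset.univ.filter fun w => G.dist c v ≤ G.dist c w ∧ p^[G.dist c w - G.dist c v] w = v)
    (fun w => G.dist c w) ⟨v, by simp⟩
  simp only [Finset.mem_filter, Finset.mem_univ, true_and] at hw hmax
  have hpos := hG.connected.pos_dist_of_ne hv.symm
  have hwc : w ≠ c := by
    rintro rfl
    have : G.dist w w = 0 := dist_self
    omega
  refine ⟨w, hwc, ?_, hw.1, hw.2⟩
  rw [← card_neighborFinset_eq_degree, Finset.card_eq_one]
  refine ⟨p w, ?_⟩
  ext x
  rw [mem_neighborFinset, Finset.mem_singleton, adj_iff_parent hG hp]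
  constructor
  · rintro (h | ⟨h, hx⟩)
    · exact h.2.symm
    · exfalso
      have h1 := (hp x h).2
      rw [hx] at h1
      have h2 : G.dist c x - G.dist c v = (G.dist c w - G.dist c v) + 1 := by omega
      have h3 := hmax x ⟨by omega, by rw [h2, Function.iterate_succ_apply, hx, hw.2]⟩
      omega
  · rintro rfl
    exact Or.inl ⟨hwc, rfl⟩

/-- The leaves other than the root. -/
noncomputable def leafSet (G : SimpleGraph V) (c : V) : Finset V :=
  Finset.univ.filter fun w => w ≠ c ∧ G.degree w = 1

lemma leaf_surj (hG : G.IsTree) {c : V} {p : V → V}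
    (hp : ∀ v, v ≠ c → G.Adj v (p v) ∧ G.dist c (p v) + 1 = G.dist c v) (k : ℕ) (hk : 1 ≤ k) :
    Set.SurjOn (fun w => p^[G.dist c w - k] w) (leafSet G c)
      (Finset.univ.filter fun v => G.dist c v = k : Finset V) := by
  intro v hv
  simp only [Finset.coe_filter, Finset.mem_univ, true_and, Set.mem_ofPred_eq] at hv
  have hvc : v ≠ c := by
    rintro rfl
    have : G.dist v v = 0 := dist_self
    omega
  obtain ⟨w, h1, h2, h3, h4⟩ := exists_leaf_below hG hp v hvc
  refine ⟨w, by simp [leafSet, h1, h2], ?_⟩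
  simp only
  rw [← hv]
  exact h4

lemma level_le (hG : G.IsTree) (c : V) (k : ℕ) (hk : 1 ≤ k) :
    (Finset.univ.filter fun v => G.dist c v = k).card ≤ (leafSet G c).card := by
  obtain ⟨p, hp⟩ := exists_parent hG.connected c
  exact Finset.card_le_card_of_surjOn _ (leaf_surj hG hp k hk)

lemma filter_le_succ (d : V → ℕ) (k : ℕ) :
    (Finset.univ.filter fun v => d v ≤ k + 1).card =
      (Finset.univ.filter fun v => d v ≤ k).card + (Finset.univ.filter fun v => d v = k + 1).card := by
  rw [← Finset.card_union_of_disjoint]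
  · congr 1
    ext v
    simp only [Finset.mem_filter, Finset.mem_univ, true_and, Finset.mem_union]
    omega
  · rw [Finset.disjoint_filter]
    intro v _ h
    omega

lemma filter_zero (hG : G.IsTree) (c : V) :
    (Finset.univ.filter fun v => G.dist c v ≤ 0).card = 1 := by
  rw [Finset.card_eq_one]
  refine ⟨c, ?_⟩
  ext v
  simp only [Finset.mem_filter, Finset.mem_univ, true_and, Finset.mem_singleton, Nat.le_zero,
    hG.connected.dist_eq_zero_iff]
  exact eq_comm

lemma cumul_le (hG : G.IsTree) (c : V) (r : ℕ) (hr : (leafSet G c).card ≤ r) (k : ℕ) :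
    (Finset.univ.filter fun v => G.dist c v ≤ k).card ≤ k * r + 1 := by
  induction k with
  | zero => rw [filter_zero hG]; omega
  | succ k ih =>
    rw [filter_le_succ]
    have := level_le hG c (k + 1) (by omega)
    have h2 : (k + 1) * r = k * r + r := by ring
    omega

lemma sum_eq_tail (d : V → ℕ) (K : ℕ) (hK : ∀ v, d v ≤ K) :
    ∑ v, d v = ∑ j ∈ Finset.range K, (Finset.univ.filter fun v => j < d v).card := by
  have h := Finset.sum_card_bipartiteAbove_eq_sum_card_bipartiteBelow
    (s := (Finset.univ : Finset V)) (t := Finset.range K) (fun v j => j < d v)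
  simp only [Finset.bipartiteAbove, Finset.bipartiteBelow] at h
  rw [← h]
  refine Finset.sum_congr rfl fun v _ => ?_
  have : (Finset.range K).filter (fun j => j < d v) = Finset.range (d v) := by
    ext j
    have := hK v
    simp only [Finset.mem_filter, Finset.mem_range]
    omega
  rw [this, Finset.card_range]

lemma tail_add (d : V → ℕ) (j : ℕ) : (Finset.univ.filter fun v => d v ≤ j).card +
    (Finset.univ.filter fun v => j < d v).card = Fintype.card V := by
  have := Finset.card_filter_add_card_filter_not (s := (Finset.univ : Finset V)) (fun v => d v ≤ j)
  simpa only [not_le, Finset.card_univ] using this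

lemma cumul_eq (d d' : V → ℕ) (hsum : ∑ v, d v ≤ ∑ v, d' v)
    (h : ∀ k, (Finset.univ.filter fun v => d v ≤ k).card ≤
      (Finset.univ.filter fun v => d' v ≤ k).card) (k : ℕ) :
    (Finset.univ.filter fun v => d v ≤ k).card = (Finset.univ.filter fun v => d' v ≤ k).card := by
  have b1 : ∀ v, d v ≤ ∑ v, d v + ∑ v, d' v + k + 1 := fun v => by
    have := Finset.single_le_sum (f := d) (fun _ _ => Nat.zero_le _) (Finset.mem_univ v)
    omega
  have b2 : ∀ v, d' v ≤ ∑ v, d v + ∑ v, d' v + k + 1 := fun v => by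
    have := Finset.single_le_sum (f := d') (fun _ _ => Nat.zero_le _) (Finset.mem_univ v)
    omega
  have e1 := sum_eq_tail d _ b1
  have e2 := sum_eq_tail d' _ b2
  have hle : ∀ j ∈ Finset.range (∑ v, d v + ∑ v, d' v + k + 1),
      (Finset.univ.filter fun v => j < d' v).card ≤ (Finset.univ.filter fun v => j < d v).card := by
    intro j _
    have := tail_add d j
    have := tail_add d' j
    have := h j
    omega
  have h3 := (Finset.sum_eq_sum_iff_of_le hle).1
    (le_antisymm (Finset.sum_le_sum hle) (by rw [← e1, ← e2]; exact hsum)) k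
    (by rw [Finset.mem_range]; omega)
  have := tail_add d k
  have := tail_add d' k
  omega

lemma leaves_bound (hG : G.IsTree) (c : V) (h4 : degreeTwoCount G + 4 ≤ Fintype.card V) :
    (leafSet G c).card ≤ Fintype.card V - degreeTwoCount G - 1 := by
  have hsub : (leafSet G c).card ≤ (Finset.univ.filter fun v => G.degree v = 1).card := by
    refine Finset.card_le_card fun v hv => ?_
    simp only [leafSet, Finset.mem_filter, Finset.mem_univ, true_and] at hv ⊢
    exact hv.2
  have hdisj : Disjoint (Finset.univ.filter fun v => G.degree v = 1)
      (Finset.univ.filter fun v => G.degree v = 2) := by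
    rw [Finset.disjoint_filter]
    intro v _ h
    omega
  have hcard := Finset.card_union_of_disjoint hdisj
  have hle := Finset.card_le_univ ((Finset.univ.filter fun v => G.degree v = 1) ∪
      (Finset.univ.filter fun v => G.degree v = 2))
  unfold degreeTwoCount at *
  by_contra hcon
  have hall : ((Finset.univ.filter fun v => G.degree v = 1) ∪
      (Finset.univ.filter fun v => G.degree v = 2)) = Finset.univ := by
    rw [← Finset.card_eq_iff_eq_univ]
    omega
  have hdeg : ∀ v, G.degree v = (if G.degree v = 1 then 1 else 0) +
      2 * (if G.degree v = 2 then 1 else 0) := by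
    intro v
    have hv : v ∈ ((Finset.univ.filter fun v => G.degree v = 1) ∪
      (Finset.univ.filter fun v => G.degree v = 2)) := by rw [hall]; exact Finset.mem_univ v
    simp only [Finset.mem_filter, Finset.mem_univ, true_and, Finset.mem_union] at hv
    rcases hv with hv | hv <;> simp [hv]
  have hs := G.sum_degrees_eq_twice_card_edges
  have he := hG.card_edgeFinset
  rw [Finset.sum_congr rfl fun v _ => hdeg v, Finset.sum_add_distrib, ← Finset.mul_sum,
    Finset.sum_boole, Finset.sum_boole] at hs
  rw [hall, Finset.card_univ] at hcard
  simp only [Nat.cast_id] at hs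
  omega

end Levels

section Spider

/-- Parent function of the spider. -/
def spPar (r v : ℕ) : ℕ := if v ≤ r then 0 else v - r

lemma spider_adj {n r : ℕ} (u v : Fin n) : (spiderS n r).Adj u v ↔
    u ≠ v ∧ (spPar r u.val = v.val ∨ spPar r v.val = u.val) := by
  simp only [spiderS, parentGraph, SimpleGraph.fromRel_adj, spPar]

lemma spPar_lt {r v : ℕ} (hr : 1 ≤ r) (hv : 1 ≤ v) : spPar r v < v := by
  unfold spPar
  split_ifs <;> omega

lemma spPar_ceil {r v : ℕ} (hr : 1 ≤ r) (hv : 1 ≤ v) :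
    (spPar r v + r - 1) / r + 1 = (v + r - 1) / r := by
  unfold spPar
  split_ifs with h
  · rw [Nat.div_eq_of_lt (by omega)]
    symm
    exact Nat.div_eq_of_lt_le (by omega) (by omega)
  · rw [← Nat.add_div_right _ (by omega)]
    congr 1
    omega

lemma spider_walk {n r : ℕ} (hn : 0 < n) (hr : 1 ≤ r) : ∀ (k : ℕ) (hk : k < n),
    ∃ w : (spiderS n r).Walk ⟨0, hn⟩ ⟨k, hk⟩, w.length = (k + r - 1) / r := by
  intro k
  induction k using Nat.strong_induction_on with
  | _ k ih =>
    intro hk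
    rcases Nat.eq_zero_or_pos k with rfl | hpos
    · exact ⟨Walk.nil, by rw [Walk.length_nil, Nat.div_eq_of_lt (by omega)]⟩
    · have hlt := spPar_lt hr hpos
      obtain ⟨w, hw⟩ := ih (spPar r k) hlt (by omega)
      have hadj : (spiderS n r).Adj ⟨spPar r k, by omega⟩ ⟨k, hk⟩ := by
        rw [spider_adj]
        refine ⟨?_, Or.inr rfl⟩
        intro h
        have := congrArg Fin.val h
        simp only at this
        omega
      exact ⟨w.concat hadj, by rw [Walk.length_concat, hw, spPar_ceil hr hpos]⟩

lemma spider_connected {n r : ℕ} (hn : 0 < n) (hr : 1 ≤ r) : (spiderS n r).Connected := by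
  have : Nonempty (Fin n) := ⟨⟨0, hn⟩⟩
  refine SimpleGraph.Connected.mk fun u v => ?_
  obtain ⟨w, -⟩ := spider_walk hn hr u.val u.isLt
  obtain ⟨w', -⟩ := spider_walk hn hr v.val v.isLt
  exact ⟨w.reverse.append w'⟩

lemma spider_isTree {n r : ℕ} (hn : 0 < n) (hr : 1 ≤ r) : (spiderS n r).IsTree := by
  have hc := spider_connected hn hr
  rw [isTree_iff_connected_and_card]
  refine ⟨hc, le_antisymm ?_ hc.card_vert_le_card_edgeSet_add_one⟩
  have hlt : ∀ v : Fin n, spPar r v.val < n := by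
    intro v
    have := v.isLt
    unfold spPar
    split_ifs <;> omega
  have hsub : (spiderS n r).edgeFinset ⊆ (Finset.univ.erase (⟨0, hn⟩ : Fin n)).image
      (fun v => s(v, ⟨spPar r v.val, hlt v⟩)) := by
    intro e he
    induction e using Sym2.ind with
    | _ u v =>
      rw [mem_edgeFinset, mem_edgeSet, spider_adj] at he
      have key : ∀ a b : Fin n, a ≠ b → spPar r a.val = b.val → a ≠ ⟨0, hn⟩ := by
        rintro a b hab h rfl
        apply hab
        apply Fin.ext
        simpa [spPar] using h
      rw [Finset.mem_image]
      obtain ⟨hne, h | h⟩ := he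
      · refine ⟨u, by simp [key u v hne h], ?_⟩
        simp only [h]
      · refine ⟨v, by simp [key v u hne.symm h], ?_⟩
        rw [Sym2.eq_swap]
        simp only [h]
  have h1 := Finset.card_le_card hsub
  have h2 := h1.trans Finset.card_image_le
  rw [Finset.card_erase_of_mem (Finset.mem_univ _), Finset.card_univ, Fintype.card_fin] at h2
  rw [Nat.card_eq_fintype_card, Nat.card_eq_fintype_card, Fintype.card_fin, ← edgeFinset_card]
  omega

lemma spider_degree_zero {n r : ℕ} (hn : r + 1 ≤ n) :
    (spiderS n r).degree ⟨0, by omega⟩ = r := by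
  have : (spiderS n r).neighborFinset ⟨0, by omega⟩ =
      Finset.univ.filter (fun v : Fin n => 1 ≤ v.val ∧ v.val ≤ r) := by
    ext v
    rw [mem_neighborFinset, spider_adj]
    simp only [Finset.mem_filter, Finset.mem_univ, true_and, spPar, ne_eq, Fin.ext_iff]
    have := v.isLt
    split_ifs <;> omega
  rw [← card_neighborFinset_eq_degree, this]
  have h2 : (Finset.univ.filter (fun v : Fin n => 1 ≤ v.val ∧ v.val ≤ r)).image Fin.val =
      Finset.Icc 1 r := by
    ext v
    simp only [Finset.mem_image, Finset.mem_filter, Finset.mem_univ, true_and, Finset.mem_Icc]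
    constructor
    · rintro ⟨a, h, rfl⟩; exact h
    · intro h; exact ⟨⟨v, by omega⟩, h, rfl⟩
  rw [← Finset.card_image_of_injective _ Fin.val_injective, h2, Nat.card_Icc]
  omega

lemma spider_degree_pos {n r : ℕ} (hr : 1 ≤ r) (v : Fin n) (hv : 1 ≤ v.val) :
    (spiderS n r).degree v = if v.val + r < n then 2 else 1 := by
  have hlt := spPar_lt hr hv
  have hvn := v.isLt
  split_ifs with h
  · have : (spiderS n r).neighborFinset v = {⟨spPar r v, by omega⟩, ⟨v + r, h⟩} := by
      ext w
      rw [mem_neighborFinset, spider_adj]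
      simp only [Finset.mem_insert, Finset.mem_singleton, spPar, ne_eq, Fin.ext_iff]
      split_ifs <;> omega
    rw [← card_neighborFinset_eq_degree, this, Finset.card_pair]
    simp only [ne_eq, Fin.ext_iff]
    omega
  · have : (spiderS n r).neighborFinset v = {⟨spPar r v, by omega⟩} := by
      ext w
      have := w.isLt
      rw [mem_neighborFinset, spider_adj]
      simp only [Finset.mem_singleton, spPar, ne_eq, Fin.ext_iff]
      split_ifs <;> omega
    rw [← card_neighborFinset_eq_degree, this, Finset.card_singleton]

lemma spider_two {n r : ℕ} (hr : 3 ≤ r) (hn : r + 1 ≤ n) :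
    degreeTwoCount (spiderS n r) = n - r - 1 := by
  unfold degreeTwoCount
  have : (Finset.univ.filter fun v => (spiderS n r).degree v = 2).image Fin.val =
      Finset.Ico 1 (n - r) := by
    ext k
    simp only [Finset.mem_image, Finset.mem_filter, Finset.mem_univ, true_and, Finset.mem_Ico]
    constructor
    · rintro ⟨v, hv, rfl⟩
      rcases Nat.eq_zero_or_pos v.val with h0 | h0
      · exfalso
        have hv0 : v = ⟨0, by omega⟩ := Fin.ext h0
        rw [hv0, spider_degree_zero hn] at hv
        omega
      · rw [spider_degree_pos (by omega) v h0] at hv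
        split_ifs at hv <;> omega
    · intro h
      refine ⟨⟨k, by omega⟩, ?_, rfl⟩
      rw [spider_degree_pos (by omega) _ h.1, if_pos]
      simp only
      omega
  rw [← Finset.card_image_of_injective _ Fin.val_injective, this, Nat.card_Ico]

lemma ceil_count {n r : ℕ} (hr : 1 ≤ r) (k : ℕ) :
    (Finset.univ.filter fun v : Fin n => (v.val + r - 1) / r ≤ k).card = min n (k * r + 1) := by
  have : (Finset.univ.filter fun v : Fin n => (v.val + r - 1) / r ≤ k).image Fin.val =
      Finset.range (min n (k * r + 1)) := by
    have key : ∀ v : ℕ, (v + r - 1) / r ≤ k ↔ v < k * r + 1 := by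
      intro v
      rw [← Nat.lt_succ_iff, Nat.div_lt_iff_lt_mul (by omega), Nat.succ_mul]
      omega
    ext v
    simp only [Finset.mem_image, Finset.mem_filter, Finset.mem_univ, true_and, Finset.mem_range,
      key, lt_min_iff]
    constructor
    · rintro ⟨a, h, rfl⟩; exact ⟨a.isLt, h⟩
    · intro h; exact ⟨⟨v, h.1⟩, h.2, rfl⟩
  rw [← Finset.card_image_of_injective _ Fin.val_injective, this, Finset.card_range]

end Spider

section Iso

lemma exists_label {V : Type*} [Fintype V] (L A : Finset V) (hAL : A ⊆ L) (r s : ℕ)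
    (hL : L.card = r) (hA : A.card = s) :
    ∃ σ : V → ℕ, Set.InjOn σ L ∧ (∀ x ∈ L, 1 ≤ σ x ∧ σ x ≤ r) ∧ ∀ x ∈ A, σ x ≤ s := by
  have hB : (L \ A).card = r - s := by rw [Finset.card_sdiff_of_subset hAL, hL, hA]
  have hsr : s ≤ r := by rw [← hL, ← hA]; exact Finset.card_le_card hAL
  have f1 : ∀ x (h : x ∈ A), (A.equivFin ⟨x, h⟩).val < s := fun x h =>
    lt_of_lt_of_eq (A.equivFin ⟨x, h⟩).isLt hA
  have f2 : ∀ x (h : x ∈ L \ A), ((L \ A).equivFin ⟨x, h⟩).val < r - s := fun x h =>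
    lt_of_lt_of_eq ((L \ A).equivFin ⟨x, h⟩).isLt hB
  have i1 : ∀ x y (h : x ∈ A) (h' : y ∈ A),
      (A.equivFin ⟨x, h⟩).val = (A.equivFin ⟨y, h'⟩).val → x = y := fun x y h h' e => by
    have := A.equivFin.injective (Fin.ext e)
    exact congrArg Subtype.val this
  have i2 : ∀ x y (h : x ∈ L \ A) (h' : y ∈ L \ A),
      ((L \ A).equivFin ⟨x, h⟩).val = ((L \ A).equivFin ⟨y, h'⟩).val → x = y := fun x y h h' e => by
    have := (L \ A).equivFin.injective (Fin.ext e)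
    exact congrArg Subtype.val this
  refine ⟨fun x => if h : x ∈ A then (A.equivFin ⟨x, h⟩).val + 1 else
    if h : x ∈ L \ A then ((L \ A).equivFin ⟨x, h⟩).val + 1 + s else 0, ?_, ?_, ?_⟩
  · intro x hx y hy hxy
    simp only at hxy
    by_cases hxA : x ∈ A <;> by_cases hyA : y ∈ A
    · rw [dif_pos hxA, dif_pos hyA] at hxy
      exact i1 x y hxA hyA (by omega)
    · have hyB : y ∈ L \ A := Finset.mem_sdiff.2 ⟨hy, hyA⟩
      rw [dif_pos hxA, dif_neg hyA, dif_pos hyB] at hxy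
      have := f1 x hxA
      omega
    · have hxB : x ∈ L \ A := Finset.mem_sdiff.2 ⟨hx, hxA⟩
      rw [dif_pos hyA, dif_neg hxA, dif_pos hxB] at hxy
      have := f1 y hyA
      omega
    · have hyB : y ∈ L \ A := Finset.mem_sdiff.2 ⟨hy, hyA⟩
      have hxB : x ∈ L \ A := Finset.mem_sdiff.2 ⟨hx, hxA⟩
      rw [dif_neg hxA, dif_pos hxB, dif_neg hyA, dif_pos hyB] at hxy
      exact i2 x y hxB hyB (by omega)
  · intro x hx
    by_cases hxA : x ∈ A
    · have := f1 x hxA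
      simp only [dif_pos hxA]
      omega
    · have hxB : x ∈ L \ A := Finset.mem_sdiff.2 ⟨hx, hxA⟩
      have := f2 x hxB
      simp only [dif_neg hxA, dif_pos hxB]
      omega
  · intro x hxA
    have := f1 x hxA
    simp only [dif_pos hxA]
    omega

lemma iso_of_cumul {n r : ℕ} (hr : 1 ≤ r) (hrn : r + 1 ≤ n) {G : SimpleGraph (Fin n)}
    (hG : G.IsTree) (c : Fin n) (hleaf : (leafSet G c).card ≤ r)
    (hcum : ∀ k, (Finset.univ.filter fun v => G.dist c v ≤ k).card = min n (k * r + 1)) :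
    Nonempty (G ≃g spiderS n r) := by
  obtain ⟨p, hp⟩ := exists_parent hG.connected c
  have hself : G.dist c c = 0 := dist_self
  have hpos : ∀ v, v ≠ c → 1 ≤ G.dist c v := fun v hv => hG.connected.pos_dist_of_ne hv.symm
  have hzero : ∀ v, G.dist c v = 0 → v = c := fun v hv => (hG.connected.dist_eq_zero_iff.1 hv).symm
  -- level one
  have hL1 : (Finset.univ.filter fun v => G.dist c v = 1).card = r := by
    have h1 := filter_le_succ (fun v => G.dist c v) 0
    have h2 := hcum 0
    have h3 := hcum 1
    simp only [zero_add] at h1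
    rw [h1, h2, zero_mul, one_mul] at h3
    omega
  have hinj1 : Set.InjOn (fun w => p^[G.dist c w - 1] w) (leafSet G c) := by
    apply Finset.injOn_of_card_image_eq
    refine le_antisymm Finset.card_image_le ?_
    refine hleaf.trans ?_
    rw [← hL1]
    refine Finset.card_le_card fun v hv => ?_
    obtain ⟨w, hw, hwv⟩ := leaf_surj hG hp 1 le_rfl hv
    exact Finset.mem_image.2 ⟨w, hw, hwv⟩
  set anc : Fin n → Fin n := fun w => p^[G.dist c w - 1] w with hanc
  have hanc_inj : ∀ x y, x ≠ c → y ≠ c → G.dist c x = G.dist c y → anc x = anc y → x = y := by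
    intro x y hx hy hxy h
    obtain ⟨a, ha1, ha2, ha3, ha4⟩ := exists_leaf_below hG hp x hx
    obtain ⟨b, hb1, hb2, hb3, hb4⟩ := exists_leaf_below hG hp y hy
    have hx1 := hpos x hx
    have hy1 := hpos y hy
    have ea : anc a = anc x := by
      simp only [hanc]
      have e : G.dist c a - 1 = (G.dist c x - 1) + (G.dist c a - G.dist c x) := by omega
      rw [e, Function.iterate_add_apply, ha4]
    have eb : anc b = anc y := by
      simp only [hanc]
      have e : G.dist c b - 1 = (G.dist c y - 1) + (G.dist c b - G.dist c y) := by omega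
      rw [e, Function.iterate_add_apply, hb4]
    have hab : a = b := hinj1 (by simp [leafSet, ha1, ha2]) (by simp [leafSet, hb1, hb2])
      (ea.trans (h.trans eb.symm))
    subst hab
    rw [← ha4, ← hb4, hxy]
  have hanc_level : ∀ x, x ≠ c → G.dist c (anc x) = 1 := by
    intro x hx
    have := hpos x hx
    simp only [hanc]
    rw [dist_iter hp _ _ (by omega)]
    omega
  have hanc_mem : ∀ x, x ≠ c → anc x ∈ Finset.univ.filter fun v => G.dist c v = 1 := fun x hx =>
    Finset.mem_filter.2 ⟨Finset.mem_univ _, hanc_level x hx⟩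
  have hanc_par : ∀ x, 2 ≤ G.dist c x → anc (p x) = anc x := by
    intro x hx
    have hxc : x ≠ c := by rintro rfl; omega
    have h1 := (hp x hxc).2
    simp only [hanc]
    have h2 : G.dist c x - 1 = (G.dist c (p x) - 1) + 1 := by omega
    rw [h2, Function.iterate_succ_apply]
  -- the last level
  obtain ⟨q, s, hqs, hs⟩ : ∃ q s, n - 1 = q * r + s ∧ s < r :=
    ⟨(n - 1) / r, (n - 1) % r, by rw [mul_comm]; exact (Nat.div_add_mod _ _).symm,
      Nat.mod_lt _ (by omega)⟩
  have hqr : (q + 1) * r = q * r + r := by ring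
  have hle : ∀ v, G.dist c v ≤ q + 1 := by
    have h1 := hcum (q + 1)
    rw [hqr, min_eq_left (by omega)] at h1
    have h2 : (Finset.univ.filter fun v => G.dist c v ≤ q + 1) = Finset.univ := by
      rw [← Finset.card_eq_iff_eq_univ, h1, Fintype.card_fin]
    intro v
    have h3 := Finset.mem_univ v
    rw [← h2] at h3
    exact (Finset.mem_filter.1 h3).2
  have hLq : (Finset.univ.filter fun v => G.dist c v = q + 1).card = s := by
    have h1 := filter_le_succ (fun v => G.dist c v) q
    have h2 := hcum q
    have h3 := hcum (q + 1)
    rw [h1, h2, hqr] at h3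
    omega
  have hLqne : ∀ v, G.dist c v = q + 1 → v ≠ c := by
    rintro v hv rfl
    omega
  obtain ⟨σ, hσ1, hσ2, hσ3⟩ := exists_label (Finset.univ.filter fun v => G.dist c v = 1)
    ((Finset.univ.filter fun v => G.dist c v = q + 1).image anc) (by
      intro x hx
      obtain ⟨v, hv, rfl⟩ := Finset.mem_image.1 hx
      simp only [Finset.mem_filter, Finset.mem_univ, true_and] at hv ⊢
      exact hanc_level v (hLqne v hv)) r s hL1 (by
      rw [Finset.card_image_of_injOn, hLq]
      intro x hx y hy hxy
      simp only [Finset.coe_filter, Finset.mem_univ, true_and, Set.mem_ofPred_eq] at hx hy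
      exact hanc_inj x y (hLqne x hx) (hLqne y hy) (by omega) hxy)
  have hσ2' : ∀ v, v ≠ c → 1 ≤ σ (anc v) ∧ σ (anc v) ≤ r := fun v hv =>
    hσ2 _ (hanc_mem v hv)
  -- the labelling
  have hbound : ∀ v, v ≠ c → σ (anc v) + (G.dist c v - 1) * r < n := by
    intro v hv
    have h1 := hσ2' v hv
    have h2 := hpos v hv
    rcases Nat.lt_or_ge (G.dist c v) (q + 1) with h3 | h3
    · have h4 : (G.dist c v - 1 + 1) * r ≤ q * r := Nat.mul_le_mul_right r (by omega)
      rw [Nat.succ_mul] at h4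
      omega
    · have h4 : G.dist c v = q + 1 := le_antisymm (hle v) h3
      have h5 := hσ3 (anc v) (Finset.mem_image_of_mem _ (by simp [h4]))
      rw [h4, Nat.add_sub_cancel]
      omega
  obtain ⟨g, hgc, hgv⟩ : ∃ g : Fin n → Fin n, (g c).val = 0 ∧
      ∀ v, v ≠ c → (g v).val = σ (anc v) + (G.dist c v - 1) * r := by
    refine ⟨fun v => if h : v = c then ⟨0, by omega⟩ else
      ⟨σ (anc v) + (G.dist c v - 1) * r, hbound v h⟩, by simp, fun v hv => by simp [hv]⟩
  have hinj : Function.Injective g := by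
    intro u v h
    have h' := congrArg Fin.val h
    by_cases hu : u = c <;> by_cases hv : v = c
    · rw [hu, hv]
    · subst hu
      have := hσ2' v hv
      rw [hgc, hgv v hv] at h'
      omega
    · subst hv
      have := hσ2' u hu
      rw [hgc, hgv u hu] at h'
      omega
    · rw [hgv u hu, hgv v hv] at h'
      have a1 := hσ2' u hu
      have a2 := hσ2' v hv
      have a3 := hpos u hu
      have a4 := hpos v hv
      have hd : G.dist c u - 1 = G.dist c v - 1 := by
        rcases Nat.lt_trichotomy (G.dist c u - 1) (G.dist c v - 1) with h1 | h1 | h1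
        · have := Nat.mul_le_mul_right r (Nat.succ_le_of_lt h1)
          rw [Nat.succ_mul] at this
          omega
        · exact h1
        · have := Nat.mul_le_mul_right r (Nat.succ_le_of_lt h1)
          rw [Nat.succ_mul] at this
          omega
      rw [hd] at h'
      have h6 : anc u = anc v := hσ1 (hanc_mem u hu) (hanc_mem v hv)
        (by omega)
      exact hanc_inj u v hu hv (by omega) h6
  have hpar : ∀ v, v ≠ c → spPar r (g v).val = (g (p v)).val := by
    intro v hv
    have a1 := hσ2' v hv
    have a2 := hpos v hv
    have a3 := (hp v hv).2
    rcases Nat.lt_or_ge (G.dist c v) 2 with h | h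
    · have h1 : p v = c := hzero _ (by omega)
      have h2 : G.dist c v - 1 = 0 := by omega
      rw [h1, hgc, hgv v hv, h2, zero_mul, spPar, if_pos (by omega)]
    · have h1 : p v ≠ c := by
        intro h1
        rw [h1] at a3
        omega
      have h2 : G.dist c v - 1 = (G.dist c (p v) - 1) + 1 := by omega
      rw [hgv v hv, hgv _ h1, hanc_par v h, h2, Nat.succ_mul, spPar, if_neg (by omega)]
      omega
  have hbij : Function.Bijective g := Finite.injective_iff_bijective.1 hinj
  refine ⟨⟨Equiv.ofBijective g hbij, ?_⟩⟩
  intro u v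
  simp only [Equiv.ofBijective_apply]
  rw [spider_adj, adj_iff_parent hG hp]
  have key : ∀ u v, g u ≠ g v → spPar r (g u).val = (g v).val → u ≠ c ∧ p u = v := by
    intro u v hne h
    have hu : u ≠ c := by
      rintro rfl
      apply hne
      apply Fin.ext
      rw [← h, hgc]
      simp [spPar]
    refine ⟨hu, hinj (Fin.ext ?_)⟩
    rw [← hpar u hu, h]
  have key2 : ∀ u, u ≠ c → g u ≠ g (p u) := fun u hu h => (hp u hu).1.ne (hinj h)
  constructor
  · rintro ⟨hne, h | h⟩
    · exact Or.inl (key u v hne h)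
    · exact Or.inr (key v u hne.symm h)
  · rintro (⟨h, rfl⟩ | ⟨h, rfl⟩)
    · exact ⟨key2 u h, Or.inl (hpar u h)⟩
    · exact ⟨(key2 v h).symm, Or.inr (hpar v h)⟩

end Iso

/-- the tree maximizing the Mostar index among trees of order n with exactly
t vertices of degree two (0 ≤ t ≤ n-4) is S_{n,n-t-1}. -/
theorem max_mostar_degree_two (n t : ℕ) (ht : t ≤ n - 4) (hn : 4 ≤ n)
    (T : SimpleGraph (Fin n)) (hT : T.IsTree) (h2 : degreeTwoCount T = t)
    (hmax : ∀ T' : SimpleGraph (Fin n), T'.IsTree → degreeTwoCount T' = t →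
      mostar T' ≤ mostar T) :
    Nonempty (T ≃g spiderS n (n - t - 1)) := by
  obtain ⟨r, hr⟩ : ∃ r, r = n - t - 1 := ⟨_, rfl⟩
  rw [← hr]
  have hn0 : 0 < n := by omega
  have hne : Nonempty (Fin n) := ⟨⟨0, hn0⟩⟩
  have hS : (spiderS n r).IsTree := spider_isTree hn0 (by omega)
  have hS2 : degreeTwoCount (spiderS n r) = t := by
    rw [spider_two (by omega) (by omega)]
    omega
  have hle := hmax _ hS hS2
  obtain ⟨c, hc⟩ := exists_center hT
  have hge := mostar_ge hS ⟨0, hn0⟩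
  have hleaf : (leafSet T c).card ≤ r := by
    have := leaves_bound hT c (by rw [h2, Fintype.card_fin]; omega)
    rw [h2, Fintype.card_fin] at this
    omega
  have hsum : ∑ v, T.dist c v ≤ ∑ v : Fin n, (v.val + r - 1) / r := by
    have h1 : ∑ v, (spiderS n r).dist ⟨0, hn0⟩ v ≤ ∑ v : Fin n, (v.val + r - 1) / r := by
      refine Finset.sum_le_sum fun v _ => ?_
      obtain ⟨w, hw⟩ := spider_walk hn0 (show 1 ≤ r by omega) v.val v.isLt
      rw [← hw]
      exact dist_le w
    refine le_trans ?_ h1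
    have h3 : (mostar (spiderS n r) : ℤ) ≤ mostar T := by exact_mod_cast hle
    have h4 : ∑ v, (T.dist c v : ℤ) ≤ ∑ v, ((spiderS n r).dist ⟨0, hn0⟩ v : ℤ) := by linarith
    exact_mod_cast h4
  refine iso_of_cumul (by omega) (by omega) hT c hleaf fun k => ?_
  rw [← ceil_count (show 1 ≤ r by omega) k]
  refine cumul_eq (fun v => T.dist c v) (fun v : Fin n => (v.val + r - 1) / r) hsum ?_ k
  intro k
  rw [ceil_count (show 1 ≤ r by omega) k]
  refine le_min ?_ (cumul_le hT c r hleaf k)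
  exact (Finset.card_le_univ _).trans (by rw [Fintype.card_fin])
end
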